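/- Let (R,m) be a regular Noetherian local ring of dimension d > 0 with infinite residue field and let I be an m-primary ideal. Then e_1(I) ≤ ē_1(I) ≤ (d−1)·min{ e_0(I)/2 , e_0(I) − λ(R/Ī) }, where Ī is the integral closure of I. -/

import Mathlib

open Finset IsLocalRing

/-- The length of an `R`-module `M`: the Krull dimension of its lattice of submodules,
i.e. the supremum of the lengths of chains of submodules of `M`. -/
noncomputable def moduleLength (R M : Type*) [CommRing R] [AddCommGroup M] [Module R M] :
    WithBot ℕ∞ :=
  Order.krullDim (Submodule R M)

/-- A local Noetherian ring is Cohen-Macaulay if its depth equals its Krull dimension,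
equivalently, if it admits a regular sequence in the maximal ideal whose length is the
Krull dimension. -/
def IsCohenMacaulayLocalRing (R : Type*) [CommRing R] [IsLocalRing R] : Prop :=
  ∃ rs : List R, (∀ x ∈ rs, x ∈ maximalIdeal R) ∧
    RingTheory.Sequence.IsRegular R rs ∧ (rs.length : WithBot ℕ∞) = ringKrullDim R

/-- `e 0, …, e d` are the Hilbert coefficients of an ideal `I` in a ring of dimension `d`:
for all large `n`, `λ(R ⧸ I^(n+1)) = ∑_{i=0}^{d} (-1)^i (e i) C(n+d-i, d-i)`. -/
def HasHilbertCoeffs {R : Type*} [CommRing R] (I : Ideal R) (d : ℕ) (e : ℕ → ℤ) : Prop :=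
  ∃ N : ℕ, ∀ n ≥ N, ∃ l : ℕ,
    moduleLength R (R ⧸ I ^ (n + 1)) = (l : WithBot ℕ∞) ∧
    (l : ℤ) = ∑ i ∈ Finset.range (d + 1), (-1 : ℤ) ^ i * e i * ((n + d - i).choose (d - i))

/-- The set of elements integral over an ideal `I`: all `y` satisfying an equation
`y^m + a₁ y^(m-1) + ⋯ + a_m = 0` with `a_j ∈ I^j`. -/
def integralOverIdeal {R : Type*} [CommRing R] (I : Ideal R) : Set R :=
  {y | ∃ m : ℕ, 0 < m ∧ ∃ a : ℕ → R, (∀ j, 1 ≤ j → j ≤ m → a j ∈ I ^ j) ∧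
    y ^ m + ∑ j ∈ Finset.Icc 1 m, a j * y ^ (m - j) = 0}

/-- The integral closure of an ideal `I`, as an ideal (the set of elements integral over
`I` is an ideal, so it coincides with the ideal it generates). -/
noncomputable def idealIntegralClosure {R : Type*} [CommRing R] (I : Ideal R) : Ideal R :=
  Ideal.span (integralOverIdeal I)

/-- `ebar 0, …, ebar d` are the normal Hilbert coefficients of `I`: for all large `n`,
`λ(R ⧸ closure(I^(n+1))) = ∑_{i=0}^{d} (-1)^i (ebar i) C(n+d-i, d-i)`. -/
def HasNormalHilbertCoeffs {R : Type*} [CommRing R] (I : Ideal R) (d : ℕ) (ebar : ℕ → ℤ) :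
    Prop :=
  ∃ N : ℕ, ∀ n ≥ N, ∃ l : ℕ,
    moduleLength R (R ⧸ idealIntegralClosure (I ^ (n + 1))) = (l : WithBot ℕ∞) ∧
    (l : ℤ) = ∑ i ∈ Finset.range (d + 1), (-1 : ℤ) ^ i * ebar i * ((n + d - i).choose (d - i))

universe u

section CoreBS
variable {R : Type u} [CommRing R]

/-- `x` acts null-homotopically on the filtered differential module `E`. -/
def FilteredNullHomotopic {E : Type u} [AddCommGroup E] [Module R E] {J : Ideal R}
    (dE : E →ₗ[R] E) (F : J.Filtration E) (x : R) : Prop :=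
  ∃ c : E →ₗ[R] E, (∀ v, dE (c v) + c (dE v) = x • v) ∧ ∀ m, ∀ v ∈ F.N m, c v ∈ F.N (m + 1)

lemma FilteredNullHomotopic.of_mem_span {E : Type u} [AddCommGroup E] [Module R E] {J : Ideal R}
    {dE : E →ₗ[R] E} {F : J.Filtration E} {x : R}
    (hx : x ∈ Ideal.span {x | FilteredNullHomotopic dE F x}) : FilteredNullHomotopic dE F x := by
  refine Submodule.span_induction (p := fun x _ => FilteredNullHomotopic dE F x) ?_ ?_ ?_ ?_ hx
  · intro x hx; exact hx
  · exact ⟨0, by simp, by simp⟩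
  · rintro x y _ _ ⟨c, hc, hc'⟩ ⟨c₂, hc₂, hc₂'⟩
    refine ⟨c + c₂, fun v => ?_, fun m v hv => ?_⟩
    · have := congrArg₂ (· + ·) (hc v) (hc₂ v)
      simp only [LinearMap.add_apply, map_add, add_smul] at this ⊢
      rw [← this]; abel
    · exact add_mem (hc' m v hv) (hc₂' m v hv)
  · rintro a x _ ⟨c, hc, hc'⟩
    refine ⟨a • c, fun v => ?_, fun m v hv => ?_⟩
    · simp only [LinearMap.smul_apply, map_smul, smul_eq_mul, mul_smul, ← hc v, smul_add]
    · exact Submodule.smul_mem _ _ (hc' m v hv)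

lemma exists_filtered_acyclic [IsNoetherianRing R] {E : Type u} [AddCommGroup E] [Module R E]
    [Module.Finite R E] {J : Ideal R} (dE : E →ₗ[R] E) (F : J.Filtration E) (hF : F.Stable)
    (hJ : J ≤ Ideal.span {x | FilteredNullHomotopic dE F x}) :
    ∃ n0, ∀ n ≥ n0, ∀ v ∈ F.N n, dE v = 0 → ∃ w ∈ F.N n, dE w = v := by
  have hst : (J.trivialFiltration (LinearMap.ker dE) ⊓ F).Stable := hF.inter_left _
  obtain ⟨n0, hn0⟩ := hst.exists_pow_smul_eq_of_ge
  refine ⟨n0 + 1, fun n hn v hv hdv => ?_⟩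
  obtain ⟨n, rfl⟩ : ∃ k, n = k + 1 := ⟨n - 1, by omega⟩
  have h1 : v ∈ (J.trivialFiltration (LinearMap.ker dE) ⊓ F).N (n + 1) := ⟨hdv, hv⟩
  have h2 : (J.trivialFiltration (LinearMap.ker dE) ⊓ F).N (n + 1) =
      J • (J.trivialFiltration (LinearMap.ker dE) ⊓ F).N n := by
    rw [hn0 (n + 1) (by omega), hn0 n (by omega), ← Submodule.smul_assoc, smul_eq_mul, ← pow_succ']
    congr 2; omega
  rw [h2] at h1
  have h3 : J • (J.trivialFiltration (LinearMap.ker dE) ⊓ F).N n ≤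
      Submodule.map dE (F.N (n + 1)) := by
    rw [Submodule.smul_le]
    intro x hx z hz
    obtain ⟨c, hc, hc'⟩ := FilteredNullHomotopic.of_mem_span (hJ hx)
    refine ⟨c z, hc' n z hz.2, ?_⟩
    have h4 := hc z
    have h5 : dE z = 0 := hz.1
    rw [h5, map_zero, add_zero] at h4
    exact h4
  exact h3 h1


/-- Filtration of `E × E` used on the mapping cone of multiplication by an element of `J`. -/
def coneFiltration {E : Type u} [AddCommGroup E] [Module R E] {J : Ideal R}
    (F : J.Filtration E) : J.Filtration (E × E) where
  N m := (F.N m).prod (F.N (m - 1))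
  mono m := Submodule.prod_mono (F.mono m) (F.antitone (by omega))
  smul_le m := by
    rw [Submodule.smul_le]
    rintro r hr ⟨a, b⟩ ⟨ha, hb⟩
    refine ⟨F.smul_le m (Submodule.smul_mem_smul hr ha), ?_⟩
    have h1 := F.smul_le (m - 1) (Submodule.smul_mem_smul hr hb)
    exact F.antitone (by omega : m + 1 - 1 ≤ m - 1 + 1) h1

lemma coneFiltration_stable {E : Type u} [AddCommGroup E] [Module R E] {J : Ideal R}
    {F : J.Filtration E} (hF : F.Stable) : (coneFiltration F).Stable := by
  obtain ⟨n0, hn0⟩ := hF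
  refine ⟨n0 + 1, fun n hn => le_antisymm ((coneFiltration F).smul_le n) ?_⟩
  obtain ⟨n, rfl⟩ : ∃ k, n = k + 1 := ⟨n - 1, by omega⟩
  rintro ⟨a, b⟩ ⟨ha, hb⟩
  have ha' : a ∈ J • F.N (n + 1) := by rw [hn0 _ (by omega)]; exact ha
  have hb' : b ∈ J • F.N n := by rw [hn0 _ (by omega)]; exact hb
  have h1 : (LinearMap.inl R E E) a ∈ J • (coneFiltration F).N (n + 1) := by
    have : (LinearMap.inl R E E) a ∈ (J • F.N (n + 1)).map (LinearMap.inl R E E) := ⟨a, ha', rfl⟩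
    rw [Submodule.map_smul''] at this
    refine Submodule.smul_mono le_rfl ?_ this
    rintro _ ⟨z, hz, rfl⟩
    exact ⟨hz, zero_mem _⟩
  have h2 : (LinearMap.inr R E E) b ∈ J • (coneFiltration F).N (n + 1) := by
    have : (LinearMap.inr R E E) b ∈ (J • F.N n).map (LinearMap.inr R E E) := ⟨b, hb', rfl⟩
    rw [Submodule.map_smul''] at this
    refine Submodule.smul_mono le_rfl ?_ this
    rintro _ ⟨z, hz, rfl⟩
    exact ⟨zero_mem _, hz⟩
  have := add_mem h1 h2
  simpa using this

/-- The differential of the mapping cone of multiplication by `x`. -/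
def coneDiff {E : Type u} [AddCommGroup E] [Module R E] (dE : E →ₗ[R] E) (x : R) :
    E × E →ₗ[R] E × E :=
  (dE.coprod (x • LinearMap.id)).prod ((0 : E →ₗ[R] E).coprod (-dE))

lemma coneDiff_apply {E : Type u} [AddCommGroup E] [Module R E] (dE : E →ₗ[R] E) (x : R)
    (a b : E) : coneDiff dE x (a, b) = (dE a + x • b, -dE b) := by
  simp [coneDiff]

lemma FilteredNullHomotopic.cone {E : Type u} [AddCommGroup E] [Module R E] {J : Ideal R}
    {dE : E →ₗ[R] E} {F : J.Filtration E} {z : R} (x : R) (h : FilteredNullHomotopic dE F z) :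
    FilteredNullHomotopic (coneDiff dE x) (coneFiltration F) z := by
  obtain ⟨c, hc, hc'⟩ := h
  refine ⟨c.prodMap (-c), ?_, ?_⟩
  · rintro ⟨a, b⟩
    simp only [coneDiff_apply, LinearMap.prodMap_apply, LinearMap.neg_apply, Prod.mk_add_mk,
      map_add, map_neg, Prod.smul_mk, ← hc, map_smul, smul_neg, neg_neg]
    congr 1; abel
  · rintro m ⟨a, b⟩ ⟨ha, hb⟩
    refine ⟨hc' m a ha, neg_mem ?_⟩
    exact F.antitone (by omega) (hc' _ b hb)

lemma FilteredNullHomotopic.cone_self {E : Type u} [AddCommGroup E] [Module R E] {J : Ideal R}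
    (dE : E →ₗ[R] E) (F : J.Filtration E) (x : R) :
    FilteredNullHomotopic (coneDiff dE x) (coneFiltration F) x := by
  refine ⟨LinearMap.inr R E E ∘ₗ LinearMap.fst R E E, ?_, ?_⟩
  · rintro ⟨a, b⟩
    simp [coneDiff_apply]
  · rintro m ⟨a, b⟩ ⟨ha, hb⟩
    exact ⟨zero_mem _, ha⟩

lemma exists_homotopy_of_acyclic {D : Type u} [AddCommGroup D] [Module R D] (dD : D →ₗ[R] D)
    (B : Submodule R D)
    (hB : ∀ v ∈ B, dD v = 0 → ∃ w ∈ B, dD w = v) (r : ℕ → ℕ)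
    (dP : ∀ i, (Fin (r (i + 1)) → R) →ₗ[R] (Fin (r i) → R))
    (hdP : ∀ i v, dP i (dP (i + 1) v) = 0)
    (f : ∀ i, (Fin (r i) → R) →ₗ[R] D) (hfB : ∀ i v, f i v ∈ B) (hf0 : ∀ v, dD (f 0 v) = 0)
    (hfs : ∀ i v, dD (f (i + 1) v) = f i (dP i v)) :
    ∃ h : ∀ i, (Fin (r i) → R) →ₗ[R] D, (∀ v, f 0 v = dD (h 0 v)) ∧
      ∀ i v, f (i + 1) v = dD (h (i + 1) v) + h i (dP i v) := by
  have lift : ∀ (k : ℕ) (φ : (Fin k → R) →ₗ[R] D), (∀ v, φ v ∈ B) → (∀ v, dD (φ v) = 0) →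
      ∃ h : (Fin k → R) →ₗ[R] D, (∀ v, h v ∈ B) ∧ ∀ v, dD (h v) = φ v := by
    intro k φ h1 h2
    choose w hwB hw using fun j => hB (φ (Pi.single j 1)) (h1 _) (h2 _)
    refine ⟨(Pi.basisFun R (Fin k)).constr R w, fun v => ?_, fun v => ?_⟩
    · rw [Module.Basis.constr_apply_fintype]
      exact sum_mem fun i _ => B.smul_mem _ (hwB i)
    · have : dD ∘ₗ (Pi.basisFun R (Fin k)).constr R w = φ := by
        refine (Pi.basisFun R (Fin k)).ext fun j => ?_
        simp [hw]
      exact LinearMap.congr_fun this v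
  let S : ℕ → Type u := fun i => {h : (Fin (r i) → R) →ₗ[R] D //
    (∀ v, h v ∈ B) ∧ ∀ v, dD (h (dP i v)) = f i (dP i v)}
  have s0 : ∃ h : S 0, ∀ v, f 0 v = dD (h.1 v) := by
    obtain ⟨h, hB, hh⟩ := lift _ (f 0) (hfB 0) hf0
    exact ⟨⟨h, hB, fun v => hh _⟩, fun v => (hh v).symm⟩
  have ss : ∀ i (h : S i), ∃ h' : S (i + 1), ∀ v, f (i + 1) v = dD (h'.1 v) + h.1 (dP i v) := by
    intro i h
    obtain ⟨h', hB', hh'⟩ := lift _ (f (i + 1) - h.1 ∘ₗ dP i)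
      (fun v => sub_mem (hfB _ _) (h.2.1 _)) (fun v => by simp [hfs, h.2.2])
    refine ⟨⟨h', hB', fun v => ?_⟩, fun v => ?_⟩
    · rw [hh']; simp [hdP]
    · rw [hh']; simp
  choose h0 hh0 using s0
  choose hs hhs using ss
  let H : ∀ i, S i := fun i => Nat.rec h0 (fun i h => hs i h) i
  exact ⟨fun i => (H i).1, hh0, fun i v => hhs i (H i) v⟩

theorem exists_homotopy_mod [IsNoetherianRing R] {J : Ideal R} (xs : List R) :
    ∀ (E : Type u) [AddCommGroup E] [Module R E] [Module.Finite R E]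
      (dE : E →ₗ[R] E) (F : J.Filtration E), (∀ v, dE (dE v) = 0) → F.Stable →
      (∀ m, ∀ v ∈ F.N m, dE v ∈ F.N m) → (∀ x ∈ xs, x ∈ J) →
      J ≤ Ideal.span ({x | FilteredNullHomotopic dE F x} ∪ {x | x ∈ xs}) →
      ∃ n0, ∀ n ≥ n0, ∀ (D : Type u) [AddCommGroup D] [Module R D] (dD : D →ₗ[R] D)
        (π : D →ₗ[R] E), (∀ v, dD (dD v) = 0) → (∀ v, π (dD v) = dE (π v)) →
        (∀ v, dD v = 0 → π v = 0 → ∃ w, π w = 0 ∧ dD w = v) →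
        (∀ v ∈ F.N n, ∃ w, π w = v) →
        ∀ (r : ℕ → ℕ) (dP : ∀ i, (Fin (r (i + 1)) → R) →ₗ[R] (Fin (r i) → R)),
          (∀ i v, dP i (dP (i + 1) v) = 0) →
          ∀ f : ∀ i, (Fin (r i) → R) →ₗ[R] D, (∀ i v, π (f i v) ∈ F.N (n + xs.length)) →
            (∀ v, dD (f 0 v) = 0) → (∀ i v, dD (f (i + 1) v) = f i (dP i v)) →
            ∃ h : ∀ i, (Fin (r i) → R) →ₗ[R] D,
              f 0 - dD ∘ₗ h 0 ∈ Ideal.ofList xs • (⊤ : Submodule R ((Fin (r 0) → R) →ₗ[R] D)) ∧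
              ∀ i, f (i + 1) - dD ∘ₗ h (i + 1) - h i ∘ₗ dP i ∈
                Ideal.ofList xs • (⊤ : Submodule R ((Fin (r (i + 1)) → R) →ₗ[R] D)) := by
  induction xs with
  | nil =>
    intro E _ _ _ dE F hdE hF hdF _ hJ
    obtain ⟨n0, hn0⟩ := exists_filtered_acyclic dE F hF (by simpa using hJ)
    refine ⟨n0, fun n hn D _ _ dD π hdD hπ hker hrange r dP hdP f hfn hf0 hfs => ?_⟩
    have hB : ∀ v ∈ (F.N n).comap π, dD v = 0 → ∃ w ∈ (F.N n).comap π, dD w = v := by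
      intro v hv hdv
      obtain ⟨w, hw, hdw⟩ := hn0 n hn (π v) hv (by rw [← hπ, hdv, map_zero])
      obtain ⟨u, hu⟩ := hrange w hw
      obtain ⟨t, ht, hdt⟩ := hker (v - dD u) (by simp [hdv, hdD]) (by simp [hπ, hu, hdw])
      refine ⟨u + t, ?_, ?_⟩
      · simpa [ht, hu] using hw
      · simp [hdt]
    obtain ⟨h, h1, h2⟩ := exists_homotopy_of_acyclic dD ((F.N n).comap π) hB r dP hdP f
      (by simpa using hfn) hf0 hfs
    refine ⟨h, ?_, fun i => ?_⟩
    · have : f 0 - dD ∘ₗ h 0 = 0 := LinearMap.ext fun v => by simp [h1]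
      rw [this]; exact zero_mem _
    · have : f (i + 1) - dD ∘ₗ h (i + 1) - h i ∘ₗ dP i = 0 := LinearMap.ext fun v => by simp [h2]
      rw [this]; exact zero_mem _
  | cons x xs ih =>
    intro E _ _ _ dE F hdE hF hdF hxJ hJ
    obtain ⟨n0, hn0⟩ := ih (E × E) (coneDiff dE x) (coneFiltration F)
      (by rintro ⟨a, b⟩; simp [coneDiff_apply, hdE]) (coneFiltration_stable hF)
      (by
        rintro m ⟨a, b⟩ ⟨ha, hb⟩
        rw [coneDiff_apply]
        refine ⟨add_mem (hdF _ _ ha) ?_, neg_mem (hdF _ _ hb)⟩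
        exact F.antitone (by omega)
          (F.smul_le _ (Submodule.smul_mem_smul (hxJ x (by simp)) hb)))
      (fun y hy => hxJ y (by simp [hy]))
      (hJ.trans (Ideal.span_mono (by
        rintro y (hy | hy)
        · exact Or.inl (hy.cone x)
        · rcases List.mem_cons.1 hy with rfl | hy
          · exact Or.inl (FilteredNullHomotopic.cone_self dE F _)
          · exact Or.inr hy)))
    refine ⟨n0, fun n hn D _ _ dD π hdD hπ hker hrange r dP hdP f hfn hf0 hfs => ?_⟩
    obtain ⟨h, h1, h2⟩ := hn0 (n + 1) (by omega) (D × D) (coneDiff dD x) (π.prodMap π)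
      (by rintro ⟨a, b⟩; simp [coneDiff_apply, hdD])
      (by rintro ⟨a, b⟩; simp [coneDiff_apply, hπ])
      (by
        rintro ⟨a, b⟩ hv hv'
        simp only [coneDiff_apply, Prod.mk_eq_zero, LinearMap.prodMap_apply, neg_eq_zero] at hv hv'
        obtain ⟨w, hw, hdw⟩ := hker b hv.2 hv'.2
        obtain ⟨u, hu, hdu⟩ := hker (a + x • w) (by simp [hdw, hv.1]) (by simp [hw, hv'.1])
        refine ⟨(u, -w), by simp [hw, hu], ?_⟩
        simp [coneDiff_apply, hdu, hdw])
      (by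
        rintro ⟨a, b⟩ ⟨ha, hb⟩
        obtain ⟨u, hu⟩ := hrange a (F.mono _ ha)
        obtain ⟨w, hw⟩ := hrange b hb
        exact ⟨(u, w), by simp [hu, hw]⟩)
      r dP hdP (fun i => LinearMap.inl R D D ∘ₗ f i)
      (by
        intro i v
        refine ⟨?_, ?_⟩
        · have := hfn i v
          simp only [List.length_cons] at this
          simpa [add_assoc, add_comm 1] using this
        · simp)
      (by intro v; simp [coneDiff_apply, hf0])
      (by intro i v; simp [coneDiff_apply, hfs])
    refine ⟨fun i => LinearMap.fst R D D ∘ₗ h i, ?_, fun i => ?_⟩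
    · have h3 := Submodule.mem_map_of_mem (f := LinearMap.llcomp R (Fin (r 0) → R) (D × D) D
        (LinearMap.fst R D D)) h1
      rw [Submodule.map_smul''] at h3
      have h4 : x • (LinearMap.snd R D D ∘ₗ h 0) ∈ Ideal.ofList (x :: xs) •
          (⊤ : Submodule R ((Fin (r 0) → R) →ₗ[R] D)) :=
        Submodule.smul_mem_smul (Ideal.subset_span (by simp)) trivial
      have h5 := add_mem (Submodule.smul_mono (Ideal.span_mono (by
        intro y hy; simp only [List.mem_cons, Set.mem_ofPred_eq] at hy ⊢; exact Or.inr hy)) le_top h3)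
        h4
      convert h5 using 1
      refine LinearMap.ext fun v => ?_
      rcases hab : h 0 v with ⟨a, b⟩
      simp [coneDiff_apply, hab]
      abel
    · have h3 := Submodule.mem_map_of_mem (f := LinearMap.llcomp R (Fin (r (i + 1)) → R) (D × D) D
        (LinearMap.fst R D D)) (h2 i)
      rw [Submodule.map_smul''] at h3
      have h4 : x • (LinearMap.snd R D D ∘ₗ h (i + 1)) ∈ Ideal.ofList (x :: xs) •
          (⊤ : Submodule R ((Fin (r (i + 1)) → R) →ₗ[R] D)) :=
        Submodule.smul_mem_smul (Ideal.subset_span (by simp)) trivial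
      have h5 := add_mem (Submodule.smul_mono (Ideal.span_mono (by
        intro y hy; simp only [List.mem_cons, Set.mem_ofPred_eq] at hy ⊢; exact Or.inr hy)) le_top h3)
        h4
      convert h5 using 1
      refine LinearMap.ext fun v => ?_
      rcases hab : h (i + 1) v with ⟨a, b⟩
      simp [coneDiff_apply, hab]
      abel

end CoreBS

section Resolution
variable {R : Type u} [CommRing R]

/-- The ideal generated by the first `i` terms of a sequence. -/
def initialIdeal (y : ℕ → R) (i : ℕ) : Ideal R := Ideal.span (y '' Set.Iio i)

lemma initialIdeal_zero (y : ℕ → R) : initialIdeal y 0 = ⊥ := by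
  simp [initialIdeal]

lemma initialIdeal_succ (y : ℕ → R) (i : ℕ) :
    initialIdeal y (i + 1) = initialIdeal y i ⊔ Ideal.span {y i} := by
  have : Set.Iio (i + 1) = Set.Iio i ∪ {i} := by ext; simp
  rw [initialIdeal, this, Set.image_union, Ideal.span_union, Set.image_singleton]
  rfl

/-- The first `j` terms of the sequence `y` form a weakly regular sequence on `N`. -/
def RegularUpTo {V : Type u} [AddCommGroup V] [Module R V] (y : ℕ → R) (N : Submodule R V)
    (j : ℕ) : Prop :=
  ∀ i < j, ∀ v ∈ N, y i • v ∈ initialIdeal y i • N → v ∈ initialIdeal y i • N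

lemma mem_smul_top_pi_iff {n : ℕ} {I : Ideal R} {v : Fin n → R} :
    v ∈ I • (⊤ : Submodule R (Fin n → R)) ↔ ∀ i, v i ∈ I := by
  constructor
  · intro h i
    have := Submodule.mem_map_of_mem (f := LinearMap.proj (R := R) (φ := fun _ : Fin n => R) i) h
    rw [Submodule.map_smul''] at this
    have h2 := Submodule.smul_mono (le_refl I) le_top this
    simpa using h2
  · intro h
    have : v = ∑ i, v i • (Pi.single i 1 : Fin n → R) := by
      simpa using (pi_eq_sum_univ' v)
    rw [this]
    exact sum_mem fun i _ => Submodule.smul_mem_smul (h i) trivial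

lemma RegularUpTo.pi {y : ℕ → R} {d : ℕ} (hy : RegularUpTo y (⊤ : Submodule R R) d) (n : ℕ) :
    RegularUpTo y (⊤ : Submodule R (Fin n → R)) d := by
  intro i hi v _ hv
  rw [mem_smul_top_pi_iff] at hv ⊢
  intro j
  have := hy i hi (v j) trivial (by simpa using hv j)
  simpa using this

lemma ker_inf_initialIdeal_smul_le {V W : Type u} [AddCommGroup V] [Module R V] [AddCommGroup W]
    [Module R W] {y : ℕ → R} {j : ℕ} (π : V →ₗ[R] W)
    (h : RegularUpTo y (LinearMap.range π) j) :
    ∀ i ≤ j, LinearMap.ker π ⊓ initialIdeal y i • (⊤ : Submodule R V) ≤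
      initialIdeal y i • LinearMap.ker π := by
  intro i
  induction i with
  | zero => intro _; simp [initialIdeal_zero]
  | succ i ih =>
    rintro hi v ⟨hv, hv'⟩
    rw [initialIdeal_succ, Submodule.sup_smul] at hv' ⊢
    obtain ⟨u, hu, w', hw', rfl⟩ := Submodule.mem_sup.1 hv'
    obtain ⟨w, -, rfl⟩ := (Submodule.mem_smul_pointwise_iff_exists _ _ _).1
      (by rwa [Submodule.ideal_span_singleton_smul] at hw')
    have h1 : y i • π w ∈ initialIdeal y i • LinearMap.range π := by
      have h2 : y i • π w = - π u := by
        have : π (u + y i • w) = 0 := hv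
        rw [map_add, map_smul] at this
        exact eq_neg_of_add_eq_zero_right this
      rw [h2, LinearMap.range_eq_map, ← Submodule.map_smul'']
      exact neg_mem (Submodule.mem_map_of_mem hu)
    have h2 := h i (by omega) (π w) ⟨w, rfl⟩ h1
    rw [LinearMap.range_eq_map, ← Submodule.map_smul''] at h2
    obtain ⟨t, ht, htw⟩ := h2
    have hz : w - t ∈ LinearMap.ker π := by simp [htw]
    have h3 : u + y i • t ∈ initialIdeal y i • LinearMap.ker π := by
      refine ih (by omega) ⟨?_, add_mem hu (Submodule.smul_mem _ _ ht)⟩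
      have : π (u + y i • w) = 0 := hv
      simpa [htw] using this
    refine Submodule.mem_sup.2 ⟨_, h3, y i • (w - t), ?_, by rw [smul_sub]; abel⟩
    exact Submodule.smul_mem_smul (Ideal.subset_span rfl) hz

lemma RegularUpTo.ker {V W : Type u} [AddCommGroup V] [Module R V] [AddCommGroup W]
    [Module R W] {y : ℕ → R} {d j : ℕ} (π : V →ₗ[R] W)
    (hV : RegularUpTo y (⊤ : Submodule R V) d)
    (h : RegularUpTo y (LinearMap.range π) j) (hj : j < d) :
    RegularUpTo y (LinearMap.ker π) (j + 1) := by
  intro i hi v hv hyv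
  exact ker_inf_initialIdeal_smul_le π h i (by omega)
    ⟨hv, hV i (by omega) v trivial (Submodule.smul_mono le_rfl le_top hyv)⟩

lemma exists_minimal_presentation [IsNoetherianRing R] [IsLocalRing R] {k : ℕ}
    (N : Submodule R (Fin k → R)) : ∃ (n : ℕ) (π : (Fin n → R) →ₗ[R] (Fin k → R)),
      LinearMap.range π = N ∧ LinearMap.ker π ≤ maximalIdeal R • ⊤ := by
  classical
  have hex : ∃ n : ℕ, ∃ b : Fin n → (Fin k → R), Submodule.span R (Set.range b) = N :=
    Submodule.fg_iff_exists_fin_generating_family.1 (IsNoetherian.noetherian N)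
  obtain ⟨b, hb⟩ := Nat.find_spec hex
  have hmin := fun m hm => Nat.find_min hex (m := m) hm
  obtain ⟨n, hn⟩ : ∃ n, n = Nat.find hex := ⟨_, rfl⟩
  rw [← hn] at hmin
  revert b
  rw [← hn]
  intro b hb
  refine ⟨n, Fintype.linearCombination R b, by rw [Fintype.range_linearCombination, hb], ?_⟩
  intro v hv
  rw [mem_smul_top_pi_iff]
  by_contra! hcon
  obtain ⟨i, hi⟩ := hcon
  obtain ⟨n, rfl⟩ : ∃ m, n = m + 1 := ⟨n - 1, by have := i.2; omega⟩
  refine hmin n (by omega) ⟨b ∘ i.succAbove, le_antisymm ?_ ?_⟩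
  · rw [← hb]; exact Submodule.span_mono (Set.range_comp_subset_range _ _)
  · rw [← hb, Submodule.span_le]
    have hmem : ∀ j, b (i.succAbove j) ∈ Submodule.span R (Set.range (b ∘ i.succAbove)) :=
      fun j => Submodule.subset_span ⟨j, rfl⟩
    rintro _ ⟨j, rfl⟩
    rcases Fin.eq_self_or_eq_succAbove i j with rfl | ⟨j, rfl⟩
    · have hu : IsUnit (v j) := by simpa using hi
      have h0 : ∑ l, v l • b l = 0 := by simpa [Fintype.linearCombination_apply] using hv
      rw [Fin.sum_univ_succAbove _ j] at h0
      have h1 : v j • b j ∈ Submodule.span R (Set.range (b ∘ j.succAbove)) := by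
        rw [eq_neg_of_add_eq_zero_left h0]
        exact neg_mem (sum_mem fun l _ => Submodule.smul_mem _ _ (hmem l))
      exact (Submodule.smul_mem_iff_of_isUnit _ hu).1 h1
    · exact hmem j

theorem exists_finite_free_resolution [IsNoetherianRing R] [IsLocalRing R] {y : ℕ → R} {d : ℕ}
    (hy : RegularUpTo y (⊤ : Submodule R R) d) (hym : initialIdeal y d = maximalIdeal R)
    (M : Submodule R (Fin 1 → R)) :
    ∃ (r : ℕ → ℕ) (ε : (Fin (r 0) → R) →ₗ[R] (Fin 1 → R))
      (dP : ∀ i, (Fin (r (i + 1)) → R) →ₗ[R] (Fin (r i) → R)),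
      LinearMap.range ε = M ∧ LinearMap.range (dP 0) = LinearMap.ker ε ∧
      (∀ i, LinearMap.range (dP (i + 1)) = LinearMap.ker (dP i)) ∧ r (d + 1) = 0 := by
  let T := Σ (n k : ℕ), (Fin n → R) →ₗ[R] (Fin k → R)
  choose nn pp hp hp' using fun (k : ℕ) (N : Submodule R (Fin k → R)) =>
    exists_minimal_presentation N
  let S : ℕ → T := fun i => Nat.rec ⟨nn 1 M, 1, pp 1 M⟩
    (fun _ t => ⟨nn t.1 (LinearMap.ker t.2.2), t.1, pp t.1 (LinearMap.ker t.2.2)⟩) i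
  have hmin : ∀ i, LinearMap.ker (S i).2.2 ≤ maximalIdeal R • ⊤ := by
    intro i
    cases i with
    | zero => exact hp' _ _
    | succ i => exact hp' _ _
  have hrange : ∀ i, LinearMap.range (S (i + 1)).2.2 = LinearMap.ker (S i).2.2 :=
    fun i => hp _ _
  have hreg : ∀ i ≤ d, RegularUpTo y (LinearMap.range (S i).2.2) i := by
    intro i
    induction i with
    | zero => intro _ i hi; omega
    | succ i ih =>
      intro hi
      rw [hrange]
      exact RegularUpTo.ker _ (hy.pi _) (ih (by omega)) (by omega)
  have hker : LinearMap.ker (S d).2.2 = ⊥ := by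
    refine Submodule.eq_bot_of_le_smul_of_le_jacobson_bot (maximalIdeal R) _
      (IsNoetherian.noetherian _) ?_ (IsLocalRing.maximalIdeal_le_jacobson _)
    have := ker_inf_initialIdeal_smul_le _ (hreg d le_rfl) d le_rfl
    rw [hym] at this
    exact le_trans (le_inf le_rfl (hmin d)) this
  refine ⟨fun i => (S i).1, pp 1 M, fun i => (S (i + 1)).2.2, hp _ _, hrange 0,
    fun i => hrange (i + 1), ?_⟩
  have h1 : LinearMap.range (S (d + 1)).2.2 = ⊥ := by rw [hrange, hker]
  have h2 : LinearMap.ker (S (d + 1)).2.2 = ⊤ := by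
    rw [LinearMap.ker_eq_top, ← LinearMap.range_eq_bot]; exact h1
  by_contra h0
  have h3 := hmin (d + 1)
  rw [h2] at h3
  have h4 := h3 (x := Pi.single ⟨0, Nat.pos_of_ne_zero h0⟩ 1) trivial
  rw [mem_smul_top_pi_iff] at h4
  have := h4 ⟨0, Nat.pos_of_ne_zero h0⟩
  simp at this
end Resolution

section BrianconSkoda
variable {R : Type u} [CommRing R]

/-- The `J`-filtration `∑_{i<k} z^i J^(m - l i)`, where `z` is an element which one expects to
be integral over `J^l`. -/
def integralFiltration (J : Ideal R) (z : R) (l k : ℕ) : J.Filtration R where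
  N m := ⨆ i ∈ Set.Iio k, Ideal.span {z ^ i} * J ^ (m - l * i)
  mono m := iSup₂_mono fun i _ => Ideal.mul_mono_right (Ideal.pow_le_pow_right (by omega))
  smul_le m := by
    rw [smul_eq_mul, Ideal.mul_iSup]
    refine iSup_mono fun i => ?_
    rw [Ideal.mul_iSup]
    refine iSup_mono fun _ => ?_
    rw [mul_left_comm, ← pow_succ']
    exact Ideal.mul_mono_right (Ideal.pow_le_pow_right (by omega))

lemma integralFiltration_N (J : Ideal R) (z : R) (l k m : ℕ) :
    (integralFiltration J z l k).N m =
      ⨆ i ∈ Set.Iio k, Ideal.span {z ^ i} * J ^ (m - l * i) := rfl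

lemma integralFiltration_stable (J : Ideal R) (z : R) (l k : ℕ) :
    (integralFiltration J z l k).Stable := by
  refine ⟨l * k, fun n hn => ?_⟩
  simp only [integralFiltration_N]
  rw [smul_eq_mul, Ideal.mul_iSup]
  refine iSup_congr fun i => ?_
  rw [Ideal.mul_iSup]
  refine iSup_congr fun hi => ?_
  have hi : i < k := hi
  have : l * i ≤ l * k := Nat.mul_le_mul_left _ hi.le
  rw [mul_left_comm, ← pow_succ', show n + 1 - l * i = n - l * i + 1 by omega]

lemma mul_mem_integralFiltration {J : Ideal R} {z : R} {l k m : ℕ} {a : ℕ → R}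
    (ha : ∀ j, 1 ≤ j → j ≤ k → a j ∈ (J ^ l) ^ j)
    (hz : z ^ k + ∑ j ∈ Icc 1 k, a j * z ^ (k - j) = 0) (hm : l * k ≤ m) {v : R}
    (hv : v ∈ (integralFiltration J z l k).N m) :
    z * v ∈ (integralFiltration J z l k).N (m + l) := by
  simp only [integralFiltration_N] at hv
  have hkey : (⨆ i ∈ Set.Iio k, Ideal.span {z ^ i} * J ^ (m - l * i)) ≤
      (((integralFiltration J z l k).N (m + l)).comap (LinearMap.mulLeft R z) : Ideal R) := by
    refine iSup₂_le fun i (hi : i < k) => ?_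
    have hle : l * (i + 1) ≤ l * k := Nat.mul_le_mul_left _ hi
    rw [mul_add] at hle
    rw [Ideal.mul_le]
    intro x hx w hw
    obtain ⟨t, rfl⟩ := Ideal.mem_span_singleton'.1 hx
    change z * (t * z ^ i * w) ∈ (integralFiltration J z l k).N (m + l)
    rw [show z * (t * z ^ i * w) = t * (z ^ (i + 1) * w) by ring]
    refine Ideal.mul_mem_left _ _ ?_
    have hbasic : ∀ i' < k, ∀ w' ∈ J ^ (m + l - l * i'),
        z ^ i' * w' ∈ (integralFiltration J z l k).N (m + l) := by
      intro i' hi' w' hw'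
      rw [integralFiltration_N]
      exact Submodule.mem_iSup_of_mem i' (Submodule.mem_iSup_of_mem hi'
        (Ideal.mul_mem_mul (Ideal.mem_span_singleton_self _) hw'))
    rcases Nat.lt_or_ge (i + 1) k with h | h
    · refine hbasic _ h _ ?_
      rwa [show m + l - l * (i + 1) = m - l * i by rw [mul_add]; omega]
    · have hik : i + 1 = k := by omega
      rw [hik, eq_neg_of_add_eq_zero_left hz, neg_mul, sum_mul]
      refine neg_mem (sum_mem fun j hj => ?_)
      rw [mem_Icc] at hj
      rw [show a j * z ^ (k - j) * w = z ^ (k - j) * (a j * w) by ring]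
      refine hbasic _ (by omega) _ ?_
      have := Ideal.mul_mem_mul (ha j hj.1 hj.2) hw
      rw [← pow_mul, ← pow_add] at this
      refine Ideal.pow_le_pow_right ?_ this
      have h1 : l * (k - j) + l * j = l * k := by rw [← mul_add]; congr 1; omega
      have h2 : l * k = l * i + l := by rw [← hik, mul_add, mul_one]
      omega
  exact hkey hv

lemma finrank_eq_one_of_ne_bot [IsDomain R] [IsNoetherianRing R] {M : Submodule R (Fin 1 → R)} (hM : M ≠ ⊥) :
    Module.finrank R M = 1 := by
  have h1 : Module.finrank R M ≤ 1 := by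
    simpa using Submodule.finrank_le M
  have : Nontrivial M := (Submodule.nontrivial_iff_ne_bot).2 hM
  have h2 : 0 < Module.finrank R M := Module.finrank_pos
  omega

lemma alternating_rank_sum [IsDomain R] [IsNoetherianRing R] {r : ℕ → ℕ} {d : ℕ}
    {M : Submodule R (Fin 1 → R)} (hM : M ≠ ⊥)
    {ε : (Fin (r 0) → R) →ₗ[R] (Fin 1 → R)}
    {dP : ∀ i, (Fin (r (i + 1)) → R) →ₗ[R] (Fin (r i) → R)}
    (hε : LinearMap.range ε = M) (h0 : LinearMap.range (dP 0) = LinearMap.ker ε)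
    (h1 : ∀ i, LinearMap.range (dP (i + 1)) = LinearMap.ker (dP i)) (hr : r (d + 1) = 0) :
    ∑ i ∈ range (d + 1), (-1 : ℤ) ^ i * r i = 1 := by
  have hrn : ∀ {a b : ℕ} (g : (Fin a → R) →ₗ[R] (Fin b → R)),
      Module.finrank R (LinearMap.range g) + Module.finrank R (LinearMap.ker g) = a := by
    intro a b g
    have h := Submodule.finrank_quotient_add_finrank (LinearMap.ker g)
    rwa [g.quotKerEquivRange.finrank_eq, Module.finrank_fin_fun] at h
  have key : ∀ m, ∑ i ∈ range (m + 1), (-1 : ℤ) ^ i * r i =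
      1 + (-1 : ℤ) ^ m * Module.finrank R (LinearMap.range (dP m)) := by
    intro m
    induction m with
    | zero =>
      have := hrn ε
      rw [hε, finrank_eq_one_of_ne_bot hM, ← h0] at this
      simp [← this]
    | succ m ih =>
      have := hrn (dP m)
      rw [← h1] at this
      have h : (r (m + 1) : ℤ) = Module.finrank R (LinearMap.range (dP m)) +
        Module.finrank R (LinearMap.range (dP (m + 1))) := by exact_mod_cast this.symm
      rw [sum_range_succ, ih, h]
      ring
  rw [key d]
  have : Module.finrank R (LinearMap.range (dP d)) = 0 := by
    have h := hrn (dP d)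
    omega
  simp [this]

lemma trace_comp_mem {a : ℕ} {D : Type u} [AddCommGroup D] [Module R D] {I : Ideal R}
    (q : D →ₗ[R] (Fin a → R)) {g : (Fin a → R) →ₗ[R] D}
    (hg : g ∈ I • (⊤ : Submodule R ((Fin a → R) →ₗ[R] D))) :
    LinearMap.trace R _ (q ∘ₗ g) ∈ I := by
  have h := Submodule.mem_map_of_mem
    (f := LinearMap.trace R _ ∘ₗ LinearMap.llcomp R (Fin a → R) D (Fin a → R) q) hg
  rw [Submodule.map_smul''] at h
  have h2 := Submodule.smul_mono (le_refl I) le_top h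
  rw [smul_eq_mul, Ideal.mul_top] at h2
  exact h2

theorem mem_of_integralOver_pow_length [IsNoetherianRing R] [IsLocalRing R] [IsDomain R]
    {y : ℕ → R} {d : ℕ} (hy : RegularUpTo y (⊤ : Submodule R R) d)
    (hym : initialIdeal y d = maximalIdeal R) (xs : List R) (hxs : xs ≠ []) {z : R}
    (hz : z ∈ integralOverIdeal (Ideal.ofList xs ^ xs.length)) : z ∈ Ideal.ofList xs := by
  obtain ⟨k, hk, a, ha, hza⟩ := hz
  set J := Ideal.ofList xs with hJ
  set l := xs.length with hl
  have hl0 : 0 < l := List.length_pos_iff.2 hxs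
  by_cases hJ0 : J = ⊥
  · have h0 : ∑ j ∈ Icc 1 k, a j * z ^ (k - j) = 0 := by
      refine sum_eq_zero fun j hj => ?_
      rw [mem_Icc] at hj
      have := ha j hj.1 hj.2
      rw [hJ0, Ideal.bot_pow hl0.ne', Ideal.bot_pow (by omega)] at this
      rw [(Ideal.mem_bot).1 this, zero_mul]
    rw [h0, add_zero] at hza
    rw [eq_zero_of_pow_eq_zero hza]
    exact J.zero_mem
  set F := integralFiltration J z l k with hF
  obtain ⟨n0, hn0⟩ := exists_homotopy_mod (J := J) xs R (0 : R →ₗ[R] R) F (by simp)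
    (integralFiltration_stable J z l k) (by simp) (fun x hx => Ideal.subset_span hx)
    (Ideal.span_mono Set.subset_union_right)
  obtain ⟨n, hn, hnk⟩ : ∃ n, n0 ≤ n ∧ l * k ≤ n := ⟨max n0 (l * k), le_max_left _ _, le_max_right _ _⟩
  set M : Submodule R (Fin 1 → R) := (F.N n).comap (LinearMap.proj 0) with hMdef
  have hM : M ≠ ⊥ := by
    have h1 : J ^ n ≠ ⊥ := fun h => hJ0 (by
      exact eq_zero_of_pow_eq_zero (n := n) h)
    obtain ⟨v, hv, hv0⟩ := Submodule.exists_mem_ne_zero_of_ne_bot h1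
    refine fun hbot => hv0 ?_
    have : (fun _ => v : Fin 1 → R) ∈ M := by
      change v ∈ F.N n
      rw [hF, integralFiltration_N]
      refine Submodule.mem_iSup_of_mem 0 (Submodule.mem_iSup_of_mem hk ?_)
      simpa using hv
    rw [hbot] at this
    exact congrFun this 0
  obtain ⟨r, ε, dP, hε, h0, h1, hr⟩ := exists_finite_free_resolution hy hym M
  have hdd : ∀ i v, dP i (dP (i + 1) v) = 0 := fun i v => by
    have : dP (i + 1) v ∈ LinearMap.ker (dP i) := h1 i ▸ ⟨v, rfl⟩
    exact this
  have hεd : ∀ v, ε (dP 0 v) = 0 := fun v => by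
    have : dP 0 v ∈ LinearMap.ker ε := h0 ▸ ⟨v, rfl⟩
    exact this
  let D := ∀ i, Fin (r i) → R
  let dD : D →ₗ[R] D := LinearMap.pi fun i => dP i ∘ₗ LinearMap.proj (i + 1)
  let π : D →ₗ[R] R := LinearMap.proj 0 ∘ₗ ε ∘ₗ LinearMap.proj 0
  let s : ∀ i, (Fin (r i) → R) →ₗ[R] D := fun i => LinearMap.single R (fun i => Fin (r i) → R) i
  have hdD : ∀ v i, dD v i = dP i (v (i + 1)) := fun v i => rfl
  have hπ : ∀ v, π v = ε (v 0) 0 := fun v => rfl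
  have hs0 : ∀ i v, s i v i = v := fun i v =>
    Pi.single_eq_same (M := fun i => Fin (r i) → R) i v
  have hs1 : ∀ i j v, j ≠ i → s i v j = 0 := fun i j v h =>
    Pi.single_eq_of_ne (M := fun i => Fin (r i) → R) h v
  have hεM : ∀ v, ε v 0 ∈ F.N n := fun v => by
    have : ε v ∈ M := hε ▸ ⟨v, rfl⟩
    exact this
  obtain ⟨h, hh0, hh⟩ := hn0 n hn D dD π
    (fun v => by
      funext i
      rw [hdD, hdD, hdd]; rfl)
    (fun v => by rw [hπ, hdD, hεd]; rfl)
    (fun v hv hv0 => by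
      have h2 : ∀ i, ∃ w, dP i w = v i := by
        intro i
        cases i with
        | zero =>
          have : v 0 ∈ LinearMap.ker ε := by
            rw [LinearMap.mem_ker]
            funext j
            rw [Fin.fin_one_eq_zero j]
            exact hv0
          rwa [← h0] at this
        | succ i =>
          have : v (i + 1) ∈ LinearMap.ker (dP i) := congrFun hv i
          rwa [← h1] at this
      choose w hw using h2
      refine ⟨fun i => Nat.casesOn i 0 w, ?_, ?_⟩
      · rw [hπ]; simp
      · funext i
        rw [hdD]
        exact hw i)
    (fun v hv => by
      have : (fun _ => v : Fin 1 → R) ∈ LinearMap.range ε := by rw [hε]; exact hv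
      obtain ⟨w, hw⟩ := this
      exact ⟨s 0 w, by rw [hπ, hs0, hw]⟩)
    r dP hdd (fun i => z • s i)
    (fun i v => by
      rw [LinearMap.smul_apply, map_smul, smul_eq_mul]
      refine mul_mem_integralFiltration ha hza hnk ?_
      rw [hπ]
      cases i with
      | zero => rw [hs0]; exact hεM v
      | succ i => rw [hs1 _ _ _ (by omega)]; simp)
    (fun v => by
      funext i
      rw [hdD, LinearMap.smul_apply, Pi.smul_apply, hs1 _ _ _ (by omega), smul_zero, map_zero]; rfl)
    (fun i v => by
      funext j
      rw [hdD, LinearMap.smul_apply, Pi.smul_apply, LinearMap.smul_apply, Pi.smul_apply]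
      by_cases hji : j = i
      · subst hji; rw [hs0, hs0, map_smul]
      · rw [hs1 _ _ _ (by omega), hs1 _ _ _ hji]; simp)
  let p : ∀ i, D →ₗ[R] (Fin (r i) → R) := fun i => LinearMap.proj i
  let t : ℕ → R := fun i => LinearMap.trace R _ (dP i ∘ₗ p (i + 1) ∘ₗ h i)
  have hps : ∀ i, p i ∘ₗ (z • s i) = z • LinearMap.id := fun i => by
    rw [LinearMap.comp_smul]
    congr 1
    exact LinearMap.ext (hs0 i)
  have hpd : ∀ i, p i ∘ₗ dD = dP i ∘ₗ p (i + 1) := fun i => rfl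
  have htr : ∀ i, LinearMap.trace R _ (p i ∘ₗ (z • s i)) = z * r i := fun i => by
    rw [hps, map_smul, LinearMap.trace_id]
    simp
  have e0 : z * r 0 - t 0 ∈ J := by
    have := trace_comp_mem (p 0) hh0
    rwa [LinearMap.comp_sub, map_sub, htr, ← LinearMap.comp_assoc, hpd] at this
  have e1 : ∀ i, z * r (i + 1) - t (i + 1) - t i ∈ J := fun i => by
    have := trace_comp_mem (p (i + 1)) (hh i)
    rw [LinearMap.comp_sub, LinearMap.comp_sub, map_sub, map_sub, htr, ← LinearMap.comp_assoc,
      hpd, ← LinearMap.comp_assoc _ (h i),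
      LinearMap.trace_comp_comm' (dP i)] at this
    exact this
  have key : ∀ m, z * ∑ i ∈ range (m + 1), (-1 : R) ^ i * r i - (-1) ^ m * t m ∈ J := by
    intro m
    induction m with
    | zero => simpa using e0
    | succ m ih =>
      have := J.add_mem ih (J.mul_mem_left ((-1) ^ (m + 1)) (e1 m))
      rw [sum_range_succ]
      convert this using 1
      ring
  have htd : t d = 0 := by
    have : dP d = 0 := by
      ext v : 1
      have : IsEmpty (Fin (r (d + 1))) := by rw [hr]; infer_instance
      exact this.elim v
    simp [t, this]
  have hsum : ∑ i ∈ range (d + 1), (-1 : R) ^ i * r i = 1 := by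
    have := congrArg (Int.cast : ℤ → R) (alternating_rank_sum hM hε h0 h1 hr)
    simpa using this
  simpa [htd, hsum] using key d

end BrianconSkoda

section IntegralClosureOfIdeals
variable {R : Type u} [CommRing R]

/-- `z` is almost integral over the ideal `I`: for some `c ≠ 0`, all `c z^n` lie in `I^n`. -/
def AlmostIntegralOver (I : Ideal R) (z : R) : Prop := ∃ c : R, c ≠ 0 ∧ ∀ n, c * z ^ n ∈ I ^ n

lemma AlmostIntegralOver.mem_integralOverIdeal [IsNoetherianRing R] [IsDomain R] {I : Ideal R}
    {z : R} (h : AlmostIntegralOver I z) : z ∈ integralOverIdeal I := by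
  obtain ⟨c, hc, h⟩ := h
  have hzint : IsIntegral (reesAlgebra I) (Polynomial.monomial 1 z) := by
    refine IsAlmostIntegral.isIntegral_of_nonZeroDivisors_le_comap
      ⟨⟨Polynomial.C c, ?_⟩, ?_, fun n => ?_⟩ ?_
    · exact Subalgebra.algebraMap_mem (reesAlgebra I) c
    · rw [mem_nonZeroDivisors_iff_ne_zero, Ne, Subtype.ext_iff]
      simpa using hc
    · refine ⟨⟨Polynomial.monomial n (c * z ^ n), reesAlgebra.monomial_mem.2 (h n)⟩, ?_⟩
      rw [Polynomial.monomial_pow, one_mul, Algebra.smul_def]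
      change _ = Polynomial.C c * _
      rw [Polynomial.C_mul_monomial]
      rfl
    · intro r hr
      rw [mem_nonZeroDivisors_iff_ne_zero] at hr
      rw [Submonoid.mem_comap, mem_nonZeroDivisors_iff_ne_zero]
      intro h0
      exact hr (Subtype.ext h0)
  obtain ⟨p, hp, hpz⟩ := hzint
  have hm : p.natDegree ≠ 0 := by
    intro h0
    rw [hp.natDegree_eq_zero.1 h0] at hpz
    simp at hpz
  refine ⟨p.natDegree, Nat.pos_of_ne_zero hm,
    fun j => (p.coeff (p.natDegree - j) : Polynomial R).coeff j, fun j _ _ =>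
      (mem_reesAlgebra_iff _ _).1 (p.coeff (p.natDegree - j)).2 j, ?_⟩
  rw [Polynomial.eval₂_eq_sum_range] at hpz
  have := congrArg (fun q => Polynomial.coeff q p.natDegree) hpz
  simp only [Polynomial.finsetSum_coeff, Polynomial.coeff_zero, Polynomial.monomial_pow,
    one_mul] at this
  rw [sum_range_succ] at this
  have hco : ∀ i ≤ p.natDegree, (algebraMap (reesAlgebra I) (Polynomial R) (p.coeff i) *
      (Polynomial.monomial i) (z ^ i)).coeff p.natDegree =
      (p.coeff i : Polynomial R).coeff (p.natDegree - i) * z ^ i := by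
    intro i hi
    rw [← Nat.sub_add_cancel hi, Polynomial.coeff_mul_monomial, Nat.sub_add_cancel hi]
    rfl
  rw [hco _ le_rfl] at this
  have h1 : (p.coeff p.natDegree : Polynomial R) = 1 := by
    rw [hp.coeff_natDegree]; rfl
  rw [h1] at this
  simp only [Nat.sub_self, Polynomial.coeff_one_zero, one_mul] at this
  rw [add_comm, ← this, ← sum_range_reflect]
  congr 1
  rw [show Icc 1 p.natDegree = Ico 1 (p.natDegree + 1) from rfl, sum_Ico_eq_sum_range,
    Nat.add_sub_cancel]
  refine sum_congr rfl fun j hj => ?_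
  rw [mem_range] at hj
  rw [hco _ (by omega), show p.natDegree - (p.natDegree - 1 - j) = 1 + j by omega,
    show p.natDegree - (1 + j) = p.natDegree - 1 - j by omega]
  change (p.coeff (p.natDegree - (1 + j)) : Polynomial R).coeff (1 + j) * _ = _
  rw [show p.natDegree - (1 + j) = p.natDegree - 1 - j by omega]

lemma integralOverIdeal.almostIntegralOver [IsDomain R] {I : Ideal R} (hI : I ≠ ⊥)
    {z : R} (h : z ∈ integralOverIdeal I) : AlmostIntegralOver I z := by
  obtain ⟨k, hk, a, ha, hz⟩ := h
  obtain ⟨c, hc, hc0⟩ := Submodule.exists_mem_ne_zero_of_ne_bot hI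
  refine ⟨c ^ k, pow_ne_zero _ hc0, fun n => ?_⟩
  have hpow : c ^ k ∈ I ^ k := Ideal.pow_mem_pow hc k
  have key : ∀ n, z ^ n ∈ I ^ (n - k) := by
    intro n
    induction n using Nat.strong_induction_on with
    | _ n ih =>
      rcases Nat.lt_or_ge n k with h | h
      · simp [Nat.sub_eq_zero_of_le h.le]
      · have h1 : z ^ n = - ∑ j ∈ Icc 1 k, a j * z ^ (n - j) := by
          have h2 : z ^ n = z ^ k * z ^ (n - k) := by rw [← pow_add]; congr 1; omega
          rw [h2, eq_neg_of_add_eq_zero_left hz, neg_mul, sum_mul]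
          congr 1
          refine sum_congr rfl fun j hj => ?_
          rw [mem_Icc] at hj
          rw [mul_assoc, ← pow_add]
          congr 2
          omega
        rw [h1]
        refine neg_mem (sum_mem fun j hj => ?_)
        rw [mem_Icc] at hj
        have := Ideal.mul_mem_mul (ha j hj.1 hj.2) (ih (n - j) (by omega))
        rw [← pow_add] at this
        exact Ideal.pow_le_pow_right (by omega) this
  have := Ideal.mul_mem_mul hpow (key n)
  rw [← pow_add] at this
  exact Ideal.pow_le_pow_right (by omega) this

lemma AlmostIntegralOver.add [IsDomain R] {I : Ideal R} {z w : R} (hz : AlmostIntegralOver I z)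
    (hw : AlmostIntegralOver I w) : AlmostIntegralOver I (z + w) := by
  obtain ⟨c, hc, hcz⟩ := hz
  obtain ⟨b, hb, hbw⟩ := hw
  refine ⟨c * b, mul_ne_zero hc hb, fun n => ?_⟩
  rw [add_pow, mul_sum]
  refine sum_mem fun i hi => ?_
  rw [mem_range] at hi
  have := Ideal.mul_mem_mul (hcz i) (hbw (n - i))
  rw [← pow_add, show i + (n - i) = n by omega] at this
  convert Ideal.mul_mem_right (n.choose i : R) _ this using 1
  ring

lemma AlmostIntegralOver.mul [IsDomain R] {I I' : Ideal R} {z w : R}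
    (hz : AlmostIntegralOver I z) (hw : AlmostIntegralOver I' w) :
    AlmostIntegralOver (I * I') (z * w) := by
  obtain ⟨c, hc, hcz⟩ := hz
  obtain ⟨b, hb, hbw⟩ := hw
  refine ⟨c * b, mul_ne_zero hc hb, fun n => ?_⟩
  have := Ideal.mul_mem_mul (hcz n) (hbw n)
  rw [← mul_pow] at this
  convert this using 1
  ring

lemma AlmostIntegralOver.of_mem [Nontrivial R] {I : Ideal R} {z : R} (hz : z ∈ I) :
    AlmostIntegralOver I z :=
  ⟨1, one_ne_zero, fun n => by rw [one_mul]; exact Ideal.pow_mem_pow hz n⟩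

lemma AlmostIntegralOver.mono {I I' : Ideal R} (h : I ≤ I') {z : R}
    (hz : AlmostIntegralOver I z) : AlmostIntegralOver I' z := by
  obtain ⟨c, hc, hcz⟩ := hz
  exact ⟨c, hc, fun n => Ideal.pow_right_mono h n (hcz n)⟩

/-- The ideal of elements almost integral over `I`. -/
def almostClosure [IsDomain R] (I : Ideal R) : Ideal R where
  carrier := {z | AlmostIntegralOver I z}
  zero_mem' := AlmostIntegralOver.of_mem I.zero_mem
  add_mem' := AlmostIntegralOver.add
  smul_mem' r z hz := by
    obtain ⟨c, hc, hcz⟩ := hz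
    refine ⟨c, hc, fun n => ?_⟩
    have := Ideal.mul_mem_left (I ^ n) (r ^ n) (hcz n)
    rwa [smul_eq_mul, mul_pow, mul_left_comm]

lemma mem_almostClosure [IsDomain R] {I : Ideal R} {z : R} :
    z ∈ almostClosure I ↔ AlmostIntegralOver I z := Iff.rfl

lemma idealIntegralClosure_eq_almostClosure [IsNoetherianRing R] [IsDomain R] {I : Ideal R}
    (hI : I ≠ ⊥) : idealIntegralClosure I = almostClosure I := by
  refine le_antisymm (Ideal.span_le.2 fun z hz => ?_) fun z hz => Ideal.subset_span ?_
  · exact integralOverIdeal.almostIntegralOver hI hz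
  · exact AlmostIntegralOver.mem_integralOverIdeal hz

lemma almostIntegralOver_of_pow_mem [IsDomain R] {J I : Ideal R} (hJ : J ≠ ⊥) {t p : ℕ}
    (h : ∀ n, I ^ (n + t) ≤ J ^ n) {z : R} (hz : AlmostIntegralOver (I ^ p) z) :
    AlmostIntegralOver (J ^ p) z := by
  obtain ⟨c, hc, hcz⟩ := hz
  obtain ⟨b, hb, hb0⟩ := Submodule.exists_mem_ne_zero_of_ne_bot hJ
  refine ⟨c * b ^ t, mul_ne_zero hc (pow_ne_zero _ hb0), fun n => ?_⟩
  have h1 : c * z ^ n ∈ J ^ (p * n - t) := by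
    rcases Nat.lt_or_ge (p * n) t with h2 | h2
    · simp [Nat.sub_eq_zero_of_le h2.le]
    · have h3 := hcz n
      rw [← pow_mul, show p * n = p * n - t + t by omega] at h3
      exact h _ h3
  have h2 := Ideal.mul_mem_mul h1 (Ideal.pow_mem_pow hb t)
  rw [← pow_add] at h2
  rw [← pow_mul]
  convert Ideal.pow_le_pow_right (by omega : p * n ≤ p * n - t + t) h2 using 1
  ring

end IntegralClosureOfIdeals

section RegularLocal
variable {R : Type u} [CommRing R]

/-- The list is a weakly regular sequence on the quotient by the ideal `K`. -/
def RegularMod : Ideal R → List R → Prop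
  | _, [] => True
  | K, x :: xs => (∀ r, x * r ∈ K → r ∈ K) ∧ RegularMod (K ⊔ Ideal.span {x}) xs

variable [IsNoetherianRing R] [IsLocalRing R]

lemma ringKrullDim_quotient_le_card {K : Ideal R} {s : Finset R}
    (h : K ⊔ Ideal.span s = maximalIdeal R) : ringKrullDim (R ⧸ K) ≤ s.card := by
  classical
  have hK : K ≤ maximalIdeal R := h ▸ le_sup_left
  have : Nontrivial (R ⧸ K) :=
    Ideal.Quotient.nontrivial_iff.2 (fun h => (maximalIdeal.isMaximal R).ne_top (top_le_iff.1 (h ▸ hK)))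
  have hloc : IsLocalRing (R ⧸ K) :=
    IsLocalRing.of_surjective' (Ideal.Quotient.mk K) Ideal.Quotient.mk_surjective
  have hm : maximalIdeal (R ⧸ K) = Ideal.span ((s.image (Ideal.Quotient.mk K) : Finset _) : Set _) := by
    have h1 : (maximalIdeal R).map (Ideal.Quotient.mk K) = maximalIdeal (R ⧸ K) := by
      refine IsLocalRing.eq_maximalIdeal ?_
      refine (Ideal.map_eq_top_or_isMaximal_of_surjective _ Ideal.Quotient.mk_surjective
        (maximalIdeal.isMaximal R)).resolve_left ?_
      intro htop
      have := Ideal.comap_map_of_surjective _ (Ideal.Quotient.mk_surjective (I := K)) (maximalIdeal R)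
      rw [htop, Ideal.comap_top, ← RingHom.ker_eq_comap_bot, Ideal.mk_ker, sup_eq_left.2 hK] at this
      exact (maximalIdeal.isMaximal R).ne_top this.symm
    rw [← h1, ← h, Ideal.map_sup, Ideal.map_quotient_self, bot_sup_eq, Ideal.map_span,
      Finset.coe_image]
  refine (ringKrullDim_le_spanFinrank_maximalIdeal (R ⧸ K)).trans ?_
  rw [hm]
  exact_mod_cast (Submodule.spanFinrank_span_le_ncard_of_finite (Finset.finite_toSet _)).trans
    (by rw [Set.ncard_coe_finset]; exact Finset.card_image_le)

lemma ringKrullDim_quotient_le_add_one {K : Ideal R} {z : R} (hK : K ≤ maximalIdeal R)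
    (hz : z ∈ maximalIdeal R) :
    ringKrullDim (R ⧸ K) ≤ ringKrullDim (R ⧸ K ⊔ Ideal.span {z}) + 1 := by
  have : Nontrivial (R ⧸ K) :=
    Ideal.Quotient.nontrivial_iff.2 (fun h => (maximalIdeal.isMaximal R).ne_top (top_le_iff.1 (h ▸ hK)))
  have hloc : IsLocalRing (R ⧸ K) :=
    IsLocalRing.of_surjective' (Ideal.Quotient.mk K) Ideal.Quotient.mk_surjective
  have h : ringKrullDim (R ⧸ K) ≤ ringKrullDim ((R ⧸ K) ⧸
      Ideal.span ({Ideal.Quotient.mk K z} : Set (R ⧸ K))) + 1 := by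
    have h := ringKrullDim_le_ringKrullDim_quotient_add_encard {Ideal.Quotient.mk K z}
      (by
      rw [IsLocalRing.ringJacobson_eq_maximalIdeal]
      simp only [Set.singleton_subset_iff, SetLike.mem_coe, mem_maximalIdeal,
        mem_nonunits_iff]
      intro hu
      obtain ⟨b, hb⟩ := isUnit_iff_exists_inv.1 hu
      obtain ⟨t, rfl⟩ := Ideal.Quotient.mk_surjective b
      rw [← map_mul, ← map_one (Ideal.Quotient.mk K), Ideal.Quotient.eq] at hb
      have h1 := (maximalIdeal R).sub_mem ((maximalIdeal R).mul_mem_right t hz) (hK hb)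
      rw [sub_sub_cancel] at h1
      exact (maximalIdeal.isMaximal R).ne_top ((Ideal.eq_top_iff_one _).2 h1))
    rwa [Set.encard_singleton] at h
  rw [ringKrullDim_eq_of_ringEquiv (DoubleQuot.quotQuotEquivQuotSup K (Ideal.span {z})).symm,
    Ideal.map_span, Set.image_singleton]
  exact h

lemma exists_mem_maximalIdeal_notMem {K : Ideal R} {r : ℕ}
    (hdim : ringKrullDim (R ⧸ K) = (r + 1 : ℕ)) :
    ∃ z ∈ maximalIdeal R, z ∉ K ⊔ maximalIdeal R • maximalIdeal R ∧
      ∀ q ∈ K.minimalPrimes, z ∉ q := by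
  classical
  have hfin := Ideal.finite_minimalPrimes_of_isNoetherianRing R K
  by_contra! hcon
  have hsub : ((maximalIdeal R : Ideal R) : Set R) ⊆
      ⋃ i ∈ (↑(insert (K ⊔ maximalIdeal R • maximalIdeal R) hfin.toFinset :
        Finset (Ideal R)) : Set (Ideal R)), (i : Set R) := by
    intro z hz
    simp only [Set.mem_iUnion, Finset.mem_coe, Finset.mem_insert, Set.Finite.mem_toFinset]
    by_cases h : z ∈ K ⊔ maximalIdeal R • maximalIdeal R
    · exact ⟨_, Or.inl rfl, h⟩
    · obtain ⟨q, hq, hzq⟩ := hcon z hz h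
      exact ⟨q, Or.inr hq, hzq⟩
  have hdim0 : ¬ ringKrullDim (R ⧸ K) ≤ 0 := by
    rw [hdim]; exact_mod_cast (by omega : ¬ (r + 1 ≤ 0))
  rw [Ideal.subset_union_prime (f := fun i => i) (K ⊔ maximalIdeal R • maximalIdeal R)
    (K ⊔ maximalIdeal R • maximalIdeal R)] at hsub
  · obtain ⟨q, hq, hmq⟩ := hsub
    rw [Finset.mem_insert, Set.Finite.mem_toFinset] at hq
    refine hdim0 ?_
    have hall : ∀ p : Ideal R, p.IsPrime → K ≤ p → p = maximalIdeal R := by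
      intro p hp hKp
      refine le_antisymm (le_maximalIdeal hp.ne_top) ?_
      rcases hq with rfl | hq
      · have := Submodule.le_of_le_smul_of_le_jacobson_bot
          (IsNoetherian.noetherian (maximalIdeal R)) (IsLocalRing.maximalIdeal_le_jacobson _) hmq
        exact this.trans hKp
      · have h1 : p ≤ q := (le_maximalIdeal hp.ne_top).trans hmq
        exact hmq.trans (hq.2 ⟨hp, hKp⟩ h1)
    have : Ring.KrullDimLE 0 (R ⧸ K) := by
      rw [Ring.krullDimLE_zero_iff]
      intro p hp
      have h2 := hall (p.comap (Ideal.Quotient.mk K)) (Ideal.comap_isPrime _ _)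
        (fun x hx => by
          rw [Ideal.mem_comap, Ideal.Quotient.eq_zero_iff_mem.2 hx]; exact p.zero_mem)
      have h3 : p = (maximalIdeal R).map (Ideal.Quotient.mk K) := by
        rw [← h2, Ideal.map_comap_of_surjective _ Ideal.Quotient.mk_surjective]
      rw [h3]
      exact (Ideal.map_eq_top_or_isMaximal_of_surjective _ Ideal.Quotient.mk_surjective
        (maximalIdeal.isMaximal R)).resolve_left (h3 ▸ hp.ne_top)
    exact Ring.krullDimLE_iff.1 this
  · intro i hi hne _
    rw [Finset.mem_insert, Set.Finite.mem_toFinset] at hi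
    exact (hi.resolve_left hne).1.1

omit [IsNoetherianRing R] in
lemma exists_exchange {K : Ideal R} {s : Finset R} (h : K ⊔ Ideal.span s = maximalIdeal R) {z : R}
    (hz : z ∈ maximalIdeal R) (hz2 : z ∉ K ⊔ maximalIdeal R • maximalIdeal R) :
    ∃ s' : Finset R, s'.card + 1 = s.card ∧
      (K ⊔ Ideal.span {z}) ⊔ Ideal.span s' = maximalIdeal R := by
  classical
  have hsm : ∀ i ∈ s, i ∈ maximalIdeal R := fun i hi => by
    rw [← h]; exact Ideal.mem_sup_right (Ideal.subset_span hi)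
  have hz' := hz
  rw [← h] at hz'
  obtain ⟨k, hk, t, ht, rfl⟩ := Submodule.mem_sup.1 hz'
  obtain ⟨a, -, rfl⟩ := Submodule.mem_span_finset.1 ht
  obtain ⟨i, hi, hu⟩ : ∃ i ∈ s, IsUnit (a i) := by
    by_contra! hcon
    refine hz2 (Submodule.mem_sup.2 ⟨k, hk, _, sum_mem fun i hi => ?_, rfl⟩)
    exact Submodule.smul_mem_smul ((mem_maximalIdeal _).2 (hcon i hi)) (hsm i hi)
  refine ⟨s.erase i, Finset.card_erase_add_one hi, le_antisymm ?_ ?_⟩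
  · refine sup_le (sup_le (h ▸ le_sup_left) ?_) ?_
    · rw [Ideal.span_singleton_le_iff_mem]; exact hz
    · exact Ideal.span_le.2 fun j hj => hsm j (Finset.mem_of_mem_erase hj)
  · conv_lhs => rw [← h]
    refine sup_le (le_sup_left.trans le_sup_left) (Ideal.span_le.2 fun j hj => ?_)
    by_cases hji : j = i
    · subst hji
      rw [SetLike.mem_coe, ← Submodule.smul_mem_iff_of_isUnit _ hu]
      have hsum := Finset.add_sum_erase s (fun i => a i • i) hi
      have : a j • j = (k + ∑ i ∈ s, a i • i) - k - ∑ i ∈ s.erase j, a i • i := by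
        rw [← hsum]; abel
      rw [this]
      refine sub_mem (sub_mem ?_ ?_) ?_
      · exact Ideal.mem_sup_left (Ideal.mem_sup_right (Ideal.mem_span_singleton_self _))
      · exact Ideal.mem_sup_left (Ideal.mem_sup_left hk)
      · exact Ideal.mem_sup_right (sum_mem fun l hl => Submodule.smul_mem _ _
          (Ideal.subset_span hl))
    · exact Ideal.mem_sup_right (Ideal.subset_span (Finset.mem_erase.2 ⟨hji, hj⟩))

theorem isPrime_and_exists_regularMod (r : ℕ) : ∀ (K : Ideal R) (s : Finset R),
    K ⊔ Ideal.span s = maximalIdeal R → s.card = r → ringKrullDim (R ⧸ K) = r →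
    K.IsPrime ∧ ∃ l : List R, l.length = r ∧ K ⊔ Ideal.ofList l = maximalIdeal R ∧
      RegularMod K l := by
  induction r with
  | zero =>
    intro K s h hs _
    rw [Finset.card_eq_zero] at hs
    have hKm : K = maximalIdeal R := by simpa [hs] using h
    refine ⟨hKm ▸ inferInstance, [], rfl, by simpa using hKm, trivial⟩
  | succ r ih =>
    intro K s h hs hdim
    have hK : K ≤ maximalIdeal R := h ▸ le_sup_left
    obtain ⟨z, hz, hz2, hzq⟩ := exists_mem_maximalIdeal_notMem hdim
    obtain ⟨s', hs', h'⟩ := exists_exchange h hz hz2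
    have hdim' : ringKrullDim (R ⧸ K ⊔ Ideal.span {z}) = r := by
      refine le_antisymm ?_ ?_
      · have := ringKrullDim_quotient_le_card h'
        rwa [show s'.card = r by omega] at this
      · have := ringKrullDim_quotient_le_add_one hK hz
        rw [hdim] at this
        revert this
        generalize ringKrullDim (R ⧸ K ⊔ Ideal.span {z}) = D
        intro this
        induction D with
        | bot => simp at this
        | coe D =>
          have h3 : ((r + 1 : ℕ) : ℕ∞) ≤ D + 1 := by exact_mod_cast this
          have h4 : (r : ℕ∞) ≤ D := by
            induction D with
            | top => exact le_top
            | coe D =>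
              have : r + 1 ≤ D + 1 := by exact_mod_cast h3
              exact_mod_cast (by omega : r ≤ D)
          exact_mod_cast h4
    obtain ⟨hp, l, hl, hlm, hlr⟩ := ih _ s' h' (by omega) hdim'
    obtain ⟨q, hq, hqp⟩ := Ideal.exists_minimalPrimes_le (I := K) (J := K ⊔ Ideal.span {z})
      le_sup_left
    have hqK : q ≤ K := by
      refine Submodule.le_of_le_smul_of_le_jacobson_bot (I := Ideal.span {z})
        (IsNoetherian.noetherian q) ?_ ?_
      · rw [Ideal.span_singleton_le_iff_mem]
        exact IsLocalRing.maximalIdeal_le_jacobson _ hz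
      · intro t ht
        obtain ⟨k, hk, w, hw, rfl⟩ := Submodule.mem_sup.1 (hqp ht)
        obtain ⟨c, rfl⟩ := Ideal.mem_span_singleton'.1 hw
        refine Submodule.mem_sup.2 ⟨k, hk, _, ?_, rfl⟩
        have h1 : c * z ∈ q := by
          have := q.sub_mem ht (hq.1.2 hk)
          simpa using this
        have h2 : c ∈ q := (hq.1.1.mem_or_mem h1).resolve_right (hzq q hq)
        rw [mul_comm, ← smul_eq_mul]
        exact Submodule.smul_mem_smul (Ideal.mem_span_singleton_self z) h2
    have hKq : K = q := le_antisymm hq.1.2 hqK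
    have hKp : K.IsPrime := hKq ▸ hq.1.1
    refine ⟨hKp, z :: l, by simp [hl], ?_, fun t ht => ?_, hlr⟩
    · rw [Ideal.ofList_cons, ← sup_assoc]; exact hlm
    · refine (hKp.mem_or_mem ht).resolve_left ?_
      have := hzq q hq
      rwa [hKq]

end RegularLocal

section CohenMacaulay
variable {R : Type u} [CommRing R]

/-- `a` is a nonzerodivisor on `R ⧸ K`. -/
def NzdMod (K : Ideal R) (a : R) : Prop := ∀ r, a * r ∈ K → r ∈ K

lemma NzdMod.mul {K : Ideal R} {a b : R} (ha : NzdMod K a) (hb : NzdMod K b) :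
    NzdMod K (a * b) := fun r hr => hb r (ha _ (by rwa [← mul_assoc]))

lemma NzdMod.pow {K : Ideal R} {a : R} (ha : NzdMod K a) (n : ℕ) : NzdMod K (a ^ n) := by
  induction n with
  | zero => intro r hr; simpa using hr
  | succ n ih => rw [pow_succ]; exact ih.mul ha

lemma mem_sup_span_singleton_iff {K : Ideal R} {a r : R} :
    r ∈ K ⊔ Ideal.span {a} ↔ ∃ t, r - a * t ∈ K := by
  rw [Submodule.mem_sup]
  constructor
  · rintro ⟨k, hk, w, hw, rfl⟩
    obtain ⟨t, rfl⟩ := Ideal.mem_span_singleton'.1 hw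
    exact ⟨t, by rw [mul_comm a]; simpa using hk⟩
  · rintro ⟨t, ht⟩
    exact ⟨_, ht, a * t, Ideal.mem_span_singleton'.2 ⟨t, mul_comm _ _⟩, by ring⟩

lemma regularMod_append_singleton {K : Ideal R} {l : List R} {z : R} :
    RegularMod K (l ++ [z]) ↔ RegularMod K l ∧ NzdMod (K ⊔ Ideal.ofList l) z := by
  induction l generalizing K with
  | nil => simp [RegularMod, NzdMod]
  | cons a l ih =>
    rw [List.cons_append, RegularMod, ih, RegularMod, Ideal.ofList_cons, sup_assoc, and_assoc]

section Local
variable [IsNoetherianRing R] [IsLocalRing R]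

lemma NzdMod.swap {K : Ideal R} {a b : R} (hma : a ∈ maximalIdeal R)
    (ha : NzdMod K a) (hb : NzdMod (K ⊔ Ideal.span {a}) b) :
    NzdMod K b ∧ NzdMod (K ⊔ Ideal.span {b}) a := by
  refine ⟨fun r hr => ?_, fun r hr => ?_⟩
  · let L : Ideal R := Submodule.comap (LinearMap.mulLeft R b) K
    have hL : L ≤ K := by
      refine Submodule.le_of_le_smul_of_le_jacobson_bot (I := Ideal.span {a})
        (IsNoetherian.noetherian L) ?_ ?_
      · rw [Ideal.span_singleton_le_iff_mem]
        exact IsLocalRing.maximalIdeal_le_jacobson _ hma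
      · intro t ht
        have ht' : b * t ∈ K := ht
        obtain ⟨s, hs⟩ := mem_sup_span_singleton_iff.1 (hb t (Ideal.mem_sup_left ht'))
        refine Submodule.mem_sup.2 ⟨t - a * s, hs, a * s, ?_, by ring⟩
        rw [← smul_eq_mul a s]
        refine Submodule.smul_mem_smul (Ideal.mem_span_singleton_self a) (ha _ ?_)
        have : a * (b * s) = b * t - b * (t - a * s) := by ring
        change a * (b * s) ∈ K
        rw [this]
        exact K.sub_mem ht' (K.mul_mem_left _ hs)
    exact hL hr
  · obtain ⟨t, ht⟩ := mem_sup_span_singleton_iff.1 hr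
    have h1 : b * t ∈ K ⊔ Ideal.span {a} := by
      refine mem_sup_span_singleton_iff.2 ⟨r, ?_⟩
      rw [← neg_mem_iff]; simpa using ht
    obtain ⟨u, hu⟩ := mem_sup_span_singleton_iff.1 (hb _ h1)
    refine mem_sup_span_singleton_iff.2 ⟨u, ha _ ?_⟩
    have : a * (r - b * u) = (a * r - b * t) + b * (t - a * u) := by ring
    rw [this]
    exact K.add_mem ht (K.mul_mem_left _ hu)

lemma regularMod_append_singleton_iff_cons {K : Ideal R} {l : List R} {z : R}
    (hl : ∀ a ∈ l, a ∈ maximalIdeal R) (hz : z ∈ maximalIdeal R) :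
    RegularMod K (l ++ [z]) ↔ RegularMod K (z :: l) := by
  induction l generalizing K with
  | nil => simp
  | cons a l ih =>
    rw [List.cons_append, RegularMod, ih (fun b hb => hl b (List.mem_cons_of_mem _ hb)),
      RegularMod, RegularMod, RegularMod, sup_right_comm, ← and_assoc, ← and_assoc]
    refine and_congr_left fun _ => ⟨fun h => ?_, fun h => ?_⟩
    · exact NzdMod.swap (hl a List.mem_cons_self) h.1 h.2
    · exact NzdMod.swap hz h.1 h.2

/-- The socle of `R ⧸ Q` is a nonzero cyclic module. -/
def SocleCyclic (Q : Ideal R) : Prop :=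
  ∃ Δ, Δ ∉ Q ∧ (∀ μ ∈ maximalIdeal R, μ * Δ ∈ Q) ∧
    ∀ c, (∀ μ ∈ maximalIdeal R, μ * c ∈ Q) → c ∈ Q ⊔ Ideal.span {Δ}

omit [IsNoetherianRing R] [IsLocalRing R] in
lemma NzdMod.mul_mem_sup_mul {K : Ideal R} {a b c : R} (hb : NzdMod K b)
    (h : b * c ∈ K ⊔ Ideal.span {a * b}) : c ∈ K ⊔ Ideal.span {a} := by
  obtain ⟨t, ht⟩ := mem_sup_span_singleton_iff.1 h
  refine mem_sup_span_singleton_iff.2 ⟨t, hb _ ?_⟩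
  convert ht using 1; ring

omit [IsNoetherianRing R] [IsLocalRing R] in
lemma mul_mem_sup_mul {K : Ideal R} {a c : R} (b : R)
    (h : c ∈ K ⊔ Ideal.span {a}) : b * c ∈ K ⊔ Ideal.span {a * b} := by
  obtain ⟨t, ht⟩ := mem_sup_span_singleton_iff.1 h
  refine mem_sup_span_singleton_iff.2 ⟨t, ?_⟩
  convert K.mul_mem_left b ht using 1; ring

omit [IsNoetherianRing R] in
lemma SocleCyclic.mul {K : Ideal R} {a b : R} (ha : NzdMod K a) (hb : NzdMod K b)
    (hma : a ∈ maximalIdeal R) (h : SocleCyclic (K ⊔ Ideal.span {a})) :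
    SocleCyclic (K ⊔ Ideal.span {a * b}) := by
  obtain ⟨Δ, h1, h2, h3⟩ := h
  refine ⟨b * Δ, fun h => h1 (hb.mul_mem_sup_mul h), fun μ hμ => ?_, fun c hc => ?_⟩
  · rw [mul_left_comm]; exact mul_mem_sup_mul b (h2 μ hμ)
  · have hca := hc a hma
    rw [mul_comm a b] at hca
    obtain ⟨t, ht⟩ := mem_sup_span_singleton_iff.1 (ha.mul_mem_sup_mul hca)
    have ht3 : t ∈ K ⊔ Ideal.span {a} ⊔ Ideal.span {Δ} := h3 t fun μ hμ => by
      refine hb.mul_mem_sup_mul ?_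
      have : b * (μ * t) = μ * c - μ * (c - b * t) := by ring
      rw [this]
      exact sub_mem (hc μ hμ) (Ideal.mul_mem_left _ _ (Ideal.mem_sup_left ht))
    obtain ⟨s, hs⟩ := mem_sup_span_singleton_iff.1 ht3
    refine mem_sup_span_singleton_iff.2 ⟨s, ?_⟩
    have : c - b * Δ * s = (c - b * t) + b * (t - Δ * s) := by ring
    rw [this]
    exact add_mem (Ideal.mem_sup_left ht) (mul_mem_sup_mul b hs)

omit [IsNoetherianRing R] in
lemma SocleCyclic.of_mul {K : Ideal R} {a b : R} (ha : NzdMod K a) (hb : NzdMod K b)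
    (hmb : b ∈ maximalIdeal R) (h : SocleCyclic (K ⊔ Ideal.span {b * a})) :
    SocleCyclic (K ⊔ Ideal.span {b}) := by
  obtain ⟨Δ, h1, h2, h3⟩ := h
  have h4 := h2 b hmb
  rw [mul_comm b a] at h4
  obtain ⟨t, ht⟩ := mem_sup_span_singleton_iff.1 (hb.mul_mem_sup_mul h4)
  refine ⟨t, fun h => h1 ?_, fun μ hμ => ?_, fun c hc => ?_⟩
  · have : Δ = (Δ - a * t) + a * t := by ring
    rw [this]
    exact add_mem (Ideal.mem_sup_left ht) (mul_mem_sup_mul a h)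
  · refine ha.mul_mem_sup_mul ?_
    have : a * (μ * t) = μ * Δ - μ * (Δ - a * t) := by ring
    rw [this]
    exact sub_mem (h2 μ hμ) (Ideal.mul_mem_left _ _ (Ideal.mem_sup_left ht))
  · have h5 := h3 (a * c) fun μ hμ => by
      rw [mul_left_comm]; exact mul_mem_sup_mul a (hc μ hμ)
    obtain ⟨s, hs⟩ := mem_sup_span_singleton_iff.1 h5
    refine mem_sup_span_singleton_iff.2 ⟨s, ha.mul_mem_sup_mul ?_⟩
    have : a * (c - t * s) = (a * c - Δ * s) + s * (Δ - a * t) := by ring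
    rw [this]
    exact add_mem hs (Ideal.mul_mem_left _ _ (Ideal.mem_sup_left ht))

omit [IsNoetherianRing R] in
lemma SocleCyclic.exchange {K : Ideal R} {a b : R} (ha : NzdMod K a) (hb : NzdMod K b)
    (hma : a ∈ maximalIdeal R) (hmb : b ∈ maximalIdeal R)
    (h : SocleCyclic (K ⊔ Ideal.span {a})) : SocleCyclic (K ⊔ Ideal.span {b}) :=
  SocleCyclic.of_mul ha hb hmb (by rw [mul_comm]; exact h.mul ha hb hma)

omit [IsNoetherianRing R] in
lemma socleCyclic_maximalIdeal : SocleCyclic (maximalIdeal R) := by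
  refine ⟨1, fun h => (maximalIdeal.isMaximal R).ne_top ((Ideal.eq_top_iff_one _).2 h),
    fun μ hμ => by simpa using hμ, fun c _ => Ideal.mem_sup_right (by simp)⟩

/-- If `I ⊔ (x)` contains a power of the maximal ideal and `z` avoids the minimal primes of `I`,
then `I ⊔ (z)` contains a power of the maximal ideal. -/
lemma exists_pow_le_sup_of_notMem_minimalPrimes {I : Ideal R} {x z : R} {N : ℕ}
    (hxm : x ∈ maximalIdeal R) (hx : maximalIdeal R ^ N ≤ I ⊔ Ideal.span {x})
    (hz : ∀ p ∈ I.minimalPrimes, z ∉ p) :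
    ∃ M, maximalIdeal R ^ M ≤ I ⊔ Ideal.span {z} := by
  refine Ideal.exists_pow_le_of_le_radical_of_fg ?_ (IsNoetherian.noetherian _)
  rw [Ideal.radical_eq_sInf]
  refine le_sInf fun p hp => ?_
  have hIp : I ≤ p := le_sup_left.trans hp.1
  have hzp : z ∈ p := hp.1 (Ideal.mem_sup_right (Ideal.mem_span_singleton_self z))
  have hpp := hp.2
  obtain ⟨q, hq, hqp⟩ := Ideal.exists_minimalPrimes_le hIp
  have hqne : q ≠ p := fun h => hz q hq (h ▸ hzp)
  have := hq.1.1
  by_contra hmp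
  have hlt : p < maximalIdeal R := lt_of_le_of_ne (le_maximalIdeal hpp.ne_top)
    (fun h => hmp h.ge)
  have hms : Function.Surjective (Ideal.Quotient.mk q) := Ideal.Quotient.mk_surjective
  have hqm : q ≤ maximalIdeal R := le_maximalIdeal this.ne_top
  have hm : maximalIdeal R ∈ (q ⊔ Ideal.span {x}).minimalPrimes := by
    have hle : maximalIdeal R ^ N ≤ q ⊔ Ideal.span {x} := hx.trans (sup_le_sup_right hq.1.2 _)
    have hmin : ∀ r : Ideal R, r.IsPrime → q ⊔ Ideal.span {x} ≤ r → maximalIdeal R ≤ r :=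
      fun r hr hrq => hr.le_of_pow_le (hle.trans hrq)
    refine ⟨⟨inferInstance, ?_⟩, fun r hr _ => hmin r hr.1 hr.2⟩
    exact sup_le hqm ((Ideal.span_singleton_le_iff_mem _).2 hxm)
  have h1 := Ideal.map_height_le_one_of_mem_minimalPrimes hm
  have hpq : (p.map (Ideal.Quotient.mk q)).IsPrime :=
    Ideal.map_isPrime_of_surjective hms (by rwa [Ideal.mk_ker])
  have h2 : p.map (Ideal.Quotient.mk q) < (maximalIdeal R).map (Ideal.Quotient.mk q) := by
    refine lt_of_le_of_ne (Ideal.map_mono hlt.le) fun h => hlt.ne ?_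
    have := congrArg (Ideal.comap (Ideal.Quotient.mk q)) h
    rwa [Ideal.comap_map_quotientMk, Ideal.comap_map_quotientMk, sup_eq_right.2 hqp,
      sup_eq_right.2 hqm] at this
  have h3 : (⊥ : Ideal (R ⧸ q)) < p.map (Ideal.Quotient.mk q) := by
    refine bot_lt_iff_ne_bot.2 fun h => hqne ?_
    have := congrArg (Ideal.comap (Ideal.Quotient.mk q)) h
    rw [Ideal.comap_map_quotientMk, sup_eq_right.2 hqp, ← RingHom.ker_eq_comap_bot,
      Ideal.mk_ker] at this
    exact this.symm
  have hmp : ((maximalIdeal R).map (Ideal.Quotient.mk q)).IsPrime :=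
    Ideal.map_isPrime_of_surjective hms (by rwa [Ideal.mk_ker])
  have h4 := (Ideal.height_le_iff (n := 1)).1 (by exact_mod_cast h1) _ hpq h2
  have h5 := (Ideal.height_le_iff (n := 0)).1
    (by exact_mod_cast Order.lt_one_iff.1 (by exact_mod_cast h4)|>.le) _ Ideal.isPrime_bot h3
  simp at h5

omit [IsLocalRing R] in
lemma nzdMod_iff_forall_associatedPrimes {I : Ideal R} {z : R} :
    NzdMod I z ↔ ∀ p ∈ associatedPrimes R (R ⧸ I), z ∉ p := by
  have h := biUnion_associatedPrimes_eq_zero_divisors R (R ⧸ I)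
  have h' := Set.ext_iff.1 h z
  simp only [Set.mem_iUnion, SetLike.mem_coe, exists_prop, Set.mem_ofPred_eq] at h'
  constructor
  · intro hz p hp hzp
    obtain ⟨r, hr, hzr⟩ := h'.1 ⟨p, hp, hzp⟩
    obtain ⟨r, rfl⟩ := Ideal.Quotient.mk_surjective r
    refine hr (Ideal.Quotient.eq_zero_iff_mem.2 (hz r ?_))
    rw [← Ideal.Quotient.eq_zero_iff_mem]
    exact hzr
  · intro hz r hr
    by_contra hrI
    obtain ⟨p, hp, hzp⟩ := h'.2 ⟨Ideal.Quotient.mk I r,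
      fun h => hrI (Ideal.Quotient.eq_zero_iff_mem.1 h),
      (Ideal.Quotient.eq_zero_iff_mem.2 hr : Ideal.Quotient.mk I (z * r) = 0)⟩
    exact hz p hp hzp

/-- Prime avoidance: an element of the maximal ideal that is regular modulo `I₁` and avoids the
minimal primes of `I₁` and `I₂`. -/
lemma exists_nzdMod_avoiding {I₁ I₂ : Ideal R} {y : R} (hy : y ∈ maximalIdeal R)
    (hy1 : NzdMod I₁ y) (h1 : maximalIdeal R ∉ I₁.minimalPrimes)
    (h2 : maximalIdeal R ∉ I₂.minimalPrimes) :
    ∃ z ∈ maximalIdeal R, NzdMod I₁ z ∧ (∀ p ∈ I₁.minimalPrimes, z ∉ p) ∧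
      ∀ p ∈ I₂.minimalPrimes, z ∉ p := by
  classical
  have hf0 := associatedPrimes.finite R (R ⧸ I₁)
  have hf1 := Ideal.finite_minimalPrimes_of_isNoetherianRing R I₁
  have hf2 := Ideal.finite_minimalPrimes_of_isNoetherianRing R I₂
  simp only [nzdMod_iff_forall_associatedPrimes]
  by_contra! hcon
  have hsub : ((maximalIdeal R : Ideal R) : Set R) ⊆
      ⋃ i ∈ (↑(hf0.toFinset ∪ (hf1.toFinset ∪ hf2.toFinset)) : Set (Ideal R)), (i : Set R) := by
    intro z hz
    simp only [Set.mem_iUnion, Finset.mem_coe, Finset.mem_union, Set.Finite.mem_toFinset]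
    by_cases h : ∀ p ∈ associatedPrimes R (R ⧸ I₁), z ∉ p
    · by_cases h' : ∀ p ∈ I₁.minimalPrimes, z ∉ p
      · obtain ⟨q, hq, hzq⟩ := hcon z hz h h'
        exact ⟨q, Or.inr (Or.inr hq), hzq⟩
      · push Not at h'
        obtain ⟨q, hq, hzq⟩ := h'
        exact ⟨q, Or.inr (Or.inl hq), hzq⟩
    · push Not at h
      obtain ⟨q, hq, hzq⟩ := h
      exact ⟨q, Or.inl hq, hzq⟩
  rw [Ideal.subset_union_prime (f := fun i => i) ⊤ ⊤] at hsub
  · obtain ⟨q, hq, hmq⟩ := hsub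
    rw [Finset.mem_union, Finset.mem_union, Set.Finite.mem_toFinset, Set.Finite.mem_toFinset,
      Set.Finite.mem_toFinset] at hq
    have hqp : q.IsPrime := by
      rcases hq with hq | hq | hq
      exacts [hq.1, hq.1.1, hq.1.1]
    have hqm : q = maximalIdeal R := le_antisymm (le_maximalIdeal hqp.ne_top) hmq
    subst hqm
    rcases hq with hq | hq | hq
    exacts [nzdMod_iff_forall_associatedPrimes.1 hy1 _ hq hy, h1 hq, h2 hq]
  · intro i hi _ _
    rw [Finset.mem_union, Finset.mem_union, Set.Finite.mem_toFinset, Set.Finite.mem_toFinset,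
      Set.Finite.mem_toFinset] at hi
    rcases hi with hi | hi | hi
    exacts [hi.1, hi.1.1, hi.1.1]

/-- In the presence of one regular sequence `ys` of maximal length, every other system of
parameters `xs` is regular, and the socle of the quotient by it is cyclic if it is so for `ys`. -/
theorem regularMod_and_socleCyclic {d : ℕ}
    (hd : ∀ l : List R, l.length < d → maximalIdeal R ∉ (Ideal.ofList l).minimalPrimes) (n : ℕ) :
    ∀ zs ys xs : List R, ys.length = n → xs.length = n → zs.length + n = d →
      (∀ a ∈ ys, a ∈ maximalIdeal R) → (∀ a ∈ xs, a ∈ maximalIdeal R) →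
      RegularMod (Ideal.ofList zs) ys →
      (∃ N, maximalIdeal R ^ N ≤ Ideal.ofList zs ⊔ Ideal.ofList ys) →
      (∃ N, maximalIdeal R ^ N ≤ Ideal.ofList zs ⊔ Ideal.ofList xs) →
      RegularMod (Ideal.ofList zs) xs ∧
        (SocleCyclic (Ideal.ofList zs ⊔ Ideal.ofList ys) →
          SocleCyclic (Ideal.ofList zs ⊔ Ideal.ofList xs)) := by
  induction n with
  | zero =>
    intro zs ys xs hys hxs _ _ _ _ _ _
    rw [List.length_eq_zero_iff] at hys hxs
    subst hys hxs
    exact ⟨trivial, id⟩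
  | succ n ih =>
    intro zs ys xs hys hxs hzs hym hxm hreg ⟨N₁, hN₁⟩ ⟨N₂, hN₂⟩
    obtain ⟨ys, y, rfl⟩ := List.eq_nil_or_concat' ys |>.resolve_left (by rintro rfl; simp at hys)
    obtain ⟨xs, x, rfl⟩ := List.eq_nil_or_concat' xs |>.resolve_left (by rintro rfl; simp at hxs)
    simp only [List.length_append, List.length_singleton, Nat.add_right_cancel_iff] at hys hxs
    simp only [List.mem_append, List.mem_singleton, or_imp, forall_and, forall_eq] at hym hxm
    rw [Ideal.ofList_append, ← sup_assoc, Ideal.ofList_singleton] at hN₁ hN₂ ⊢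
    rw [Ideal.ofList_append, ← sup_assoc, Ideal.ofList_singleton]
    rw [regularMod_append_singleton] at hreg ⊢
    obtain ⟨z, hzm, hz1, hz2, hz3⟩ := exists_nzdMod_avoiding hym.2 hreg.2
      (by rw [← Ideal.ofList_append]; exact hd _ (by simp; omega))
      (I₂ := Ideal.ofList zs ⊔ Ideal.ofList xs)
      (by rw [← Ideal.ofList_append]; exact hd _ (by simp; omega))
    have hreg' : RegularMod (Ideal.ofList zs) (ys ++ [z]) :=
      regularMod_append_singleton.2 ⟨hreg.1, hz1⟩
    rw [regularMod_append_singleton_iff_cons hym.1 hzm] at hreg'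
    have hK : Ideal.ofList (z :: zs) = Ideal.ofList zs ⊔ Ideal.span {z} := by
      rw [Ideal.ofList_cons, sup_comm]
    have hK' : ∀ l, Ideal.ofList (z :: zs) ⊔ Ideal.ofList l =
        Ideal.ofList zs ⊔ Ideal.ofList l ⊔ Ideal.span {z} := by
      intro l; rw [hK, sup_right_comm]
    obtain ⟨h1, h2⟩ := ih (z :: zs) ys xs hys hxs (by simp; omega) hym.1 hxm.1
      (hK ▸ hreg'.2)
      (by rw [hK']; exact exists_pow_le_sup_of_notMem_minimalPrimes hym.2 hN₁ hz2)
      (by rw [hK']; exact exists_pow_le_sup_of_notMem_minimalPrimes hxm.2 hN₂ hz3)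
    have h3 : RegularMod (Ideal.ofList zs) (xs ++ [z]) := by
      rw [regularMod_append_singleton_iff_cons hxm.1 hzm]
      exact ⟨hreg'.1, hK ▸ h1⟩
    rw [regularMod_append_singleton] at h3
    have h4 : NzdMod (Ideal.ofList zs ⊔ Ideal.ofList xs) x := by
      intro r hr
      obtain ⟨t, ht⟩ := mem_sup_span_singleton_iff.1 (hN₂ (Ideal.pow_mem_pow hzm N₂))
      refine h3.2.pow N₂ r ?_
      have : z ^ N₂ * r = (z ^ N₂ - x * t) * r + t * (x * r) := by ring
      rw [this]
      exact add_mem (Ideal.mul_mem_right _ _ ht) (Ideal.mul_mem_left _ _ hr)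
    refine ⟨⟨h3.1, h4⟩, fun hs => ?_⟩
    have hs' := hs.exchange hreg.2 hz1 hym.2 hzm
    rw [← hK'] at hs'
    have hs'' := h2 hs'
    rw [hK'] at hs''
    exact hs''.exchange h3.2 h4 hzm hxm.2

end Local
end CohenMacaulay

section Monomials
variable {R : Type u} [CommRing R] {d : ℕ}

/-- The monomial with exponent `α` in the elements `x`. -/
noncomputable def monom (x : Fin d → R) (α : Fin d →₀ ℕ) : R := ∏ i, x i ^ α i

lemma monom_zero (x : Fin d → R) : monom x 0 = 1 := by simp [monom]

lemma monom_add (x : Fin d → R) (α β : Fin d →₀ ℕ) :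
    monom x (α + β) = monom x α * monom x β := by
  simp [monom, pow_add, Finset.prod_mul_distrib]

lemma monom_single (x : Fin d → R) (i : Fin d) (n : ℕ) :
    monom x (Finsupp.single i n) = x i ^ n := by
  classical
  rw [monom, Finset.prod_eq_single i]
  · simp
  · intro j _ hj; simp [hj.symm]
  · simp

/-- The ideal generated by the elements `x`. -/
def genIdeal (x : Fin d → R) : Ideal R := Ideal.span (Set.range x)

lemma mem_genIdeal (x : Fin d → R) (i : Fin d) : x i ∈ genIdeal x :=
  Ideal.subset_span ⟨i, rfl⟩

lemma monom_mem_pow (x : Fin d → R) (α : Fin d →₀ ℕ) : monom x α ∈ genIdeal x ^ α.degree := by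
  rw [monom, Finsupp.degree_eq_sum, ← Finset.prod_pow_eq_pow_sum]
  exact Ideal.prod_mem_prod fun i _ => Ideal.pow_mem_pow (mem_genIdeal x i) _

lemma pow_genIdeal (x : Fin d → R) (n : ℕ) :
    genIdeal x ^ n = Ideal.span {r | ∃ α : Fin d →₀ ℕ, α.degree = n ∧ r = monom x α} := by
  refine le_antisymm ?_ (Ideal.span_le.2 ?_)
  · induction n with
    | zero =>
      rw [pow_zero, Ideal.one_eq_top, top_le_iff, Ideal.eq_top_iff_one]
      exact Ideal.subset_span ⟨0, by simp, (monom_zero x).symm⟩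
    | succ n ih =>
      rw [pow_succ]
      refine (Ideal.mul_mono_left ih).trans ?_
      rw [genIdeal, Ideal.span_mul_span]
      refine Ideal.span_le.2 ?_
      rintro _ ⟨_, ⟨α, hα, rfl⟩, _, ⟨i, rfl⟩, rfl⟩
      refine Ideal.subset_span ⟨α + Finsupp.single i 1, by simp [hα], ?_⟩
      rw [monom_add, monom_single, pow_one]
  · rintro _ ⟨α, rfl, rfl⟩
    exact monom_mem_pow x α

/-- The ideal generated by the pure powers of the elements `x`. -/
def powIdeal (x : Fin d → R) (b : Fin d → ℕ) : Ideal R := Ideal.span (Set.range fun i => x i ^ b i)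

lemma pow_mem_powIdeal (x : Fin d → R) (b : Fin d → ℕ) (i : Fin d) : x i ^ b i ∈ powIdeal x b :=
  Ideal.subset_span ⟨i, rfl⟩

lemma monom_mem_powIdeal (x : Fin d → R) {b : Fin d → ℕ} {α : Fin d →₀ ℕ} {i : Fin d}
    (h : b i ≤ α i) : monom x α ∈ powIdeal x b := by
  refine Ideal.mem_of_dvd _ ?_ (pow_mem_powIdeal x b i)
  exact (pow_dvd_pow _ h).trans (Finset.dvd_prod_of_mem _ (Finset.mem_univ i))

/-- The pure powers ideal without its `j`-th generator. -/
def powIdealErase (x : Fin d → R) (b : Fin d → ℕ) (j : Fin d) : Ideal R :=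
  Ideal.span ((fun i => x i ^ b i) '' {i | i ≠ j})

lemma powIdeal_eq_sup (x : Fin d → R) (b : Fin d → ℕ) (j : Fin d) :
    powIdeal x b = powIdealErase x b j ⊔ Ideal.span {x j ^ b j} := by
  rw [powIdeal, powIdealErase, ← Ideal.span_union]
  congr 1
  ext r
  constructor
  · rintro ⟨i, rfl⟩
    by_cases h : i = j
    · subst h; exact Or.inr rfl
    · exact Or.inl ⟨i, h, rfl⟩
  · rintro (⟨i, _, rfl⟩ | rfl)
    exacts [⟨i, rfl⟩, ⟨j, rfl⟩]

/-- The elements `x` form a permutable regular sequence, also after raising them to powers. -/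
def PowRegular (x : Fin d → R) : Prop :=
  ∀ (b : Fin d → ℕ) (j : Fin d), NzdMod (powIdealErase x b j) (x j)

lemma PowRegular.of_pow_mul_mem {x : Fin d → R} (hx : PowRegular x) {b : Fin d → ℕ} {j : Fin d}
    {e : ℕ} {c : R} (h : c * x j ^ e ∈ powIdealErase x b j ⊔ Ideal.span {x j ^ (e + b j)}) :
    c ∈ powIdeal x b := by
  obtain ⟨t, ht⟩ := mem_sup_span_singleton_iff.1 h
  rw [powIdeal_eq_sup x b j]
  refine mem_sup_span_singleton_iff.2 ⟨t, ((hx b j).pow e) _ ?_⟩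
  convert ht using 1; ring

lemma PowRegular.of_monom_mul_mem {x : Fin d → R} (hx : PowRegular x) {b : Fin d → ℕ}
    {e : Fin d →₀ ℕ} {c : R} (h : c * monom x e ∈ powIdeal x (fun i => e i + b i)) :
    c ∈ powIdeal x b := by
  classical
  suffices H : ∀ (s : Finset (Fin d)) (c : R),
      c * ∏ i ∈ s, x i ^ e i ∈ powIdeal x (fun i => if i ∈ s then e i + b i else b i) →
      c ∈ powIdeal x b by
    exact H Finset.univ c (by simpa [monom] using h)
  intro s
  induction s using Finset.induction_on with
  | empty => intro c hc; simpa using hc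
  | insert j s hj ih =>
    intro c hc
    refine ih c ?_
    rw [Finset.prod_insert hj, ← mul_assoc, mul_right_comm] at hc
    refine hx.of_pow_mul_mem (j := j) (e := e j) ?_
    rw [powIdeal_eq_sup _ _ j] at hc
    have h1 : powIdealErase x (fun i => if i ∈ insert j s then e i + b i else b i) j =
        powIdealErase x (fun i => if i ∈ s then e i + b i else b i) j := by
      unfold powIdealErase
      congr 1
      refine Set.image_congr fun i hi => ?_
      have : i ≠ j := hi
      simp [this]
    rw [h1] at hc
    simpa [hj] using hc

/-- Quasi-regularity: a relation in which one monomial is expressed through other monomials of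
at least the same degree has its coefficient in the ideal generated by `x`. -/
lemma PowRegular.mem_of_mul_monom_mem {x : Fin d → R} (hx : PowRegular x) {α : Fin d →₀ ℕ} {c : R}
    (h : c * monom x α ∈
      Ideal.span {r | ∃ γ : Fin d →₀ ℕ, γ ≠ α ∧ α.degree ≤ γ.degree ∧ r = monom x γ}) :
    c ∈ genIdeal x := by
  classical
  have key : c ∈ powIdeal x (fun _ => 1) := by
    let e : Fin d →₀ ℕ := Finsupp.equivFunOnFinite.symm fun _ => α.degree
    have hle : α ≤ e := fun i => Finsupp.le_degree i α
    refine hx.of_monom_mul_mem (e := e) ?_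
    have he : e = α + (e - α) := (add_tsub_cancel_of_le hle).symm
    rw [he, monom_add, ← mul_assoc, ← he]
    have h2 := Ideal.mul_mem_mul h (Ideal.mem_span_singleton_self (monom x (e - α)))
    refine (Ideal.span_mul_span _ _).trans_le (Ideal.span_le.2 ?_) h2
    rintro _ ⟨_, ⟨γ, hγ, hdeg, rfl⟩, _, rfl, rfl⟩
    simp only
    rw [← monom_add]
    obtain ⟨i, hi⟩ : ∃ i, α i < γ i := by
      by_contra! hcon
      have hle' : γ ≤ α := hcon
      refine hγ ?_
      have h3 := congrArg Finsupp.degree (add_tsub_cancel_of_le hle')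
      rw [map_add] at h3
      have h4 : α - γ = 0 := by rw [← Finsupp.degree_eq_zero_iff]; omega
      have h5 := add_tsub_cancel_of_le hle'
      rwa [h4, add_zero] at h5
    refine monom_mem_powIdeal x (i := i) ?_
    have := hle i
    simp only [Finsupp.add_apply, Finsupp.tsub_apply]
    omega
  simpa [powIdeal, genIdeal] using key

lemma RegularMod.nzdMod_getElem {K : Ideal R} {l : List R} (h : RegularMod K l) {i : ℕ}
    (hi : i < l.length) : NzdMod (K ⊔ Ideal.ofList (l.take i)) l[i] := by
  induction l generalizing K i with
  | nil => simp at hi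
  | cons x l ih =>
    cases i with
    | zero => simpa [NzdMod] using h.1
    | succ i =>
      have := ih h.2 (i := i) (by simpa using hi)
      simpa [sup_assoc] using this

end Monomials

section Parameters
variable {R : Type u} [CommRing R] [IsNoetherianRing R] [IsLocalRing R] {d : ℕ}

/-- The maximal ideal is generated by a regular sequence of length `d`, and it is not minimal over
ideals with fewer than `d` generators. -/
def IsRegularLocalOfDim (R : Type u) [CommRing R] [IsLocalRing R] (d : ℕ) : Prop :=
  (∀ l : List R, l.length < d → maximalIdeal R ∉ (Ideal.ofList l).minimalPrimes) ∧
    ∃ ys : List R, ys.length = d ∧ RegularMod ⊥ ys ∧ Ideal.ofList ys = maximalIdeal R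

lemma isRegularLocalOfDim_of_span (hdim : ringKrullDim R = d)
    (hreg : ∃ s : Finset R, Ideal.span (s : Set R) = maximalIdeal R ∧ s.card = d) :
    IsDomain R ∧ IsRegularLocalOfDim R d := by
  obtain ⟨s, hs, hsd⟩ := hreg
  have hb : ringKrullDim (R ⧸ (⊥ : Ideal R)) = d := by
    rw [← hdim]; exact ringKrullDim_eq_of_ringEquiv (RingEquiv.quotientBot R)
  obtain ⟨hp, ys, h1, h2, h3⟩ := isPrime_and_exists_regularMod d ⊥ s (by rwa [bot_sup_eq]) hsd hb
  refine ⟨IsDomain.of_bot_isPrime R, fun l hl hmin => ?_, ys, h1, h3, by rwa [bot_sup_eq] at h2⟩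
  classical
  have hl' : Ideal.ofList l = Ideal.span (l.toFinset : Set R) := by
    unfold Ideal.ofList
    congr 1
    ext; simp
  rw [hl'] at hmin
  have h4 := Ideal.height_le_card_of_mem_minimalPrimes_span_finset hmin
  have h5 : ((maximalIdeal R).height : WithBot ℕ∞) = d := by
    rw [IsLocalRing.maximalIdeal_height_eq_ringKrullDim, hdim]
  have h6 : (maximalIdeal R).height = (d : ℕ∞) := by exact_mod_cast h5
  rw [h6] at h4
  have h7 : d ≤ l.toFinset.card := by exact_mod_cast h4
  have := List.toFinset_card_le l
  omega

omit [IsNoetherianRing R] in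
lemma IsRegularLocalOfDim.exists_seq (h : IsRegularLocalOfDim R d) :
    ∃ y : ℕ → R, RegularUpTo y (⊤ : Submodule R R) d ∧ initialIdeal y d = maximalIdeal R := by
  obtain ⟨-, l, rfl, h3, h4⟩ := h
  have key : ∀ i ≤ l.length, initialIdeal (fun i => l.getD i 0) i = Ideal.ofList (l.take i) := by
    intro i hi
    induction i with
    | zero => simp [initialIdeal_zero]
    | succ i ih =>
      rw [initialIdeal_succ, ih (by omega), List.take_succ_eq_append_getElem hi,
        Ideal.ofList_append, Ideal.ofList_singleton, List.getD_eq_getElem _ _ hi]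
  refine ⟨fun i => l.getD i 0, fun i hi v _ hv => ?_, by rw [key _ le_rfl, List.take_length, h4]⟩
  rw [key i hi.le, smul_eq_mul, Ideal.mul_top] at hv ⊢
  have := h3.nzdMod_getElem hi
  rw [bot_sup_eq] at this
  refine this v ?_
  have hgd : l.getD i 0 = l[i] := List.getD_eq_getElem _ _ hi
  rw [← hgd]
  exact hv

lemma IsRegularLocalOfDim.socle_and_regular (h : IsRegularLocalOfDim R d) {xs : List R}
    (hl : xs.length = d) (hm : ∀ a ∈ xs, a ∈ maximalIdeal R)
    (hN : ∃ N, maximalIdeal R ^ N ≤ Ideal.ofList xs) :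
    RegularMod ⊥ xs ∧ SocleCyclic (Ideal.ofList xs) := by
  obtain ⟨h1, ys, h2, h3, h4⟩ := h
  have := regularMod_and_socleCyclic h1 d [] ys xs h2 hl (by simp)
    (fun a ha => by rw [← h4]; exact Ideal.subset_span ha) hm (by simpa using h3)
    ⟨1, by simp [h4]⟩ (by simpa using hN)
  simp only [Ideal.ofList_nil, bot_sup_eq] at this
  exact ⟨this.1, this.2 (h4 ▸ socleCyclic_maximalIdeal)⟩

/-- `x` is a system of parameters. -/
def IsParameters (x : Fin d → R) : Prop :=
  (∀ i, x i ∈ maximalIdeal R) ∧ ∃ N, maximalIdeal R ^ N ≤ genIdeal x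

lemma IsParameters.exists_pow_le_powIdeal {x : Fin d → R} (hx : IsParameters x) (b : Fin d → ℕ) :
    ∃ N, maximalIdeal R ^ N ≤ powIdeal x b := by
  obtain ⟨N, hN⟩ := hx.2
  refine Ideal.exists_pow_le_of_le_radical_of_fg ?_ (IsNoetherian.noetherian _)
  have h1 : genIdeal x ≤ (powIdeal x b).radical := by
    refine Ideal.span_le.2 ?_
    rintro _ ⟨i, rfl⟩
    exact ⟨b i, pow_mem_powIdeal x b i⟩
  intro r hr
  have h2 := h1 (hN (Ideal.pow_mem_pow hr N))
  rw [← Ideal.radical_idem]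
  exact ⟨N, h2⟩

lemma IsParameters.powRegular (h : IsRegularLocalOfDim R d) {x : Fin d → R}
    (hx : IsParameters x) : PowRegular x := by
  classical
  intro b j
  by_cases hb : ∃ i, i ≠ j ∧ b i = 0
  · obtain ⟨i, hi, hbi⟩ := hb
    have : powIdealErase x b j = ⊤ := by
      rw [Ideal.eq_top_iff_one]
      exact Ideal.subset_span ⟨i, hi, by simp [hbi]⟩
    rw [this]; exact fun _ _ => trivial
  push Not at hb
  let b' : Fin d → ℕ := fun i => if i = j then 1 else b i
  have hb' : powIdealErase x b' j = powIdealErase x b j := by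
    unfold powIdealErase
    congr 1
    refine Set.image_congr fun i hi => ?_
    have : i ≠ j := hi
    simp [b', this]
  let l := ((List.finRange d).erase j).map fun i => x i ^ b' i
  have hl : Ideal.ofList l = powIdealErase x b' j := by
    unfold powIdealErase Ideal.ofList
    congr 1
    ext r
    simp only [l, List.mem_map, Set.mem_ofPred_eq, Set.mem_image,
      (List.nodup_finRange d).mem_erase_iff, List.mem_finRange, and_true]
  have hpos : ∀ i, b' i ≠ 0 := by
    intro i
    by_cases hij : i = j
    · simp [b', hij]
    · simpa [b', hij] using hb i hij
  have hlj : Ideal.ofList (l ++ [x j]) = powIdeal x b' := by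
    rw [Ideal.ofList_append, hl, powIdeal_eq_sup x b' j, Ideal.ofList_singleton]
    simp [b']
  have h1 := h.socle_and_regular (xs := l ++ [x j])
    (by
      have : 0 < d := j.pos
      simp [l, List.length_erase_of_mem (List.mem_finRange j)]; omega)
    (by
      intro a ha
      simp only [List.mem_append, List.mem_singleton, l, List.mem_map] at ha
      rcases ha with ⟨i, -, rfl⟩ | rfl
      · exact Ideal.pow_mem_of_mem _ (hx.1 i) _ (Nat.pos_of_ne_zero (hpos i))
      · exact hx.1 j)
    (by rw [hlj]; exact hx.exists_pow_le_powIdeal b')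
  have h2 := (regularMod_append_singleton.1 h1.1).2
  rwa [bot_sup_eq, hl, hb'] at h2

lemma IsParameters.socleCyclic (h : IsRegularLocalOfDim R d) {x : Fin d → R}
    (hx : IsParameters x) : SocleCyclic (genIdeal x) := by
  have h0 : Ideal.ofList (List.ofFn x) = genIdeal x := by
    unfold Ideal.ofList genIdeal
    congr 1
    ext r
    simp [List.mem_ofFn]
  rw [← h0]
  refine (h.socle_and_regular (by simp) (fun a ha => ?_) (h0 ▸ hx.2)).2
  obtain ⟨i, rfl⟩ := List.mem_ofFn.1 ha
  exact hx.1 i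

end Parameters

section BrianconSkoda
variable {R : Type u} [CommRing R] {d : ℕ}

/-- The exponents of degree `n`. -/
noncomputable def degFinset (d n : ℕ) : Finset (Fin d →₀ ℕ) := Finset.finsuppAntidiag univ n

lemma mem_degFinset {n : ℕ} {α : Fin d →₀ ℕ} : α ∈ degFinset d n ↔ α.degree = n := by
  simp [degFinset, Finset.mem_finsuppAntidiag, Finsupp.degree_eq_sum]

lemma mem_pow_genIdeal_iff {x : Fin d → R} {n : ℕ} {r : R} :
    r ∈ genIdeal x ^ n ↔
      ∃ c : (Fin d →₀ ℕ) → R, r = ∑ α ∈ degFinset d n, c α * monom x α := by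
  have h : {r | ∃ α : Fin d →₀ ℕ, α.degree = n ∧ r = monom x α} =
      monom x '' (degFinset d n : Set (Fin d →₀ ℕ)) := by
    ext r
    simp only [Set.mem_image, Finset.mem_coe, mem_degFinset]
    exact exists_congr fun α => and_congr_right fun _ => eq_comm
  rw [pow_genIdeal, h, Ideal.span, Submodule.mem_span_image_finset_iff_exists_fun']
  simp only [smul_eq_mul, eq_comm]

lemma pow_genIdeal_le_powIdeal_pow (x : Fin d → R) {a : ℕ} (ha : 0 < a) (n : ℕ) :
    (genIdeal x ^ a) ^ (n + d) ≤ powIdeal x (fun _ => a) ^ n := by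
  rw [← pow_mul, pow_genIdeal, Ideal.span_le]
  rintro _ ⟨α, hα, rfl⟩
  have hprod : monom x α = (∏ i, (x i ^ a) ^ (α i / a)) * ∏ i, x i ^ (α i % a) := by
    rw [← Finset.prod_mul_distrib, monom]
    exact Finset.prod_congr rfl fun i _ => by rw [← pow_mul, ← pow_add, Nat.div_add_mod]
  have hn : n ≤ ∑ i, α i / a := by
      rw [Finsupp.degree_eq_sum] at hα
      have h1 : ∑ i, α i ≤ ∑ i, (a * (α i / a) + a) :=
        Finset.sum_le_sum fun i _ => by
          have := Nat.div_add_mod (α i) a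
          have := Nat.mod_lt (α i) ha
          omega
      rw [hα, Finset.sum_add_distrib, ← Finset.mul_sum] at h1
      simp only [sum_const, card_univ, Fintype.card_fin, smul_eq_mul] at h1
      have : a * n ≤ a * ∑ i, α i / a := by nlinarith
      exact Nat.le_of_mul_le_mul_left this ha
  refine Ideal.pow_le_pow_right hn ?_
  rw [hprod]
  refine Ideal.mul_mem_right _ _ ?_
  rw [← Finset.prod_pow_eq_pow_sum]
  exact Ideal.prod_mem_prod fun i _ => Ideal.pow_mem_pow (pow_mem_powIdeal x (fun _ => a) i) _


variable [IsNoetherianRing R] [IsLocalRing R] [IsDomain R]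

lemma almostClosure_pow_le_powIdeal (h : IsRegularLocalOfDim R d) (hd : 0 < d) {x : Fin d → R}
    (hx : genIdeal x ≠ ⊥) {a : ℕ} (ha : 0 < a) :
    almostClosure (genIdeal x ^ (d * a)) ≤ powIdeal x (fun _ => a) := by
  intro z hz
  rw [mem_almostClosure, mul_comm, pow_mul] at hz
  have hQ : powIdeal x (fun _ => a) ≠ ⊥ := by
    intro h0
    refine hx ((Submodule.eq_bot_iff _).2 fun r hr => ?_)
    have : genIdeal x ≤ ⊥ := by
      refine Ideal.span_le.2 ?_
      rintro _ ⟨i, rfl⟩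
      have := pow_mem_powIdeal x (fun _ => a) i
      rw [h0, Ideal.mem_bot] at this
      exact Ideal.mem_bot.2 ((pow_eq_zero_iff ha.ne').1 this)
    exact this hr
  have h1 := (almostIntegralOver_of_pow_mem hQ
    (fun n => pow_genIdeal_le_powIdeal_pow x ha n) hz).mem_integralOverIdeal
  obtain ⟨y, hy, hym⟩ := h.exists_seq
  have h2 : Ideal.ofList (List.ofFn fun i => x i ^ a) = powIdeal x (fun _ => a) := by
    unfold Ideal.ofList powIdeal
    congr 1
    ext r
    simp [List.mem_ofFn]
  rw [← h2]
  refine mem_of_integralOver_pow_length hy hym _ (by simp; omega) ?_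
  rwa [h2, List.length_ofFn]

/-- The Briançon–Skoda theorem for parameters in a regular local ring. -/
theorem almostClosure_pow_le (h : IsRegularLocalOfDim R d) (hd : 0 < d) {x : Fin d → R}
    (hx : genIdeal x ≠ ⊥) (hp : PowRegular x) (N : ℕ) :
    almostClosure (genIdeal x ^ N) ≤ genIdeal x ^ (N - (d - 1)) := by
  intro z hz
  set Q := powIdeal x (fun _ => N + 1) with hQ
  suffices H : ∀ t, t ≤ N - (d - 1) → z ∈ genIdeal x ^ t ⊔ Q by
    have h1 : Q ≤ genIdeal x ^ (N - (d - 1)) := by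
      refine Ideal.span_le.2 ?_
      rintro _ ⟨i, rfl⟩
      exact Ideal.pow_le_pow_right (by omega : N - (d - 1) ≤ N + 1)
        (Ideal.pow_mem_pow (mem_genIdeal x i) _)
    have := H _ le_rfl
    rwa [sup_eq_left.2 h1] at this
  intro t
  induction t with
  | zero => intro _; simp
  | succ t ih =>
    intro ht
    obtain ⟨w, hw, q, hq, hz'⟩ := Submodule.mem_sup.1 (ih (by omega))
    obtain ⟨c, rfl⟩ := mem_pow_genIdeal_iff.1 hw
    rw [← hz']
    refine add_mem (sum_mem fun α hα => ?_) (Ideal.mem_sup_right hq)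
    rw [mem_degFinset] at hα
    by_cases hbig : ∃ i, N + 1 ≤ α i
    · obtain ⟨i, hi⟩ := hbig
      exact Ideal.mem_sup_right (Ideal.mul_mem_left _ _ (monom_mem_powIdeal x hi))
    push Not at hbig
    refine Ideal.mem_sup_left ?_
    rw [pow_succ', ← hα]
    refine Ideal.mul_mem_mul ?_ (monom_mem_pow x α)
    let e : Fin d →₀ ℕ := Finsupp.equivFunOnFinite.symm fun _ => N
    have hle : α ≤ e := fun i => by have := hbig i; simp [e]; omega
    have hedeg : e.degree = d * N := by simp [e, Finsupp.degree_eq_sum]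
    have he : α + (e - α) = e := add_tsub_cancel_of_le hle
    have hdeg : α.degree + (e - α).degree = d * N := by rw [← map_add, he, hedeg]
    have hzQ : z * monom x (e - α) ∈ Q := by
      refine almostClosure_pow_le_powIdeal h hd hx N.succ_pos ?_
      refine AlmostIntegralOver.mono (?_ : genIdeal x ^ (N + (e - α).degree) ≤ _) ?_
      · refine Ideal.pow_le_pow_right ?_
        rw [Nat.mul_succ]
        omega
      · rw [pow_add]
        exact AlmostIntegralOver.mul hz (AlmostIntegralOver.of_mem (monom_mem_pow x _))
    have hc : c α * monom x e ∈ Q := by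
      have h1 : c α * monom x e = z * monom x (e - α) - q * monom x (e - α) -
          ∑ β ∈ (degFinset d t).erase α, c β * monom x (β + (e - α)) := by
        rw [← hz', ← Finset.add_sum_erase _ _ (mem_degFinset.2 hα), ← he, monom_add,
          add_tsub_cancel_left, add_mul, add_mul, Finset.sum_mul]
        simp only [monom_add, mul_assoc]
        ring
      rw [h1]
      refine sub_mem (sub_mem hzQ (Ideal.mul_mem_right _ _ hq)) (sum_mem fun β hβ => ?_)
      refine Ideal.mul_mem_left _ _ ?_
      obtain ⟨hne, hβd⟩ := Finset.mem_erase.1 hβ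
      rw [mem_degFinset] at hβd
      obtain ⟨i, hi⟩ : ∃ i, α i < β i := by
        by_contra! hcon
        have hle' : β ≤ α := hcon
        have h3 := congrArg Finsupp.degree (add_tsub_cancel_of_le hle')
        rw [map_add] at h3
        have h4 : α - β = 0 := by rw [← Finsupp.degree_eq_zero_iff]; omega
        have h5 := add_tsub_cancel_of_le hle'
        rw [h4, add_zero] at h5
        exact hne h5
      refine monom_mem_powIdeal x (i := i) ?_
      have h6 := hle i
      have h7 : e i = N := by simp [e]
      simp only [Finsupp.add_apply, Finsupp.tsub_apply]
      omega
    have := hp.of_monom_mul_mem (b := fun _ => 1) (e := e) (c := c α) (by simpa [e, hQ] using hc)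
    simpa [powIdeal, genIdeal] using this

end BrianconSkoda

section Colength
variable {R : Type u} [CommRing R]

/-- The length of the quotient by an ideal. -/
noncomputable def colength (K : Ideal R) : ℕ∞ := Module.length R (R ⧸ K)

lemma colength_anti {K L : Ideal R} (h : K ≤ L) : colength L ≤ colength K :=
  Module.length_le_of_surjective (Submodule.factor h) (Submodule.factor_surjective h)

lemma colength_top : colength (⊤ : Ideal R) = 0 := by
  have : Subsingleton (R ⧸ (⊤ : Ideal R)) := Submodule.Quotient.subsingleton_iff.2 rfl
  exact Module.length_eq_zero

lemma one_le_colength {K : Ideal R} (h : K ≠ ⊤) : 1 ≤ colength K := by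
  have := Ideal.Quotient.nontrivial_iff.2 h
  exact Order.one_le_iff_pos.2 (Module.length_pos)

/-- The elements whose product with `b` lies in `U`. -/
def colonBy (U : Ideal R) (b : R) : Ideal R := Submodule.comap (LinearMap.mulRight R b) U

lemma mem_colonBy {U : Ideal R} {b c : R} : c ∈ colonBy U b ↔ c * b ∈ U := Iff.rfl

lemma colength_eq_add_colonBy (U : Ideal R) (b : R) :
    colength U = colength (colonBy U b) + colength (U ⊔ Ideal.span {b}) := by
  refine Module.length_eq_add_of_exact
    (Submodule.mapQ (colonBy U b) U (LinearMap.mulRight R b)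
      (fun _ h => h))
    (Submodule.factor (le_sup_left : U ≤ U ⊔ Ideal.span {b})) ?_
    (Submodule.factor_surjective _) ?_
  · rw [injective_iff_map_eq_zero]
    intro r hr
    obtain ⟨r, rfl⟩ := Submodule.mkQ_surjective _ r
    change Submodule.Quotient.mk (r * b) = 0 at hr
    rw [Submodule.Quotient.mk_eq_zero] at hr
    exact (Submodule.Quotient.mk_eq_zero _).2 hr
  · intro r
    obtain ⟨r, rfl⟩ := Submodule.mkQ_surjective _ r
    constructor
    · intro hr
      have h1 : r ∈ U ⊔ Ideal.span {b} := by
        rw [← Submodule.Quotient.mk_eq_zero]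
        exact hr
      obtain ⟨t, ht⟩ := mem_sup_span_singleton_iff.1 h1
      refine ⟨Submodule.Quotient.mk t, ?_⟩
      change Submodule.Quotient.mk (t * b) = Submodule.Quotient.mk r
      rw [eq_comm, Submodule.Quotient.eq, mul_comm]
      exact ht
    · rintro ⟨t, ht⟩
      obtain ⟨t, rfl⟩ := Submodule.mkQ_surjective _ t
      rw [← ht]
      change Submodule.Quotient.mk (t * b) = 0
      rw [Submodule.Quotient.mk_eq_zero]
      exact Ideal.mem_sup_right (Ideal.mul_mem_left _ _ (Ideal.mem_span_singleton_self b))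

variable {d : ℕ}

/-- The ideal generated by the monomials with exponent larger than `α`. -/
noncomputable def higherIdeal (x : Fin d → R) (α : Fin d →₀ ℕ) : Ideal R :=
  Ideal.span (monom x '' {β | toDegLex α < toDegLex β})

/-- The ideal of leading coefficients at `α` of elements of `Γ`. -/
noncomputable def leadIdeal (x : Fin d → R) (Γ : Ideal R) (α : Fin d →₀ ℕ) : Ideal R :=
  colonBy (Γ ⊔ higherIdeal x α) (monom x α)

lemma colength_sup_span_eq_sum (x : Fin d → R) (Γ : Ideal R) (S : Finset (Fin d →₀ ℕ))
    (hS : ∀ α ∈ S, ∀ β, toDegLex β < toDegLex α → β ∈ S) :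
    colength (Γ ⊔ Ideal.span (monom x '' {β | β ∉ S})) =
      ∑ α ∈ S, colength (leadIdeal x Γ α) := by
  classical
  revert hS
  refine Finset.induction_on_max_value (toDegLex : (Fin d →₀ ℕ) → DegLex (Fin d →₀ ℕ)) S ?_ ?_
  · intro _
    rw [Finset.sum_empty]
    convert colength_top (R := R)
    rw [Ideal.eq_top_iff_one]
    exact Ideal.mem_sup_right (Ideal.subset_span ⟨0, by simp, monom_zero x⟩)
  · intro a S ha hmax ih hS
    have hS' : ∀ α ∈ S, ∀ β, toDegLex β < toDegLex α → β ∈ S := by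
      intro α hα β hβ
      refine (Finset.mem_insert.1 (hS α (Finset.mem_insert_of_mem hα) β hβ)).resolve_left ?_
      rintro rfl
      exact (hβ.trans_le (hmax α hα)).ne rfl
    have h1 : {β | β ∉ insert a S} = {β : Fin d →₀ ℕ | toDegLex a < toDegLex β} := by
      ext β
      simp only [Set.mem_ofPred_eq, Finset.mem_insert, not_or]
      constructor
      · rintro ⟨hβa, hβS⟩
        by_contra hle
        rcases (not_lt.1 hle).lt_or_eq with h | h
        · exact hβS ((Finset.mem_insert.1 (hS a (Finset.mem_insert_self _ _) β h)).resolve_left hβa)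
        · exact hβa (toDegLex_injective h)
      · intro h
        refine ⟨?_, fun hβ => absurd (hmax β hβ) (not_le.2 h)⟩
        rintro rfl
        exact lt_irrefl _ h
    have h2 : {β | β ∉ S} = {β | β ∉ insert a S} ∪ {a} := by
      ext β
      simp only [Set.mem_ofPred_eq, Finset.mem_insert, not_or, Set.mem_union, Set.mem_singleton_iff]
      constructor
      · intro h
        by_cases hβ : β = a
        exacts [Or.inr hβ, Or.inl ⟨hβ, h⟩]
      · rintro (h | rfl)
        exacts [h.2, ha]
    rw [Finset.sum_insert ha, ← ih hS', h2, Set.image_union, Ideal.span_union, ← sup_assoc,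
      Set.image_singleton, h1]
    exact colength_eq_add_colonBy _ _

lemma sum_degFinset_disjoint (n : ℕ) {M : Type*} [AddCommMonoid M] (f : (Fin d →₀ ℕ) → M) :
    ∑ α ∈ (range n).biUnion (degFinset d), f α = ∑ i ∈ range n, ∑ α ∈ degFinset d i, f α := by
  refine Finset.sum_biUnion fun i _ j _ hij => ?_
  rw [Function.onFun, Finset.disjoint_left]
  intro α h1 h2
  exact hij ((mem_degFinset.1 h1).symm.trans (mem_degFinset.1 h2))

theorem colength_eq_sum (x : Fin d → R) {Γ : Ideal R} {n : ℕ} (hΓ : genIdeal x ^ n ≤ Γ) :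
    colength Γ = ∑ i ∈ range n, ∑ α ∈ degFinset d i, colength (leadIdeal x Γ α) := by
  rw [← sum_degFinset_disjoint, ← colength_sup_span_eq_sum]
  · congr 1
    refine (sup_eq_left.2 (Ideal.span_le.2 ?_)).symm
    rintro _ ⟨β, hβ, rfl⟩
    simp only [Set.mem_ofPred_eq, Finset.mem_biUnion, mem_degFinset, mem_range, not_exists,
      not_and] at hβ
    refine hΓ (Ideal.pow_le_pow_right ?_ (monom_mem_pow x β))
    by_contra h
    exact hβ β.degree (not_le.1 h) rfl
  · intro α hα β hβ
    simp only [Finset.mem_biUnion, mem_degFinset, mem_range] at hα ⊢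
    obtain ⟨i, hi, rfl⟩ := hα
    exact ⟨_, (Finsupp.DegLex.monotone_degree hβ.le).trans_lt hi, rfl⟩

lemma card_degFinset_succ (i : ℕ) : #(degFinset (d + 1) i) = (i + d).choose d := by
  rw [degFinset, Finset.card_finsuppAntidiag_nat_eq_choose, Finset.card_univ, Fintype.card_fin,
    show d + 1 + i - 1 = i + d by omega, ← Nat.choose_symm_add]

lemma sum_card_degFinset (n : ℕ) :
    ∑ i ∈ range n, #(degFinset (d + 1) i) = (n + d).choose (d + 1) := by
  induction n with
  | zero => simp
  | succ n ih =>
    rw [Finset.sum_range_succ, ih, card_degFinset_succ, show n + 1 + d = (n + d) + 1 by ring,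
      Nat.choose_succ_succ, add_comm]

end Colength

section Reduction
variable {R : Type u} [CommRing R]

/-- Some `r` elements of `I` generate an ideal `J` such that `I ^ (n + t) ≤ J ^ n` for all `n`. -/
def HasReductionBy (I : Ideal R) (r : ℕ) : Prop :=
  ∃ x : Fin r → R, genIdeal x ≤ I ∧ ∃ t, ∀ n, I ^ (n + t) ≤ genIdeal x ^ n

lemma HasReductionBy.succ {I : Ideal R} {r : ℕ} (h : HasReductionBy I r) :
    HasReductionBy I (r + 1) := by
  obtain ⟨x, h⟩ := h
  have : genIdeal (Fin.cons 0 x : Fin (r + 1) → R) = genIdeal x := by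
    rw [genIdeal, Fin.range_cons, Ideal.span_insert_zero]
    rfl
  exact ⟨Fin.cons 0 x, this ▸ h⟩

lemma exists_hasReductionBy [IsNoetherianRing R] (I : Ideal R) : ∃ r, HasReductionBy I r := by
  obtain ⟨n, x, hx⟩ := Submodule.fg_iff_exists_fin_generating_family.1 (IsNoetherian.noetherian I)
  exact ⟨n, x, hx.le, 0, fun n => by rw [add_zero]; exact Ideal.pow_right_mono hx.ge n⟩

lemma mem_of_leadIdeal_eq_top {r n : ℕ} {x : Fin r → R} {α : Fin r →₀ ℕ} (hα : α.degree < n)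
    (h : leadIdeal x (genIdeal x ^ n) α = ⊤) :
    ∃ c : (Fin r →₀ ℕ) → R, c α = 1 ∧
      ∑ β ∈ degFinset r α.degree, c β * monom x β ∈ genIdeal x ^ (α.degree + 1) := by
  classical
  have h1 : monom x α ∈ genIdeal x ^ n ⊔ higherIdeal x α := by
    have := (Ideal.eq_top_iff_one _).1 h
    rwa [leadIdeal, mem_colonBy, one_mul] at this
  have h2 : genIdeal x ^ n ⊔ higherIdeal x α ≤ genIdeal x ^ (α.degree + 1) ⊔
      Ideal.span (monom x '' (((degFinset r α.degree).erase α : Finset _) : Set (Fin r →₀ ℕ))) := by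
    refine sup_le ((Ideal.pow_le_pow_right hα).trans le_sup_left) (Ideal.span_le.2 ?_)
    rintro _ ⟨β, hβ, rfl⟩
    have hβ' : toDegLex α < toDegLex β := hβ
    rcases (Finsupp.DegLex.monotone_degree hβ'.le).lt_or_eq with h3 | h3
    · exact Ideal.mem_sup_left (Ideal.pow_le_pow_right h3 (monom_mem_pow x β))
    · refine Ideal.mem_sup_right (Ideal.subset_span ⟨β, ?_, rfl⟩)
      rw [Finset.mem_coe, Finset.mem_erase, mem_degFinset]
      refine ⟨?_, h3.symm⟩
      rintro rfl
      exact lt_irrefl _ hβ'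
  obtain ⟨j, hj, w, hw, hjw⟩ := Submodule.mem_sup.1 (h2 h1)
  obtain ⟨c, rfl⟩ := (Submodule.mem_span_image_finset_iff_exists_fun' R).1 hw
  refine ⟨fun β => if β = α then 1 else - c β, by simp, ?_⟩
  rw [← Finset.add_sum_erase _ _ (mem_degFinset.2 rfl : α ∈ degFinset r α.degree)]
  have h4 : ∑ β ∈ (degFinset r α.degree).erase α, (if β = α then 1 else - c β) * monom x β =
      - ∑ β ∈ (degFinset r α.degree).erase α, c β • monom x β := by
    rw [← Finset.sum_neg_distrib]
    refine Finset.sum_congr rfl fun β hβ => ?_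
    rw [if_neg (Finset.ne_of_mem_erase hβ), smul_eq_mul, neg_mul]
  rw [h4]
  beta_reduce
  rw [if_pos rfl, one_mul, ← hjw, add_neg_cancel_right]
  exact hj

lemma monom_sub_mem {r : ℕ} {x b : Fin r → R} {Y J : Ideal R} {j : Fin r}
    (hxJ : ∀ i, x i ∈ J) (hY : ∀ i, x i - b i * x j ∈ Y) (β : Fin r →₀ ℕ) {w : R} (hw : w ∈ J) :
    w * (monom x β - monom b β * x j ^ β.degree) ∈ Y * J ^ β.degree := by
  classical
  let Q : R → R → ℕ → Prop := fun u v s =>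
    u ∈ J ^ s ∧ v ∈ J ^ s ∧ ∀ w ∈ J, w * (u - v) ∈ Y * J ^ s
  have hmul : ∀ u v s u' v' s', Q u v s → Q u' v' s' → Q (u * u') (v * v') (s + s') := by
    rintro u v s u' v' s' ⟨h1, h2, h3⟩ ⟨h1', h2', h3'⟩
    refine ⟨pow_add J s s' ▸ Ideal.mul_mem_mul h1 h1', pow_add J s s' ▸ Ideal.mul_mem_mul h2 h2',
      fun w hw => ?_⟩
    have : w * (u * u' - v * v') = w * (u' - v') * u + w * (u - v) * v' := by ring
    rw [this]
    refine add_mem ?_ ?_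
    · have := Ideal.mul_mem_mul (h3' w hw) h1
      rwa [mul_assoc, ← pow_add, add_comm s'] at this
    · have := Ideal.mul_mem_mul (h3 w hw) h2'
      rwa [mul_assoc, ← pow_add] at this
  have hone : Q 1 1 0 := ⟨by simp, by simp, fun w _ => by simp⟩
  have hx : ∀ i, Q (x i) (b i * x j) 1 := fun i => by
    refine ⟨by simpa using hxJ i, by simpa using Ideal.mul_mem_left _ _ (hxJ j), fun w hw => ?_⟩
    rw [pow_one, mul_comm w]
    exact Ideal.mul_mem_mul (hY i) hw
  have hpow : ∀ i n, Q (x i ^ n) ((b i * x j) ^ n) n := by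
    intro i n
    induction n with
    | zero => simpa using hone
    | succ n ih => rw [pow_succ, pow_succ]; exact hmul _ _ _ _ _ _ ih (hx i)
  have hprod : ∀ s : Finset (Fin r), Q (∏ i ∈ s, x i ^ β i) (∏ i ∈ s, (b i * x j) ^ β i)
      (∑ i ∈ s, β i) := by
    intro s
    induction s using Finset.induction_on with
    | empty => simpa using hone
    | insert i s hi ih =>
      rw [Finset.prod_insert hi, Finset.prod_insert hi, Finset.sum_insert hi]
      exact hmul _ _ _ _ _ _ (hpow i _) ih
  have h := (hprod univ).2.2 w hw
  simp only [mul_pow, Finset.prod_mul_distrib, Finset.prod_pow_eq_pow_sum] at h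
  rwa [← Finsupp.degree_eq_sum] at h

variable [IsLocalRing R]

lemma exists_isUnit_eval [Infinite (ResidueField R)] {r s : ℕ} {c : (Fin r →₀ ℕ) → R}
    {α : Fin r →₀ ℕ} (hα : α ∈ degFinset r s) (hc : c α = 1) :
    ∃ a : Fin r → R, IsUnit (∑ β ∈ degFinset r s, c β * monom a β) := by
  classical
  let p : MvPolynomial (Fin r) (ResidueField R) :=
    ∑ β ∈ degFinset r s, MvPolynomial.monomial β (residue R (c β))
  have hp : p ≠ 0 := by
    intro h
    have := congrArg (MvPolynomial.coeff α) h
    simp [p, MvPolynomial.coeff_sum, MvPolynomial.coeff_monomial, hα, hc] at this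
  obtain ⟨a, ha⟩ : ∃ a, MvPolynomial.eval a p ≠ 0 := by
    by_contra! hcon
    exact hp (MvPolynomial.funext fun a => by simpa using hcon a)
  choose a' ha' using fun i => residue_surjective (a i)
  refine ⟨a', ?_⟩
  rw [← residue_ne_zero_iff_isUnit]
  convert ha using 1
  simp [p, map_sum, monom, ha', MvPolynomial.eval_monomial, Finsupp.prod_fintype]

variable [IsNoetherianRing R]

lemma HasReductionBy.of_relation [Infinite (ResidueField R)] {I : Ideal R} {r : ℕ}
    {x : Fin (r + 1) → R} (hI : I ≤ maximalIdeal R) (hx : genIdeal x ≤ I) {t : ℕ}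
    (ht : ∀ n, I ^ (n + t) ≤ genIdeal x ^ n) {s : ℕ} {c : (Fin (r + 1) →₀ ℕ) → R}
    {α : Fin (r + 1) →₀ ℕ} (hα : α ∈ degFinset (r + 1) s) (hc : c α = 1)
    (hrel : ∑ β ∈ degFinset (r + 1) s, c β * monom x β ∈ genIdeal x ^ (s + 1)) :
    HasReductionBy I r := by
  classical
  set J := genIdeal x with hJ
  obtain ⟨a, ha⟩ := exists_isUnit_eval hα hc
  obtain ⟨j, hj⟩ : ∃ j, IsUnit (a j) := by
    by_contra! hcon
    rcases Nat.eq_zero_or_pos s with rfl | hs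
    · have h0 : degFinset (r + 1) 0 = {0} := by
        ext β; simp [mem_degFinset, Finsupp.degree_eq_zero_iff]
      rw [h0, Finset.mem_singleton] at hα
      subst hα
      rw [h0] at hrel
      simp only [Finset.sum_singleton, hc, monom_zero, mul_one, zero_add, pow_one] at hrel
      exact (maximalIdeal.isMaximal R).ne_top ((Ideal.eq_top_iff_one _).2 (hI (hx hrel)))
    · refine (mem_maximalIdeal _).1 ?_ ha
      refine sum_mem fun β hβ => Ideal.mul_mem_left _ _ ?_
      have h1 : genIdeal a ≤ maximalIdeal R := by
        refine Ideal.span_le.2 ?_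
        rintro _ ⟨i, rfl⟩
        exact (mem_maximalIdeal _).2 (hcon i)
      rw [mem_degFinset] at hβ
      exact h1 (Ideal.pow_le_self (by omega) (monom_mem_pow a β))
  obtain ⟨v, hv⟩ := isUnit_iff_exists_inv.1 hj
  let b : Fin (r + 1) → R := fun i => v * a i
  have hb : ∀ β ∈ degFinset (r + 1) s, monom b β = v ^ s * monom a β := by
    intro β hβ
    rw [mem_degFinset, Finsupp.degree_eq_sum] at hβ
    simp only [monom, b, mul_pow, Finset.prod_mul_distrib, Finset.prod_pow_eq_pow_sum, hβ]
  have hbu : IsUnit (∑ β ∈ degFinset (r + 1) s, c β * monom b β) := by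
    have : ∑ β ∈ degFinset (r + 1) s, c β * monom b β =
        v ^ s * ∑ β ∈ degFinset (r + 1) s, c β * monom a β := by
      rw [Finset.mul_sum]
      refine Finset.sum_congr rfl fun β hβ => ?_
      rw [hb β hβ]; ring
    rw [this]
    exact (IsUnit.pow _ (isUnit_iff_exists_inv.2 ⟨a j, by rw [mul_comm]; exact hv⟩)).mul ha
  have hbj : b j = 1 := by simp only [b]; rw [mul_comm]; exact hv
  let y : Fin r → R := fun i => x (j.succAbove i) - b (j.succAbove i) * x j
  have hxy : ∀ i, x i - b i * x j ∈ genIdeal y := by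
    intro i
    rcases Fin.eq_self_or_eq_succAbove j i with rfl | ⟨i, rfl⟩
    · rw [hbj, one_mul, sub_self]; exact zero_mem _
    · exact mem_genIdeal y i
  have hyJ : genIdeal y ≤ J := by
    refine Ideal.span_le.2 ?_
    rintro _ ⟨i, rfl⟩
    exact sub_mem (mem_genIdeal x _) (Ideal.mul_mem_left _ _ (mem_genIdeal x _))
  have hxjs : ∀ w ∈ J, w * x j ^ s ∈ genIdeal y * J ^ s ⊔ J * J ^ (s + 1) := by
    intro w hw
    have h1 : w * ((∑ β ∈ degFinset (r + 1) s, c β * monom x β) -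
        (∑ β ∈ degFinset (r + 1) s, c β * monom b β) * x j ^ s) ∈ genIdeal y * J ^ s := by
      rw [Finset.sum_mul, ← Finset.sum_sub_distrib, Finset.mul_sum]
      refine sum_mem fun β hβ => ?_
      have h2 := monom_sub_mem (b := b) (fun i => mem_genIdeal x i) hxy β hw
      rw [mem_degFinset.1 hβ] at h2
      have h3 : w * (c β * monom x β - c β * monom b β * x j ^ s) =
        c β * (w * (monom x β - monom b β * x j ^ s)) := by ring
      rw [h3]
      exact Ideal.mul_mem_left _ _ h2
    obtain ⟨u, hu⟩ := isUnit_iff_exists_inv.1 hbu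
    have h4 : w * x j ^ s = u * (w * (∑ β ∈ degFinset (r + 1) s, c β * monom x β) -
        w * ((∑ β ∈ degFinset (r + 1) s, c β * monom x β) -
        (∑ β ∈ degFinset (r + 1) s, c β * monom b β) * x j ^ s)) := by
      linear_combination (-(w * x j ^ s)) * hu
    rw [h4]
    exact Ideal.mul_mem_left _ _ (sub_mem (Ideal.mem_sup_right (Ideal.mul_mem_mul hw hrel))
      (Ideal.mem_sup_left h1))
  have hle : J ^ (s + 1) ≤ genIdeal y * J ^ s := by
    refine Submodule.le_of_le_smul_of_le_jacobson_bot (I := J)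
      (IsNoetherian.noetherian _) ((hx.trans hI).trans (IsLocalRing.maximalIdeal_le_jacobson _)) ?_
    rw [smul_eq_mul]
    conv_lhs => rw [pow_succ', hJ, pow_genIdeal, ← hJ]
    refine Ideal.mul_le.2 fun w hw z hz => ?_
    induction hz using Submodule.span_induction with
    | zero => simp
    | add z z' _ _ h h' => rw [mul_add]; exact add_mem h h'
    | smul e z _ h => rw [smul_eq_mul, mul_left_comm]; exact Ideal.mul_mem_left _ _ h
    | mem z hz =>
      obtain ⟨β, hβ, rfl⟩ := hz
      have h2 := monom_sub_mem (b := b) (fun i => mem_genIdeal x i) hxy β hw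
      rw [hβ] at h2
      have h3 : w * monom x β = w * (monom x β - monom b β * x j ^ s) +
        monom b β * (w * x j ^ s) := by ring
      rw [h3]
      exact add_mem (Ideal.mem_sup_left h2) (Ideal.mul_mem_left _ _ (hxjs w hw))
  have hfin : ∀ n, J ^ (n + s) ≤ genIdeal y ^ n * J ^ s := by
    intro n
    induction n with
    | zero => simp
    | succ n ih =>
      calc J ^ (n + 1 + s) = J ^ (n + s) * J := by rw [← pow_succ]; congr 1; ring
        _ ≤ genIdeal y ^ n * J ^ s * J := Ideal.mul_mono_left ih
        _ = genIdeal y ^ n * J ^ (s + 1) := by rw [mul_assoc, pow_succ]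
        _ ≤ genIdeal y ^ n * (genIdeal y * J ^ s) := Ideal.mul_mono_right hle
        _ = _ := by rw [← mul_assoc, ← pow_succ]
  refine ⟨y, hyJ.trans hx, s + t, fun n => ?_⟩
  rw [← add_assoc]
  exact (ht _).trans ((hfin n).trans Ideal.mul_le_left)

/-- The colengths of the powers of `I` are bounded by a polynomial of degree `d`. -/
def PolyBounded (I : Ideal R) (d : ℕ) : Prop :=
  ∃ A N : ℕ, ∀ n ≥ N, colength (I ^ n) ≤ ((A * n ^ d : ℕ) : ℕ∞)

lemma HasReductionBy.pred [Infinite (ResidueField R)] {I : Ideal R} {r d : ℕ}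
    (hI : I ≤ maximalIdeal R) (hb : PolyBounded I d) (hrd : d ≤ r)
    (h : HasReductionBy I (r + 1)) : HasReductionBy I r := by
  obtain ⟨x, hx, t, ht⟩ := h
  obtain ⟨A, N, hA⟩ := hb
  by_cases hex : ∃ n α, α.degree < n ∧ leadIdeal x (genIdeal x ^ n) α = ⊤
  · obtain ⟨n, α, hα, htop⟩ := hex
    obtain ⟨c, hc, hrel⟩ := mem_of_leadIdeal_eq_top hα htop
    exact HasReductionBy.of_relation hI hx ht (mem_degFinset.2 rfl) hc hrel
  exfalso
  push Not at hex
  have hlow : ∀ n, (((n + r).choose (r + 1) : ℕ) : ℕ∞) ≤ colength (genIdeal x ^ n) := by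
    intro n
    rw [colength_eq_sum x le_rfl, ← sum_card_degFinset, Nat.cast_sum]
    refine Finset.sum_le_sum fun i hi => ?_
    rw [Finset.card_eq_sum_ones, Nat.cast_sum]
    refine Finset.sum_le_sum fun α hα => ?_
    rw [Nat.cast_one]
    exact one_le_colength (hex n α (by rw [mem_degFinset.1 hα]; exact mem_range.1 hi))
  set B := (r + 1).factorial * (A * 2 ^ d) with hB
  let n := N + t + B + 1
  have h1 : (n + r).choose (r + 1) ≤ A * (n + t) ^ d := by
    have := (hlow n).trans ((colength_anti (ht n)).trans (hA (n + t) (by omega)))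
    exact_mod_cast this
  have h2 : n ^ (r + 1) ≤ (r + 1).factorial * (n + r).choose (r + 1) := by
    have := Nat.pow_succ_le_ascFactorial n (r + 1)
    rwa [Nat.ascFactorial_eq_factorial_mul_choose', ← add_assoc, Nat.add_sub_cancel] at this
  have h3 : n ^ (d + 1) ≤ n ^ (r + 1) := Nat.pow_le_pow_right (by omega) (by omega)
  have h4 : (n + t) ^ d ≤ 2 ^ d * n ^ d := by
    rw [← mul_pow]; exact Nat.pow_le_pow_left (by omega) d
  have h5 : n ^ d * n ≤ n ^ d * B := by
    rw [← pow_succ, hB]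
    calc n ^ (d + 1) ≤ (r + 1).factorial * (A * (n + t) ^ d) :=
          h3.trans (h2.trans (Nat.mul_le_mul_left _ h1))
      _ ≤ (r + 1).factorial * (A * (2 ^ d * n ^ d)) := by gcongr
      _ = _ := by ring
  have h6 := Nat.le_of_mul_le_mul_left h5 (by positivity)
  omega

theorem PolyBounded.hasReductionBy [Infinite (ResidueField R)] {I : Ideal R} {d : ℕ}
    (hI : I ≤ maximalIdeal R) (hb : PolyBounded I d) : HasReductionBy I d := by
  obtain ⟨r, hr⟩ := exists_hasReductionBy I
  have h1 : ∀ k, HasReductionBy I (r + k) := by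
    intro k
    induction k with
    | zero => exact hr
    | succ k ih => exact ih.succ
  have h2 := h1 d
  rw [add_comm] at h2
  have h3 : ∀ k, HasReductionBy I (d + k) → HasReductionBy I d := by
    intro k
    induction k with
    | zero => exact id
    | succ k ih => exact fun h => ih (HasReductionBy.pred hI hb (by omega) h)
  exact h3 r h2

end Reduction

section Setup
variable {R : Type u} [CommRing R]

lemma colength_eq_of_moduleLength {K : Ideal R} {l : ℕ}
    (h : moduleLength R (R ⧸ K) = (l : WithBot ℕ∞)) : colength K = l := by
  have h1 : ((Module.length R (R ⧸ K) : ℕ∞) : WithBot ℕ∞) = ((l : ℕ∞) : WithBot ℕ∞) := by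
    rw [Module.coe_length]; exact h
  exact WithBot.coe_injective h1

lemma HasHilbertCoeffs.polyBounded {I : Ideal R} {d : ℕ} {e : ℕ → ℤ}
    (he : HasHilbertCoeffs I d e) : PolyBounded I d := by
  obtain ⟨N, hN⟩ := he
  refine ⟨(∑ i ∈ range (d + 1), (e i).natAbs) * 2 ^ d, N + d + 2, fun m hm => ?_⟩
  obtain ⟨n, rfl⟩ : ∃ n, m = n + 1 := ⟨m - 1, by omega⟩
  obtain ⟨l, hl, hsum⟩ := hN n (by omega)
  rw [colength_eq_of_moduleLength hl]
  have h1 : l ≤ (∑ i ∈ range (d + 1), (e i).natAbs) * (n + d) ^ d := by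
    zify
    rw [hsum, Finset.sum_mul]
    refine Finset.sum_le_sum fun i hi => ?_
    have h2 : ((n + d - i).choose (d - i) : ℤ) ≤ ((n + d : ℕ) : ℤ) ^ d := by
      have h3 : (n + d - i).choose (d - i) ≤ (n + d) ^ d :=
        (Nat.choose_le_pow _ _).trans ((Nat.pow_le_pow_left (Nat.sub_le _ _) _).trans
          (Nat.pow_le_pow_right (by omega) (by omega)))
      exact_mod_cast h3
    calc (-1 : ℤ) ^ i * e i * ((n + d - i).choose (d - i))
        ≤ |(-1 : ℤ) ^ i * e i| * ((n + d - i).choose (d - i)) := by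
          gcongr; exact le_abs_self _
      _ = |e i| * ((n + d - i).choose (d - i)) := by
          rw [abs_mul, abs_pow, abs_neg, abs_one, one_pow, one_mul]
      _ ≤ |e i| * ((n + d : ℕ) : ℤ) ^ d := by gcongr
      _ = _ := by push_cast; rfl
  have h4 : (n + d) ^ d ≤ 2 ^ d * (n + 1) ^ d := by
    rw [← mul_pow]; exact Nat.pow_le_pow_left (by omega) d
  exact_mod_cast h1.trans ((Nat.mul_le_mul_left _ h4).trans (by rw [mul_assoc]))

lemma exists_isParameters [IsNoetherianRing R] [IsLocalRing R] [Infinite (ResidueField R)]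
    {I : Ideal R} {d : ℕ} (hI : I.radical = maximalIdeal R) (hb : PolyBounded I d) :
    ∃ x : Fin d → R, IsParameters x ∧ genIdeal x ≤ I ∧
      ∃ t, ∀ n, I ^ (n + t) ≤ genIdeal x ^ n := by
  have hIm : I ≤ maximalIdeal R := hI ▸ Ideal.le_radical
  obtain ⟨x, hx, t, ht⟩ := hb.hasReductionBy hIm
  obtain ⟨N, hN⟩ := Ideal.exists_pow_le_of_le_radical_of_fg (I := maximalIdeal R) (J := I) hI.ge
    (IsNoetherian.noetherian _)
  refine ⟨x, ⟨fun i => hIm (hx (mem_genIdeal x i)), N * (1 + t), ?_⟩, hx, t, ht⟩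
  rw [pow_mul]
  exact (Ideal.pow_right_mono hN _).trans ((ht 1).trans (by rw [pow_one]))

lemma almostClosure_congr [IsDomain R] {I J : Ideal R} {t : ℕ} (hJ : J ≠ ⊥) (hJI : J ≤ I)
    (h : ∀ n, I ^ (n + t) ≤ J ^ n) (p : ℕ) : almostClosure (I ^ p) = almostClosure (J ^ p) := by
  refine le_antisymm (fun z hz => ?_) (fun z hz => ?_)
  · rw [mem_almostClosure] at hz ⊢
    exact almostIntegralOver_of_pow_mem hJ h hz
  · rw [mem_almostClosure] at hz ⊢
    exact hz.mono (Ideal.pow_right_mono hJI p)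

lemma IsParameters.genIdeal_ne_bot [IsLocalRing R] [IsDomain R] {d : ℕ} {x : Fin d → R}
    (hx : IsParameters x) (hd : 0 < d) (hdim : ringKrullDim R = d) : genIdeal x ≠ ⊥ := by
  intro h
  obtain ⟨N, hN⟩ := hx.2
  rw [h, le_bot_iff] at hN
  have h1 : maximalIdeal R = ⊥ := by
    by_contra h2
    exact pow_ne_zero N h2 hN
  have h2 : IsField R := IsLocalRing.isField_iff_maximalIdeal_eq.2 h1
  rw [ringKrullDim_eq_zero_of_isField h2] at hdim
  have : (0 : ℕ) = d := by exact_mod_cast hdim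
  omega

end Setup

section Duality
variable {R : Type u} [CommRing R] [IsLocalRing R]

lemma colength_maximalIdeal_le : colength (maximalIdeal R) ≤ 1 := by
  have : IsSimpleModule R (R ⧸ maximalIdeal R) :=
    isSimpleModule_iff_isCoatom.2 (IsLocalRing.maximalIdeal.isMaximal R).out
  exact (Module.length_eq_one R _).le

lemma exists_notMem_forall_mul_mem {K : Ideal R} (hK : K ≠ ⊤) {N : ℕ}
    (hN : maximalIdeal R ^ N ≤ K) : ∃ y, y ∉ K ∧ ∀ μ ∈ maximalIdeal R, y * μ ∈ K := by
  induction N with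
  | zero => exact absurd (top_le_iff.1 (by simpa using hN)) hK
  | succ N ih =>
    by_cases h : maximalIdeal R ^ N ≤ K
    · exact ih h
    · obtain ⟨y, hy, hyK⟩ := SetLike.not_le_iff_exists.1 h
      exact ⟨y, hyK, fun μ hμ => hN (pow_succ (maximalIdeal R) N ▸ Ideal.mul_mem_mul hy hμ)⟩

lemma SocleCyclic.colength_le_colon [IsNoetherianRing R] {J : Ideal R} (hJ : SocleCyclic J)
    {N : ℕ} (hN : maximalIdeal R ^ N ≤ J) (K : Ideal R) (hK : J ≤ K) :
    colength J ≤ colength (J.colon (K : Set R)) + colength K := by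
  induction K using IsNoetherian.induction with
  | hgt K ih =>
    by_cases hT : K = ⊤
    · refine le_add_right (colength_anti fun c hc => ?_)
      have := Submodule.mem_colon.1 hc 1 (by rw [hT]; trivial)
      simpa using this
    obtain ⟨y, hy, hyμ⟩ := exists_notMem_forall_mul_mem hT (hN.trans hK)
    have hlt : K < K ⊔ Ideal.span {y} :=
      lt_of_le_of_ne le_sup_left fun h => hy (h ▸ Ideal.mem_sup_right (Ideal.mem_span_singleton_self y))
    have h1 : colength (K ⊔ Ideal.span {y}) + 1 ≤ colength K := by
      rw [colength_eq_add_colonBy K y, add_comm]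
      gcongr
      refine one_le_colength fun h => hy ?_
      have : (1 : R) ∈ colonBy K y := h ▸ trivial
      simpa [mem_colonBy] using this
    have h2 : colength (J.colon ((K ⊔ Ideal.span {y} : Ideal R) : Set R)) ≤
        colength (J.colon (K : Set R)) + 1 := by
      obtain ⟨Δ, hΔ, hμΔ, hsoc⟩ := hJ
      have hmem : ∀ u, u ∈ J.colon ((K ⊔ Ideal.span {y} : Ideal R) : Set R) ↔
          u ∈ J.colon (K : Set R) ∧ u * y ∈ J := by
        intro u
        constructor
        · intro h
          rw [Submodule.mem_colon] at h
          exact ⟨Submodule.mem_colon.2 fun p hp => h p (le_sup_left (a := K) hp),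
            h y (Ideal.mem_sup_right (Ideal.mem_span_singleton_self y))⟩
        · rintro ⟨h, h'⟩
          rw [Submodule.mem_colon] at h ⊢
          intro p hp
          obtain ⟨a, ha, b, hb, rfl⟩ := Submodule.mem_sup.1 hp
          obtain ⟨c, rfl⟩ := Ideal.mem_span_singleton'.1 hb
          rw [smul_add]
          refine add_mem (h a ha) ?_
          rw [smul_eq_mul, mul_left_comm]
          exact Ideal.mul_mem_left _ _ h'
      have hμ : ∀ u ∈ J.colon (K : Set R), ∀ μ ∈ maximalIdeal R, μ * (u * y) ∈ J := by
        intro u hu μ hμ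
        have := Submodule.mem_colon.1 hu _ (hyμ μ hμ)
        rwa [smul_eq_mul, show u * (y * μ) = μ * (u * y) by ring] at this
      by_cases hex : ∀ u ∈ J.colon (K : Set R), u * y ∈ J
      · exact le_add_right (colength_anti fun u hu => (hmem u).2 ⟨hu, hex u hu⟩)
      push Not at hex
      obtain ⟨u₀, hu₀, hu₀y⟩ := hex
      obtain ⟨r, hr⟩ := mem_sup_span_singleton_iff.1 (hsoc _ (hμ u₀ hu₀))
      have hru : IsUnit r := by
        by_contra hnr
        refine hu₀y ?_
        have h3 := hμΔ r ((mem_maximalIdeal r).2 hnr)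
        have : u₀ * y = (u₀ * y - Δ * r) + r * Δ := by ring
        rw [this]
        exact add_mem hr h3
      obtain ⟨s, hs⟩ := hru.exists_left_inv
      rw [colength_eq_add_colonBy _ u₀, add_comm]
      refine add_le_add (colength_anti fun u hu => ?_) ?_
      · obtain ⟨q, hq⟩ := mem_sup_span_singleton_iff.1 (hsoc _ (hμ u hu))
        refine mem_sup_span_singleton_iff.2 ⟨q * s, (hmem _).2 ⟨?_, ?_⟩⟩
        · exact sub_mem hu (Ideal.mul_mem_right _ _ hu₀)
        · have h4 : (u - u₀ * (q * s)) * y =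
              (u * y - Δ * q) - q * s * (u₀ * y - Δ * r) + Δ * q * (1 - s * r) := by ring
          rw [h4, hs, sub_self, mul_zero, add_zero]
          exact sub_mem hq (Ideal.mul_mem_left _ _ hr)
      · refine (colength_anti fun μ hμ' => ?_).trans colength_maximalIdeal_le
        rw [mem_colonBy]
        refine (hmem _).2 ⟨Ideal.mul_mem_left _ _ hu₀, ?_⟩
        rw [mul_assoc]
        exact hμ u₀ hu₀ μ hμ'
    calc colength J ≤ _ := ih _ hlt (hK.trans le_sup_left)
      _ ≤ colength (J.colon (K : Set R)) + 1 + colength (K ⊔ Ideal.span {y}) := by gcongr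
      _ = colength (J.colon (K : Set R)) + (colength (K ⊔ Ideal.span {y}) + 1) := by
        rw [add_assoc, add_comm 1]
      _ ≤ _ := by gcongr

theorem SocleCyclic.colength_le_add [IsNoetherianRing R] {J : Ideal R} (hJ : SocleCyclic J)
    {N : ℕ} (hN : maximalIdeal R ^ N ≤ J) {K L : Ideal R} (hK : J ≤ K)
    (hKL : ∀ a ∈ K, ∀ b ∈ L, a * b ∈ J) : colength J ≤ colength K + colength L := by
  rw [add_comm]
  refine (hJ.colength_le_colon hN K hK).trans (add_le_add (colength_anti fun b hb => ?_) le_rfl)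
  refine Submodule.mem_colon.2 fun a ha => ?_
  rw [smul_eq_mul, mul_comm]
  exact hKL a ha b hb

end Duality

section Counting
variable {R : Type u} [CommRing R] {d : ℕ}

lemma monom_mem_higherIdeal (x : Fin d → R) {α β : Fin d →₀ ℕ} (h : toDegLex α < toDegLex β) :
    monom x β ∈ higherIdeal x α :=
  Ideal.subset_span ⟨β, h, rfl⟩

lemma monom_mul_mem_higherIdeal (x : Fin d → R) {α β : Fin d →₀ ℕ} {h : R}
    (hh : h ∈ higherIdeal x β) : monom x α * h ∈ higherIdeal x (α + β) := by
  induction hh using Submodule.span_induction with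
  | mem r hr =>
    obtain ⟨γ, hγ, rfl⟩ := hr
    rw [← monom_add]
    refine monom_mem_higherIdeal x ?_
    rw [toDegLex_add, toDegLex_add]
    exact add_lt_add_right hγ _
  | zero => simp
  | add a b _ _ ha hb => rw [mul_add]; exact add_mem ha hb
  | smul r a _ ha => rw [smul_eq_mul, mul_left_comm]; exact Ideal.mul_mem_left _ _ ha

lemma mul_mem_higherIdeal (x : Fin d → R) {α β : Fin d →₀ ℕ} {g h : R}
    (hg : g ∈ higherIdeal x α) (hh : h ∈ higherIdeal x β) : g * h ∈ higherIdeal x (α + β) := by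
  induction hg using Submodule.span_induction with
  | mem r hr =>
    obtain ⟨γ, hγ, rfl⟩ := hr
    refine Ideal.span_mono (Set.image_mono fun δ hδ => ?_) (monom_mul_mem_higherIdeal x hh)
    have hγ' : toDegLex α < toDegLex γ := hγ
    have hδ' : toDegLex (γ + β) < toDegLex δ := hδ
    refine lt_trans ?_ hδ'
    rw [toDegLex_add, toDegLex_add]
    exact add_lt_add_left hγ' _
  | zero => simp
  | add a b _ _ ha hb => rw [add_mul]; exact add_mem ha hb
  | smul r a _ ha => rw [smul_eq_mul, mul_assoc]; exact Ideal.mul_mem_left _ _ ha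

lemma genIdeal_le_leadIdeal (x : Fin d → R) (Γ : Ideal R) (α : Fin d →₀ ℕ) :
    genIdeal x ≤ leadIdeal x Γ α := by
  refine Ideal.span_le.2 ?_
  rintro _ ⟨i, rfl⟩
  have h1 : x i * monom x α = monom x (Finsupp.single i 1 + α) := by
    rw [monom_add, monom_single, pow_one]
  refine mem_colonBy.2 (Ideal.mem_sup_right ?_)
  rw [h1]
  refine monom_mem_higherIdeal x ?_
  by_contra hlt
  have := Finsupp.DegLex.monotone_degree (not_lt.1 hlt)
  simp [map_add] at this

lemma PowRegular.leadIdeal_le {x : Fin d → R} (hp : PowRegular x) {Γ : Ideal R} {m : ℕ}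
    (hΓ : Γ ≤ genIdeal x ^ m) {α : Fin d →₀ ℕ} (hα : α.degree < m) :
    leadIdeal x Γ α ≤ genIdeal x := by
  intro c hc
  refine hp.mem_of_mul_monom_mem (α := α) ?_
  refine (sup_le (hΓ.trans ?_) ?_ : Γ ⊔ higherIdeal x α ≤ _) (mem_colonBy.1 hc)
  · rw [pow_genIdeal]
    refine Ideal.span_mono ?_
    rintro r ⟨β, hβ, rfl⟩
    exact ⟨β, by rintro rfl; omega, by omega, rfl⟩
  · refine Ideal.span_mono ?_
    rintro r ⟨β, hβ, rfl⟩
    have hβ' : toDegLex α < toDegLex β := hβ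
    exact ⟨β, by rintro rfl; exact lt_irrefl _ hβ', Finsupp.DegLex.monotone_degree hβ'.le, rfl⟩

lemma mul_mem_leadIdeal {x : Fin d → R} {Γ Γ' U : Ideal R} (h : ∀ g ∈ Γ, ∀ g' ∈ Γ', g * g' ∈ U)
    {α β : Fin d →₀ ℕ} {a b : R} (ha : a ∈ leadIdeal x Γ α) (hb : b ∈ leadIdeal x Γ' β) :
    a * b ∈ leadIdeal x U (α + β) := by
  obtain ⟨g, hg, k, hk, h1⟩ := Submodule.mem_sup.1 (mem_colonBy.1 ha)
  obtain ⟨g', hg', k', hk', h2⟩ := Submodule.mem_sup.1 (mem_colonBy.1 hb)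
  refine mem_colonBy.2 ?_
  have h3 : a * b * monom x (α + β) =
      g * g' + (a * (monom x α * k') + b * (monom x β * k) - k * k') := by
    have e1 : g = a * monom x α - k := by rw [← h1]; ring
    have e2 : g' = b * monom x β - k' := by rw [← h2]; ring
    rw [monom_add, e1, e2]; ring
  rw [h3]
  refine add_mem (Ideal.mem_sup_left (h g hg g' hg')) (Ideal.mem_sup_right ?_)
  refine sub_mem (add_mem ?_ ?_) (mul_mem_higherIdeal x hk hk')
  · exact Ideal.mul_mem_left _ _ (monom_mul_mem_higherIdeal x hk')
  · rw [add_comm α]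
    exact Ideal.mul_mem_left _ _ (monom_mul_mem_higherIdeal x hk)

lemma colength_pow_genIdeal {c : ℕ} {x : Fin (c + 1) → R} (hp : PowRegular x) (n : ℕ) :
    colength (genIdeal x ^ n) = colength (genIdeal x) * ((n + c).choose (c + 1) : ℕ) := by
  rw [colength_eq_sum x le_rfl, ← sum_card_degFinset, Nat.cast_sum, Finset.mul_sum]
  refine Finset.sum_congr rfl fun i hi => ?_
  rw [Finset.sum_congr rfl (g := fun _ => colength (genIdeal x)), Finset.sum_const, nsmul_eq_mul,
    mul_comm]
  intro α hα
  rw [le_antisymm (hp.leadIdeal_le le_rfl (by rw [mem_degFinset.1 hα]; exact mem_range.1 hi))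
    (genIdeal_le_leadIdeal x _ α)]

/-- The number of monomials of degree below `p` times the colength of `genIdeal x`, plus a lower
bound for the contribution of the degrees from `p` to `p + c - 1`. -/
lemma le_colength_of_le {c p : ℕ} {x : Fin (c + 1) → R} (hp : PowRegular x) {Γ : Ideal R}
    (h1 : genIdeal x ^ (p + c) ≤ Γ) (h2 : Γ ≤ genIdeal x ^ p) (μ : ℕ → ℕ∞)
    (hμ : ∀ i < c, ∀ α ∈ degFinset (c + 1) (p + i), μ i ≤ colength (leadIdeal x Γ α)) :
    colength (genIdeal x) * ((p + c).choose (c + 1) : ℕ) +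
      ((p + c).choose c : ℕ) * ∑ i ∈ range c, μ i ≤ colength Γ := by
  rw [colength_eq_sum x h1, Finset.sum_range_add]
  refine add_le_add ?_ ?_
  · rw [← sum_card_degFinset, Nat.cast_sum, Finset.mul_sum]
    refine Finset.sum_le_sum fun i hi => ?_
    rw [mul_comm, ← nsmul_eq_mul]
    refine Finset.card_nsmul_le_sum _ _ _ fun α hα => ?_
    exact colength_anti (hp.leadIdeal_le h2 (by rw [mem_degFinset.1 hα]; exact mem_range.1 hi))
  · rw [Finset.mul_sum]
    refine Finset.sum_le_sum fun i hi => ?_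
    calc (((p + c).choose c : ℕ) : ℕ∞) * μ i ≤ (#(degFinset (c + 1) (p + i)) : ℕ∞) * μ i := by
          rw [card_degFinset_succ]
          gcongr
          omega
      _ = #(degFinset (c + 1) (p + i)) • μ i := (nsmul_eq_mul _ _).symm
      _ ≤ _ := Finset.card_nsmul_le_sum _ _ _ (hμ i (mem_range.1 hi))

variable [IsNoetherianRing R] [IsLocalRing R] [IsDomain R]

omit [IsNoetherianRing R] in
lemma pow_le_almostClosure (J : Ideal R) : J ≤ almostClosure J := fun _ hz =>
  mem_almostClosure.2 (.of_mem hz)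

lemma two_mul_le_colength_almostClosure {c p : ℕ} {x : Fin (c + 1) → R}
    (h : IsRegularLocalOfDim R (c + 1)) (hx : IsParameters x) (hx0 : genIdeal x ≠ ⊥) :
    2 * (colength (genIdeal x) * ((p + c).choose (c + 1) : ℕ)) +
      ((p + c).choose c : ℕ) * (c * colength (genIdeal x)) ≤
      2 * colength (almostClosure (genIdeal x ^ (p + c))) := by
  have hp := hx.powRegular h
  obtain ⟨N, hN⟩ := hx.2
  set Γ := almostClosure (genIdeal x ^ (p + c)) with hΓ
  have hB : ∀ n, almostClosure (genIdeal x ^ n) ≤ genIdeal x ^ (n - c) := fun n =>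
    almostClosure_pow_le h (Nat.succ_pos c) hx0 hp n
  have hne : ∀ i, (degFinset (c + 1) i).Nonempty := fun i => by
    rw [← Finset.card_pos, card_degFinset_succ]
    exact Nat.choose_pos (by omega)
  have hmin : ∀ i, ∃ α ∈ degFinset (c + 1) (p + i), ∀ β ∈ degFinset (c + 1) (p + i),
      colength (leadIdeal x Γ α) ≤ colength (leadIdeal x Γ β) := fun i =>
    Finset.exists_min_image _ _ (hne (p + i))
  choose α hα hαmin using hmin
  let μ : ℕ → ℕ∞ := fun i => colength (leadIdeal x Γ (α i))
  have h1 := le_colength_of_le hp (pow_le_almostClosure _)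
    (by simpa using hB (p + c)) μ (fun i _ β hβ => hαmin i β hβ)
  have h2 : ∀ i ∈ range c, colength (genIdeal x) ≤ μ i + μ (c - 1 - i) := by
    intro i hi
    rw [mem_range] at hi
    refine (hx.socleCyclic h).colength_le_add hN (genIdeal_le_leadIdeal x _ _) fun a ha b hb => ?_
    refine hp.leadIdeal_le (m := p + c + (p + c) - c) le_rfl ?_
      (mul_mem_leadIdeal (fun g hg g' hg' => ?_) ha hb)
    · rw [map_add, mem_degFinset.1 (hα _), mem_degFinset.1 (hα _)]
      omega
    · refine hB _ (mem_almostClosure.2 ?_)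
      rw [pow_add _ (p + c)]
      exact (mem_almostClosure.1 hg).mul (mem_almostClosure.1 hg')
  have h3 : c * colength (genIdeal x) ≤ 2 * ∑ i ∈ range c, μ i := by
    calc c * colength (genIdeal x) = ∑ i ∈ range c, colength (genIdeal x) := by
          rw [Finset.sum_const, card_range, nsmul_eq_mul]
      _ ≤ ∑ i ∈ range c, (μ i + μ (c - 1 - i)) := Finset.sum_le_sum h2
      _ = _ := by rw [Finset.sum_add_distrib, Finset.sum_range_reflect, two_mul]
  calc _ ≤ 2 * (colength (genIdeal x) * ((p + c).choose (c + 1) : ℕ)) +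
      ((p + c).choose c : ℕ) * (2 * ∑ i ∈ range c, μ i) := by gcongr
    _ = 2 * (colength (genIdeal x) * ((p + c).choose (c + 1) : ℕ) +
      ((p + c).choose c : ℕ) * ∑ i ∈ range c, μ i) := by ring
    _ ≤ _ := by gcongr

end Counting

section FiberCone
variable {R : Type u} [CommRing R] {d : ℕ}

lemma sum_mem_mul_pow_genIdeal {x : Fin d → R} {K : Ideal R} {n : ℕ} {c : (Fin d →₀ ℕ) → R}
    (hc : ∀ α ∈ degFinset d n, c α ∈ K) :
    ∑ α ∈ degFinset d n, c α * monom x α ∈ K * genIdeal x ^ n :=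
  sum_mem fun α hα => Ideal.mul_mem_mul (hc α hα) (mem_degFinset.1 hα ▸ monom_mem_pow x α)

lemma exists_eq_sum_of_mem_mul_pow {x : Fin d → R} {K : Ideal R} {n : ℕ} {r : R}
    (hr : r ∈ K * genIdeal x ^ n) :
    ∃ c : (Fin d →₀ ℕ) → R, (∀ α, c α ∈ K) ∧ r = ∑ α ∈ degFinset d n, c α * monom x α := by
  induction hr using Submodule.mul_induction_on' with
  | mem_mul_mem a ha b hb =>
    obtain ⟨c, rfl⟩ := mem_pow_genIdeal_iff.1 hb
    refine ⟨fun α => a * c α, fun α => Ideal.mul_mem_right _ _ ha, ?_⟩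
    simp_rw [Finset.mul_sum, mul_assoc]
  | add a _ b _ ha hb =>
    obtain ⟨c, hc, rfl⟩ := ha
    obtain ⟨c', hc', rfl⟩ := hb
    refine ⟨fun α => c α + c' α, fun α => add_mem (hc α) (hc' α), ?_⟩
    simp_rw [← Finset.sum_add_distrib, add_mul]

lemma PowRegular.mem_of_sum_mem {x : Fin d → R} (hp : PowRegular x) {K : Ideal R}
    (hK : genIdeal x ≤ K) {n : ℕ} {c : (Fin d →₀ ℕ) → R}
    (h : ∑ α ∈ degFinset d n, c α * monom x α ∈ K * genIdeal x ^ n) :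
    ∀ α ∈ degFinset d n, c α ∈ K := by
  classical
  intro α hα
  obtain ⟨b, hb, he⟩ := exists_eq_sum_of_mem_mul_pow h
  have h1 : ∑ β ∈ degFinset d n, (c β - b β) * monom x β = 0 := by
    simp_rw [sub_mul, Finset.sum_sub_distrib, he, sub_self]
  have h2 : c α - b α ∈ genIdeal x := by
    refine hp.mem_of_mul_monom_mem (α := α) ?_
    rw [← Finset.add_sum_erase _ _ hα] at h1
    rw [eq_neg_of_add_eq_zero_left h1]
    refine neg_mem (sum_mem fun β hβ => Ideal.mul_mem_left _ _ (Ideal.subset_span ?_))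
    obtain ⟨hβ1, hβ2⟩ := Finset.mem_erase.1 hβ
    exact ⟨β, hβ1, by rw [mem_degFinset.1 hα, mem_degFinset.1 hβ2], rfl⟩
  have := add_mem (hK h2) (hb α)
  rwa [sub_add_cancel] at this

variable [IsLocalRing R]

lemma PowRegular.mem_of_mul_mem_step {x : Fin d → R} (hp : PowRegular x) {K : Ideal R} {l n : ℕ}
    {b r : R} (hb : b ∈ genIdeal x ^ l) (hb' : b ∉ maximalIdeal R * genIdeal x ^ l)
    (hr : r ∈ K * genIdeal x ^ n)
    (hbr : b * r ∈ (maximalIdeal R * K ⊔ genIdeal x) * genIdeal x ^ (l + n)) :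
    r ∈ (maximalIdeal R * K ⊔ genIdeal x) * genIdeal x ^ n := by
  classical
  set L := maximalIdeal R * K ⊔ genIdeal x with hL
  obtain ⟨f, rfl⟩ := mem_pow_genIdeal_iff.1 hb
  obtain ⟨g, hg, rfl⟩ := exists_eq_sum_of_mem_mul_pow hr
  by_contra hcon
  have h1 : ((degFinset d l).filter fun δ => f δ ∉ maximalIdeal R).Nonempty := by
    by_contra hne
    refine hb' (sum_mem_mul_pow_genIdeal fun α hα => ?_)
    by_contra h
    exact hne ⟨α, Finset.mem_filter.2 ⟨hα, h⟩⟩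
  have h2 : ((degFinset d n).filter fun γ => g γ ∉ L).Nonempty := by
    by_contra hne
    refine hcon (sum_mem_mul_pow_genIdeal fun α hα => ?_)
    by_contra h
    exact hne ⟨α, Finset.mem_filter.2 ⟨hα, h⟩⟩
  obtain ⟨δ, hδ, hδmax⟩ := Finset.exists_max_image _ (fun δ => toDegLex δ) h1
  obtain ⟨γ, hγ, hγmax⟩ := Finset.exists_max_image _ (fun δ => toDegLex δ) h2
  rw [Finset.mem_filter] at hδ hγ
  let C : (Fin d →₀ ℕ) → R := fun ε =>
    ∑ q ∈ (degFinset d l ×ˢ degFinset d n) with q.1 + q.2 = ε, f q.1 * g q.2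
  have h3 : (∑ α ∈ degFinset d l, f α * monom x α) * (∑ α ∈ degFinset d n, g α * monom x α) =
      ∑ ε ∈ degFinset d (l + n), C ε * monom x ε := by
    rw [Finset.sum_mul_sum, ← Finset.sum_product', ← Finset.sum_fiberwise_of_maps_to
      (t := degFinset d (l + n)) (g := fun q : (Fin d →₀ ℕ) × (Fin d →₀ ℕ) => q.1 + q.2)]
    · refine Finset.sum_congr rfl fun ε _ => ?_
      rw [Finset.sum_mul]
      refine Finset.sum_congr rfl fun q hq => ?_
      rw [← (Finset.mem_filter.1 hq).2, monom_add]
      ring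
    · intro q hq
      rw [Finset.mem_product, mem_degFinset, mem_degFinset] at hq
      rw [mem_degFinset, map_add, hq.1, hq.2]
  rw [h3] at hbr
  have h4 := hp.mem_of_sum_mem le_sup_right hbr (δ + γ)
    (by rw [mem_degFinset, map_add, mem_degFinset.1 hδ.1, mem_degFinset.1 hγ.1])
  have hmem : (δ, γ) ∈ (degFinset d l ×ˢ degFinset d n).filter fun q => q.1 + q.2 = δ + γ :=
    Finset.mem_filter.2 ⟨Finset.mem_product.2 ⟨hδ.1, hγ.1⟩, rfl⟩
  have h5 : f δ * g γ ∈ L := by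
    have h6 : C (δ + γ) = f δ * g γ + ∑ q ∈ ((degFinset d l ×ˢ degFinset d n).filter
        fun q => q.1 + q.2 = δ + γ).erase (δ, γ), f q.1 * g q.2 :=
      (Finset.add_sum_erase _ _ hmem).symm
    rw [h6] at h4
    refine (Submodule.add_mem_iff_left _ (sum_mem fun q hq => ?_)).1 h4
    obtain ⟨hq1, hq2⟩ := Finset.mem_erase.1 hq
    obtain ⟨hq3, hq4⟩ := Finset.mem_filter.1 hq2
    obtain ⟨hq5, hq6⟩ := Finset.mem_product.1 hq3
    by_cases hlt : toDegLex δ < toDegLex q.1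
    · have : f q.1 ∈ maximalIdeal R := by
        by_contra h
        exact absurd (hδmax q.1 (Finset.mem_filter.2 ⟨hq5, h⟩)) (not_le.2 hlt)
      exact Ideal.mem_sup_left (Ideal.mul_mem_mul this (hg _))
    · have hlt' : toDegLex γ < toDegLex q.2 := by
        by_contra h
        have e1 := not_lt.1 hlt
        have e2 := not_lt.1 h
        have e3 : toDegLex q.1 + toDegLex q.2 = toDegLex δ + toDegLex γ := by
          rw [← toDegLex_add, ← toDegLex_add, hq4]
        have e4 : toDegLex q.1 = toDegLex δ := by
          refine e1.eq_of_not_lt fun hl => ?_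
          exact absurd e3 (add_lt_add_of_lt_of_le hl e2).ne
        have e5 : toDegLex q.2 = toDegLex γ := by
          rw [e4] at e3
          exact add_left_cancel e3
        exact hq1 (Prod.ext (toDegLex_injective e4) (toDegLex_injective e5))
      have : g q.2 ∈ L := by
        by_contra h
        exact absurd (hγmax q.2 (Finset.mem_filter.2 ⟨hq6, h⟩)) (not_le.2 hlt')
      exact Ideal.mul_mem_left _ _ this
  refine hγ.2 ?_
  have hu : IsUnit (f δ) := by
    by_contra h
    exact hδ.2 ((mem_maximalIdeal _).2 h)
  exact (Ideal.unit_mul_mem_iff_mem _ hu).1 h5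

lemma IsParameters.genIdeal_le {x : Fin d → R} (hx : IsParameters x) :
    genIdeal x ≤ maximalIdeal R := by
  refine Ideal.span_le.2 ?_
  rintro _ ⟨i, rfl⟩
  exact hx.1 i

lemma IsParameters.mem_maximalIdeal_mul_of_mul_mem {x : Fin d → R} (hx : IsParameters x)
    (hp : PowRegular x) {l n : ℕ} {b r : R} (hb : b ∈ genIdeal x ^ l)
    (hb' : b ∉ maximalIdeal R * genIdeal x ^ l) (hr : r ∈ genIdeal x ^ n)
    (hbr : b * r ∈ maximalIdeal R * genIdeal x ^ (l + n)) :
    r ∈ maximalIdeal R * genIdeal x ^ n := by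
  have h := hp.mem_of_mul_mem_step (K := ⊤) (n := n) hb hb' (r := r) (by rwa [Ideal.top_mul])
  rw [Ideal.mul_top, sup_eq_left.2 hx.genIdeal_le] at h
  exact h hbr

lemma IsParameters.mem_pow_of_mul_mem {x : Fin d → R} (hx : IsParameters x)
    (hp : PowRegular x) {l n : ℕ} {b r : R} (hb : b ∈ genIdeal x ^ l)
    (hb' : b ∉ maximalIdeal R * genIdeal x ^ l) (hbr : b * r ∈ genIdeal x ^ (l + n)) :
    r ∈ genIdeal x ^ n := by
  induction n with
  | zero => simp
  | succ n ih =>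
    have h1 := ih (Ideal.pow_le_pow_right (by omega) hbr)
    obtain ⟨N, hN⟩ := hx.2
    have h2 : ∀ s, r ∈ (maximalIdeal R ^ s ⊔ genIdeal x) * genIdeal x ^ n := by
      intro s
      induction s with
      | zero => simpa using h1
      | succ s ihs =>
        have h3 := hp.mem_of_mul_mem_step hb hb' ihs ?_
        · refine Ideal.mul_mono_left (sup_le ?_ le_sup_right) h3
          rw [Ideal.mul_sup, ← pow_succ']
          exact sup_le_sup le_rfl Ideal.mul_le_right
        · refine Ideal.mul_mono_left le_sup_right ?_
          rw [← pow_succ']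
          exact hbr
    have h3 := h2 N
    rw [sup_eq_right.2 hN, ← pow_succ'] at h3
    exact h3

end FiberCone

section DegreeBound

lemma exists_valuationSubring_notMem {B L : Type*} [CommRing B] [Field L] [Algebra B L] {z : L}
    (hz : ¬ IsIntegral B z) :
    ∃ V : ValuationSubring L, (∀ b : B, algebraMap B L b ∈ V) ∧ z ∉ V := by
  obtain ⟨V, hV, hzV⟩ := Subring.exists_le_valuationSubring_of_isIntegrallyClosedIn
    (R := (integralClosure B L).toSubring) (x := z) hz
  exact ⟨V, fun b => hV (integralClosure B L |>.algebraMap_mem b), hzV⟩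

lemma eq_zero_of_sum_mul_pow_eq_zero {B L : Type*} [CommRing B] [IsDomain B] [Field L]
    [Algebra B L] {u : L} (hu : Transcendental B u) {e p : ℕ} (hpe : p < e) {n : ℕ} {t : ℕ → L}
    (ht : ∀ V : ValuationSubring L, (∀ b : B, algebraMap B L b ∈ V) → ∀ j,
      (V.valuation u ≤ 1 → V.valuation (t j) ≤ 1) ∧
      (1 ≤ V.valuation u → V.valuation (t j) ^ e ≤ V.valuation u ^ p))
    (hsum : ∑ j ∈ range n, t j * u ^ j = 0) : ∀ j < n, t j = 0 := by
  have hu0 : u ≠ 0 := by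
    rintro rfl
    exact hu isAlgebraic_zero
  induction n generalizing t with
  | zero => intro j hj; omega
  | succ n ih =>
    rw [Finset.sum_range_succ'] at hsum
    have hγ : t 0 * u⁻¹ = - ∑ j ∈ range n, t (j + 1) * u ^ j := by
      have h1 : t 0 = - (∑ j ∈ range n, t (j + 1) * u ^ j) * u := by
        rw [neg_mul, Finset.sum_mul]
        rw [pow_zero, mul_one] at hsum
        rw [eq_neg_of_add_eq_zero_right hsum]
        simp_rw [pow_succ, mul_assoc]
      rw [h1, mul_assoc, mul_inv_cancel₀ hu0, mul_one]
    set γ := t 0 * u⁻¹ with hγdef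
    have hV1 : ∀ V : ValuationSubring L, (∀ b : B, algebraMap B L b ∈ V) →
        V.valuation u ≤ 1 → V.valuation γ ≤ 1 := by
      intro V hV h1
      rw [hγ, Valuation.map_neg]
      refine Valuation.map_sum_le _ fun j _ => ?_
      rw [map_mul, map_pow]
      exact mul_le_one' ((ht V hV (j + 1)).1 h1) (pow_le_one' h1 j)
    have hV2 : ∀ V : ValuationSubring L, (∀ b : B, algebraMap B L b ∈ V) →
        1 ≤ V.valuation u → V.valuation (γ ^ e * u) ≤ 1 := by
      intro V hV h1
      have h2 := (ht V hV 0).2 h1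
      have h3 : t 0 = γ * u := by rw [hγdef, mul_assoc, inv_mul_cancel₀ hu0, mul_one]
      have hvu : V.valuation u ≠ 0 := (Valuation.ne_zero_iff _).2 hu0
      obtain ⟨q, rfl⟩ : ∃ q, e = p + 1 + q := ⟨e - (p + 1), by omega⟩
      rw [h3, map_mul, mul_pow, pow_add (V.valuation u) (p + 1), pow_succ, mul_assoc,
        mul_left_comm] at h2
      have h4 : V.valuation γ ^ (p + 1 + q) * (V.valuation u * V.valuation u ^ q) ≤ 1 := by
        have hpos : (0 : V.ValueGroup) < V.valuation u ^ p := pow_pos (zero_lt_iff.2 hvu) p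
        exact le_of_mul_le_mul_left (by rwa [mul_one]) hpos
      rw [map_mul, map_pow]
      refine le_trans ?_ h4
      gcongr
      exact le_mul_of_one_le_right' (one_le_pow_of_one_le' h1 q)
    have hint1 : IsIntegral B (γ ^ e) := by
      by_contra h
      obtain ⟨V, hV, hz⟩ := exists_valuationSubring_notMem h
      refine hz ((V.valuation_le_one_iff _).1 ?_)
      rcases le_total (V.valuation u) 1 with h1 | h1
      · rw [map_pow]; exact pow_le_one' (hV1 V hV h1) e
      · refine le_trans ?_ (hV2 V hV h1)
        rw [map_mul]
        exact le_mul_of_one_le_right' h1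
    have hint2 : IsIntegral B (γ ^ e * u) := by
      by_contra h
      obtain ⟨V, hV, hz⟩ := exists_valuationSubring_notMem h
      refine hz ((V.valuation_le_one_iff _).1 ?_)
      rcases le_total (V.valuation u) 1 with h1 | h1
      · rw [map_mul, map_pow]; exact mul_le_one' (pow_le_one' (hV1 V hV h1) e) h1
      · exact hV2 V hV h1
    have hγ0 : γ = 0 := by
      by_contra h
      refine hu ?_
      have h5 : u = (γ ^ e * u) * (γ ^ e)⁻¹ := by
        rw [mul_right_comm, mul_inv_cancel₀ (pow_ne_zero e h), one_mul]
      rw [h5]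
      exact hint2.isAlgebraic.mul hint1.isAlgebraic.inv
    have ht0 : t 0 = 0 := (mul_eq_zero.1 (hγdef ▸ hγ0 : t 0 * u⁻¹ = 0)).resolve_right
      (inv_ne_zero hu0)
    have h6 : ∑ j ∈ range n, t (j + 1) * u ^ j = 0 := by
      rw [hγ0] at hγ
      exact neg_eq_zero.1 hγ.symm
    have h7 := ih (t := fun j => t (j + 1)) (fun V hV j => ht V hV (j + 1)) h6
    intro j hj
    cases j with
    | zero => exact ht0
    | succ j => exact h7 j (by omega)

variable {k L : Type*} [Field k] [Field L] [Algebra k L] {c : ℕ}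

/-- Valuative form of the condition that `s ^ e` is integral over the graded ring generated by the
`u l`, of degree at most `p`. -/
def DegreeBounded (k : Type*) {L : Type*} [Field k] [Field L] [Algebra k L] {c : ℕ}
    (u : Fin (c + 1) → L) (e p : ℕ) (s : L) : Prop :=
  ∀ V : ValuationSubring L, (∀ a : k, algebraMap k L a ∈ V) →
    ∀ y, (∀ l, V.valuation (u l) ≤ V.valuation y) → V.valuation s ^ e ≤ V.valuation y ^ p

lemma DegreeBounded.eq_zero_of_sum {u : Fin (c + 1) → L} (hu0 : u 0 = 1)
    (hu : ∀ i ≠ 0, Transcendental (Algebra.adjoin k (u '' {i}ᶜ)) (u i)) {e p : ℕ} (hpe : p < e)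
    (S : Finset (Fin (c + 1))) (hS : 0 ∉ S) (T : Finset (Fin (c + 1) →₀ ℕ))
    (hT : ∀ α ∈ T, ∀ β ∈ T, (∀ l ∈ S, α l = β l) → α = β) {s : (Fin (c + 1) →₀ ℕ) → L}
    (hs : ∀ α ∈ T, DegreeBounded k u e p (s α))
    (hsum : ∑ α ∈ T, s α * monom u α = 0) : ∀ α ∈ T, s α = 0 := by
  classical
  have hune : ∀ i, u i ≠ 0 := by
    intro i
    by_cases hi : i = 0
    · rw [hi, hu0]; exact one_ne_zero
    · intro h
      exact hu i hi (h ▸ isAlgebraic_zero)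
  induction S using Finset.induction_on generalizing T with
  | empty =>
    intro α hα
    have h1 : T = {α} := Finset.eq_singleton_iff_unique_mem.2
      ⟨hα, fun β hβ => hT β hβ α hα (by simp)⟩
    rw [h1, Finset.sum_singleton] at hsum
    refine (mul_eq_zero.1 hsum).resolve_right ?_
    exact Finset.prod_ne_zero_iff.2 fun i _ => pow_ne_zero _ (hune i)
  | insert i S hiS ih =>
    have hi0 : i ≠ 0 := by rintro rfl; exact hS (Finset.mem_insert_self _ _)
    let B := Algebra.adjoin k (u '' {i}ᶜ)
    let mon : (Fin (c + 1) →₀ ℕ) → L := fun α => ∏ l ∈ univ.erase i, u l ^ α l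
    have hmon : ∀ α, monom u α = mon α * u i ^ α i := fun α =>
      (Finset.prod_erase_mul _ _ (Finset.mem_univ i)).symm
    have hB : ∀ l, l ≠ i → u l ∈ B := fun l hl => Algebra.subset_adjoin ⟨l, hl, rfl⟩
    have hmonB : ∀ α, mon α ∈ B := fun α =>
      Subalgebra.prod_mem _ fun l hl => Subalgebra.pow_mem _ (hB l (Finset.ne_of_mem_erase hl)) _
    let t : ℕ → L := fun j => ∑ α ∈ T with α i = j, s α * mon α
    obtain ⟨n, hn⟩ : ∃ n, ∀ α ∈ T, α i < n :=
      ⟨T.sup (fun α => α i) + 1, fun α hα => Nat.lt_succ_of_le (Finset.le_sup (f := fun α => α i) hα)⟩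
    have hsum' : ∑ j ∈ range n, t j * u i ^ j = 0 := by
      rw [← hsum, ← Finset.sum_fiberwise_of_maps_to (t := range n) (g := fun α => α i)
        (fun α hα => mem_range.2 (hn α hα))]
      refine Finset.sum_congr rfl fun j _ => ?_
      rw [Finset.sum_mul]
      refine Finset.sum_congr rfl fun α hα => ?_
      rw [hmon, (Finset.mem_filter.1 hα).2, mul_assoc]
    have ht := eq_zero_of_sum_mul_pow_eq_zero (hu i hi0) hpe (t := t) ?_ hsum'
    · intro α hα
      refine ih (fun h => hS (Finset.mem_insert_of_mem h)) (T.filter fun β => β i = α i) ?_ ?_ ?_ α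
        (Finset.mem_filter.2 ⟨hα, rfl⟩)
      · intro β hβ γ hγ h
        rw [Finset.mem_filter] at hβ hγ
        refine hT β hβ.1 γ hγ.1 fun l hl => ?_
        rcases Finset.mem_insert.1 hl with rfl | hl
        · rw [hβ.2, hγ.2]
        · exact h l hl
      · exact fun β hβ => hs β (Finset.mem_filter.1 hβ).1
      · have h1 := ht (α i) (hn α hα)
        have h2 : ∑ β ∈ T with β i = α i, s β * monom u β = t (α i) * u i ^ α i := by
          rw [Finset.sum_mul]
          refine Finset.sum_congr rfl fun β hβ => ?_
          rw [hmon, (Finset.mem_filter.1 hβ).2, mul_assoc]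
        rw [h2, h1, zero_mul]
    · intro V hV j
      have hVB : ∀ b ∈ B, V.valuation b ≤ 1 := fun b hb =>
        (V.valuation_le_one_iff b).2 (hV ⟨b, hb⟩)
      have hVk : ∀ a : k, algebraMap k L a ∈ V := fun a => hV ⟨_, B.algebraMap_mem a⟩
      have hle : ∀ z : L, (∀ α ∈ T, V.valuation (s α) ^ e ≤ V.valuation z) →
          V.valuation (t j) ^ e ≤ V.valuation z := by
        intro z hz
        by_cases hne : (T.filter fun α => α i = j).Nonempty
        · obtain ⟨α, hα, hmax⟩ := Finset.exists_max_image _ (fun α => V.valuation (s α)) hne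
          refine le_trans (pow_le_pow_left' ?_ e) (hz α (Finset.mem_filter.1 hα).1)
          refine Valuation.map_sum_le _ fun β hβ => ?_
          rw [map_mul]
          exact (mul_le_of_le_one_right' (hVB _ (hmonB β))).trans (hmax β hβ)
        · have : t j = 0 := by
            simp only [t]
            rw [Finset.not_nonempty_iff_eq_empty.1 hne, Finset.sum_empty]
          rw [this, map_zero, zero_pow (by omega)]
          exact zero_le
      constructor
      · intro h1
        have h2 := hle 1 fun α hα => by
          have := hs α hα V hVk 1 fun l => ?_
          · rw [map_one, one_pow] at this
            rwa [map_one]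
          · rw [map_one]
            by_cases hl : l = i
            · rw [hl]; exact h1
            · exact hVB _ (hB l hl)
        rw [map_one] at h2
        exact (pow_le_one_iff (by omega)).1 h2
      · intro h1
        have h2 := hle (u i ^ p) fun α hα => by
          rw [map_pow]
          refine hs α hα V hVk (u i) fun l => ?_
          by_cases hl : l = i
          · rw [hl]
          · exact (hVB _ (hB l hl)).trans h1
        rwa [map_pow] at h2

lemma degreeBounded_of_integral_equation {u : Fin (c + 1) → L} {e p M : ℕ} {s : L}
    {a : ℕ → L} (ha : ∀ j, 1 ≤ j → j ≤ M → a j ∈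
      Submodule.span k (monom u '' (degFinset (c + 1) (p * j) : Set (Fin (c + 1) →₀ ℕ))))
    (h : (s ^ e) ^ M + ∑ j ∈ Icc 1 M, a j * (s ^ e) ^ (M - j) = 0) :
    DegreeBounded k u e p s := by
  intro V hV y hy
  by_contra hlt
  rw [not_le] at hlt
  have hk : ∀ a : k, V.valuation (algebraMap k L a) ≤ 1 := fun a =>
    (V.valuation_le_one_iff _).2 (hV a)
  rw [← map_pow, ← map_pow] at hlt
  set κ := s ^ e with hκ
  have hκ0 : V.valuation κ ≠ 0 := (lt_of_le_of_lt zero_le hlt).ne'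
  have hvm : ∀ α : Fin (c + 1) →₀ ℕ, V.valuation (monom u α) ≤ V.valuation y ^ α.degree := by
    intro α
    rw [monom, map_prod, Finsupp.degree_eq_sum, ← Finset.prod_pow_eq_pow_sum]
    refine Finset.prod_le_prod' fun i _ => ?_
    rw [map_pow]
    exact pow_le_pow_left' (hy i) _
  have hva : ∀ q z, z ∈ Submodule.span k
      (monom u '' (degFinset (c + 1) q : Set (Fin (c + 1) →₀ ℕ))) →
      V.valuation z ≤ V.valuation y ^ q := by
    intro q z hz
    induction hz using Submodule.span_induction with
    | mem z hz =>
      obtain ⟨α, hα, rfl⟩ := hz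
      rw [← mem_degFinset.1 hα]
      exact hvm α
    | zero => rw [map_zero]; exact zero_le
    | add z w _ _ hz hw => exact (Valuation.map_add _ z w).trans (max_le hz hw)
    | smul b z _ hz =>
      rw [Algebra.smul_def, map_mul]
      exact (mul_le_of_le_one_left' (hk b)).trans hz
  have h1 : V.valuation (κ ^ M) < V.valuation (κ ^ M) := by
    nth_rewrite 1 [eq_neg_of_add_eq_zero_left h]
    rw [Valuation.map_neg]
    refine Valuation.map_sum_lt _ (by rw [map_pow]; exact pow_ne_zero _ hκ0) fun j hj => ?_
    rw [mem_Icc] at hj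
    have h2 : V.valuation (a j) < V.valuation κ ^ j := by
      refine (hva _ _ (ha j hj.1 hj.2)).trans_lt ?_
      rw [pow_mul, ← map_pow]
      exact pow_lt_pow_left₀ hlt zero_le (by omega)
    rw [map_mul, map_pow V.valuation κ (M - j), map_pow V.valuation κ M]
    calc V.valuation (a j) * V.valuation κ ^ (M - j)
        < V.valuation κ ^ j * V.valuation κ ^ (M - j) :=
          mul_lt_mul_of_pos_right h2 (pow_pos (zero_lt_iff.2 hκ0) _)
      _ = _ := by rw [← pow_add, Nat.add_sub_cancel' hj.2]
  exact lt_irrefl _ h1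

end DegreeBound

section OrderRing
variable {R : Type u} [CommRing R] [IsLocalRing R] {d : ℕ}

/-- The elements of `J ^ n`, where `J = genIdeal x`, that lie outside `m * J ^ n`. -/
def UnitForm (x : Fin d → R) (n : ℕ) (b : R) : Prop :=
  b ∈ genIdeal x ^ n ∧ b ∉ maximalIdeal R * genIdeal x ^ n

lemma unitForm_one (x : Fin d → R) : UnitForm x 0 1 := by
  constructor
  · simp
  · rw [pow_zero, mul_one]
    exact fun h => (maximalIdeal.isMaximal R).ne_top ((Ideal.eq_top_iff_one _).2 h)

lemma IsParameters.unitForm_monom {x : Fin d → R} (hx : IsParameters x) (hp : PowRegular x)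
    (α : Fin d →₀ ℕ) : UnitForm x α.degree (monom x α) := by
  classical
  refine ⟨monom_mem_pow x α, fun h => ?_⟩
  have h1 := hp.mem_of_sum_mem hx.genIdeal_le (n := α.degree)
    (c := fun β => if β = α then 1 else 0) (by simpa [mem_degFinset] using h) α
    (mem_degFinset.2 rfl)
  rw [if_pos rfl] at h1
  exact (maximalIdeal.isMaximal R).ne_top ((Ideal.eq_top_iff_one _).2 h1)

lemma IsParameters.unitForm_pow {x : Fin d → R} (hx : IsParameters x) (hp : PowRegular x)
    (i : Fin d) (n : ℕ) : UnitForm x n (x i ^ n) := by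
  have := hx.unitForm_monom hp (Finsupp.single i n)
  rwa [monom_single, Finsupp.degree_single] at this

variable [IsNoetherianRing R]

omit [IsNoetherianRing R] in
lemma UnitForm.mul {x : Fin d → R} (hx : IsParameters x) (hp : PowRegular x) {l n : ℕ} {b b' : R}
    (hb : UnitForm x l b) (hb' : UnitForm x n b') : UnitForm x (l + n) (b * b') :=
  ⟨by rw [pow_add]; exact Ideal.mul_mem_mul hb.1 hb'.1, fun h =>
    hb'.2 (hx.mem_maximalIdeal_mul_of_mul_mem hp hb.1 hb.2 hb'.1 h)⟩

omit [IsNoetherianRing R] in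
lemma UnitForm.ne_zero {x : Fin d → R} {n : ℕ} {b : R} (hb : UnitForm x n b) : b ≠ 0 := by
  rintro rfl
  exact hb.2 (Ideal.zero_mem _)

variable [IsDomain R] (K : Type u) [Field K] [Algebra R K] [IsFractionRing R K]

/-- The localization of the blowup algebra of `J = genIdeal x` at the prime `m * gr(J)`: fractions
`a / b` with `a ∈ J ^ n` and `b ∈ J ^ n` outside `m * J ^ n`. -/
def orderRing {x : Fin d → R} (hx : IsParameters x) (hp : PowRegular x) : Subring K where
  carrier := {z | ∃ n a b, a ∈ genIdeal x ^ n ∧ UnitForm x n b ∧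
    z * algebraMap R K b = algebraMap R K a}
  zero_mem' := ⟨0, 0, 1, Ideal.zero_mem _, unitForm_one x, by simp⟩
  one_mem' := ⟨0, 1, 1, by simp, unitForm_one x, by simp⟩
  add_mem' := by
    rintro z w ⟨n, a, b, ha, hb, h⟩ ⟨n', a', b', ha', hb', h'⟩
    refine ⟨n + n', a * b' + b * a', b * b', ?_, hb.mul hx hp hb', ?_⟩
    · rw [pow_add]
      exact Ideal.add_mem _ (Ideal.mul_mem_mul ha hb'.1) (Ideal.mul_mem_mul hb.1 ha')
    · simp only [map_mul, map_add, ← h, ← h']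
      ring
  mul_mem' := by
    rintro z w ⟨n, a, b, ha, hb, h⟩ ⟨n', a', b', ha', hb', h'⟩
    refine ⟨n + n', a * a', b * b', ?_, hb.mul hx hp hb', ?_⟩
    · rw [pow_add]
      exact Ideal.mul_mem_mul ha ha'
    · simp only [map_mul, ← h, ← h']
      ring
  neg_mem' := by
    rintro z ⟨n, a, b, ha, hb, h⟩
    exact ⟨n, -a, b, neg_mem ha, hb, by rw [map_neg, ← h, neg_mul]⟩

variable {K} {x : Fin d → R} (hx : IsParameters x) (hp : PowRegular x)

omit [IsLocalRing R] [IsNoetherianRing R] [IsDomain R] in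
lemma algebraMap_ne_zero_of_ne_zero {b : R} (hb : b ≠ 0) : algebraMap R K b ≠ 0 := fun h =>
  hb (IsFractionRing.injective R K (by rw [h, map_zero]))

omit [IsNoetherianRing R] [IsDomain R] in
lemma div_mem_orderRing {n : ℕ} {a b : R} (ha : a ∈ genIdeal x ^ n) (hb : UnitForm x n b) :
    algebraMap R K a / algebraMap R K b ∈ orderRing K hx hp :=
  ⟨n, a, b, ha, hb, div_mul_cancel₀ _ (algebraMap_ne_zero_of_ne_zero hb.ne_zero)⟩

omit [IsDomain R] [IsFractionRing R K] [IsNoetherianRing R] in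
lemma algebraMap_mem_orderRing (r : R) : algebraMap R K r ∈ orderRing K hx hp :=
  ⟨0, r, 1, by simp, unitForm_one x, by simp⟩

omit [IsNoetherianRing R] [IsDomain R] in
lemma mem_pow_of_div_mem_orderRing {n : ℕ} {a b : R} (hb : UnitForm x n b)
    (h : algebraMap R K a / algebraMap R K b ∈ orderRing K hx hp) : a ∈ genIdeal x ^ n := by
  obtain ⟨l, a', b', ha', hb', h⟩ := h
  rw [div_mul_eq_mul_div, div_eq_iff (algebraMap_ne_zero_of_ne_zero hb.ne_zero), ← map_mul,
    ← map_mul] at h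
  have h1 := IsFractionRing.injective R K h
  refine hx.mem_pow_of_mul_mem hp hb'.1 hb'.2 ?_
  rw [mul_comm, h1, pow_add]
  have h2 := Ideal.mul_mem_mul ha' hb.1
  exact h2

omit [IsNoetherianRing R] [IsDomain R] in
/-- The condition for a fraction of the order ring to be a unit. -/
lemma isUnit_orderRing_or (z : orderRing K hx hp) :
    IsUnit z ∨ ∃ n a b, a ∈ maximalIdeal R * genIdeal x ^ n ∧
      UnitForm x n b ∧ (z : K) * algebraMap R K b = algebraMap R K a := by
  obtain ⟨z, n, a, b, ha, hb, h⟩ := z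
  by_cases ham : a ∈ maximalIdeal R * genIdeal x ^ n
  · exact Or.inr ⟨n, a, b, ham, hb, h⟩
  · left
    have hab : UnitForm x n a := ⟨ha, ham⟩
    have ha0 := algebraMap_ne_zero_of_ne_zero (K := K) hab.ne_zero
    have hb0 := algebraMap_ne_zero_of_ne_zero (K := K) hb.ne_zero
    refine IsUnit.of_mul_eq_one ⟨_, div_mem_orderRing hx hp hb.1 hab⟩ (Subtype.ext ?_)
    simp only [Subring.coe_mul, Subring.coe_one]
    rw [← mul_div_assoc, h, div_self ha0]

omit [IsDomain R] [IsNoetherianRing R] in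
lemma not_isUnit_orderRing {z : orderRing K hx hp} {n : ℕ} {a b : R}
    (ha : a ∈ maximalIdeal R * genIdeal x ^ n) (hb : UnitForm x n b)
    (h : (z : K) * algebraMap R K b = algebraMap R K a) : ¬ IsUnit z := by
  rintro hz
  obtain ⟨w, hw⟩ := hz.exists_right_inv
  obtain ⟨w, n', a', b', ha', hb', h'⟩ := w
  have hw' : (z : K) * w = 1 := congrArg Subtype.val hw
  refine (hb.mul hx hp hb').2 ?_
  have h1 : algebraMap R K (b * b') = algebraMap R K (a * a') := by
    rw [map_mul, map_mul, ← h, ← h']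
    linear_combination (- algebraMap R K b * algebraMap R K b') * hw'
  rw [IsFractionRing.injective R K h1, pow_add, ← mul_assoc]
  exact Ideal.mul_mem_mul ha ha'

instance : IsLocalRing (orderRing K hx hp) := by
  refine IsLocalRing.of_nonunits_add fun z w hz hw => ?_
  obtain ⟨n, a, b, ha, hb, h⟩ := (isUnit_orderRing_or hx hp z).resolve_left hz
  obtain ⟨n', a', b', ha', hb', h'⟩ := (isUnit_orderRing_or hx hp w).resolve_left hw
  refine not_isUnit_orderRing hx hp (n := n + n') (a := a * b' + b * a') (b := b * b') ?_
    (hb.mul hx hp hb') ?_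
  · refine Ideal.add_mem _ ?_ ?_
    · rw [pow_add, ← mul_assoc]
      exact Ideal.mul_mem_mul ha hb'.1
    · rw [add_comm n, pow_add, ← mul_assoc, mul_comm b]
      exact Ideal.mul_mem_mul ha' hb.1
  · simp only [map_mul, map_add, ← h, ← h', Subring.coe_add]
    ring

omit [IsLocalRing R] [IsDomain R] [IsFractionRing R K] in
lemma isNoetherianRing_adjoin (s : Set K) (hs : s.Finite) :
    IsNoetherianRing (Algebra.adjoin R s) := by
  have := (Subalgebra.fg_adjoin_finset (R := R) hs.toFinset)
  rw [hs.coe_toFinset] at this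
  have := (Subalgebra.fg_iff_finiteType _).1 this
  exact Algebra.FiniteType.isNoetherianRing R _

omit [IsLocalRing R] [IsNoetherianRing R] [IsDomain R] [IsFractionRing R K] in
lemma div_mem_adjoin (i : Fin d) {n : ℕ} {a : R} (ha : a ∈ genIdeal x ^ n) :
    algebraMap R K a / algebraMap R K (x i) ^ n ∈
      Algebra.adjoin R (Set.range fun j => algebraMap R K (x j) / algebraMap R K (x i)) := by
  obtain ⟨c, rfl⟩ := mem_pow_genIdeal_iff.1 ha
  rw [map_sum, Finset.sum_div]
  refine Subalgebra.sum_mem _ fun α hα => ?_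
  rw [map_mul, mul_div_assoc]
  refine Subalgebra.mul_mem _ (Subalgebra.algebraMap_mem _ _) ?_
  rw [← mem_degFinset.1 hα, monom, map_prod, Finsupp.degree_eq_sum, ← Finset.prod_pow_eq_pow_sum,
    ← Finset.prod_div_distrib]
  refine Subalgebra.prod_mem _ fun j _ => ?_
  rw [map_pow, ← div_pow]
  exact Subalgebra.pow_mem _ (Algebra.subset_adjoin (Set.mem_range_self j)) _

omit [IsDomain R] in
include hx hp in
lemma isNoetherianRing_orderRing (i : Fin d) : IsNoetherianRing (orderRing K hx hp) := by
  let A := Algebra.adjoin R (Set.range fun j => algebraMap R K (x j) / algebraMap R K (x i))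
  have hA : IsNoetherianRing A := isNoetherianRing_adjoin _ (Set.finite_range _)
  have h1 : UnitForm x 1 (x i) := by simpa using hx.unitForm_pow hp i 1
  have hAS : A.toSubring ≤ orderRing K hx hp := by
    have : A ≤ { orderRing K hx hp with
        algebraMap_mem' := fun r => algebraMap_mem_orderRing hx hp r } := by
      refine Algebra.adjoin_le ?_
      rintro _ ⟨j, rfl⟩
      exact div_mem_orderRing hx hp (n := 1) (by rw [pow_one]; exact mem_genIdeal x j) h1
    exact this
  let _ : Algebra A (orderRing K hx hp) := (Subring.inclusion hAS).toAlgebra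
  have hcoe : ∀ a : A, ((algebraMap A (orderRing K hx hp) a : orderRing K hx hp) : K) = a :=
    fun a => rfl
  let M : Submonoid A := (IsUnit.submonoid (orderRing K hx hp)).comap (algebraMap A _)
  have hi0 := algebraMap_ne_zero_of_ne_zero (K := K) h1.ne_zero
  have : IsLocalization M (orderRing K hx hp) := by
    refine ⟨⟨fun m => m.2, fun z => ?_, fun {a b} h => ⟨1, ?_⟩⟩⟩
    · obtain ⟨z, n, a, b, ha, hb, h⟩ := z
      have hb0 := algebraMap_ne_zero_of_ne_zero (K := K) hb.ne_zero
      refine ⟨(⟨_, div_mem_adjoin i ha⟩, ⟨⟨_, div_mem_adjoin i hb.1⟩, ?_⟩), Subtype.ext ?_⟩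
      · refine IsUnit.of_mul_eq_one (⟨algebraMap R K (x i ^ n) / algebraMap R K b,
          div_mem_orderRing hx hp (hx.unitForm_pow hp i n).1 hb⟩) (Subtype.ext ?_)
        change algebraMap R K b / algebraMap R K (x i) ^ n *
          (algebraMap R K (x i ^ n) / algebraMap R K b) = 1
        rw [map_pow]
        field_simp
      · rw [Subring.coe_mul, hcoe, hcoe]
        simp only
        rw [← mul_div_assoc, h]
    · have := congrArg Subtype.val h
      rw [hcoe, hcoe] at this
      rw [Subtype.ext this]
  exact IsLocalization.isNoetherianRing M _ hA

end OrderRing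

section IntegralEquations
variable {R : Type u} [CommRing R]

lemma mem_integralOverIdeal_of_sum_range {I : Ideal R} {y : R} {M : ℕ} (hM : 0 < M) {a : ℕ → R}
    (ha : ∀ i < M, a i ∈ I ^ (M - i)) (h : y ^ M + ∑ i ∈ range M, a i * y ^ i = 0) :
    y ∈ integralOverIdeal I := by
  refine ⟨M, hM, fun j => a (M - j), fun j hj hjM => ?_, ?_⟩
  · have := ha (M - j) (by omega)
    rwa [Nat.sub_sub_self hjM] at this
  · rw [← h]
    congr 1
    refine Finset.sum_nbij' (fun j => M - j) (fun i => M - i) ?_ ?_ ?_ ?_ ?_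
    all_goals intro j hj
    all_goals simp only [mem_Icc, mem_range] at *
    all_goals omega

lemma IsIntegral.exists_sum_range {A B : Type*} [CommRing A] [CommRing B] [Algebra A B]
    [Nontrivial B] {z : B} (hz : IsIntegral A z) :
    ∃ M, 0 < M ∧ ∃ f : ℕ → A, z ^ M + ∑ i ∈ range M, algebraMap A B (f i) * z ^ i = 0 := by
  obtain ⟨p, hp, hz⟩ := hz
  refine ⟨p.natDegree, ?_, p.coeff, ?_⟩
  · rw [Nat.pos_iff_ne_zero]
    intro h0
    rw [hp.natDegree_eq_zero.1 h0, Polynomial.eval₂_one] at hz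
    exact one_ne_zero hz
  · rw [hp.as_sum] at hz
    simpa [Polynomial.eval₂_finsetSum] using hz

variable [IsLocalRing R] [IsNoetherianRing R] [IsDomain R]

lemma IsRegularLocalOfDim.isIntegrallyClosed {d : ℕ} (h : IsRegularLocalOfDim R d) :
    IsIntegrallyClosed R := by
  obtain ⟨y, hy, hym⟩ := h.exists_seq
  refine (isIntegrallyClosed_iff (FractionRing R)).2 fun {z} hz => ?_
  obtain ⟨p, q, hq, rfl⟩ := IsFractionRing.div_surjective (A := R) z
  have hq0 : algebraMap R (FractionRing R) q ≠ 0 :=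
    algebraMap_ne_zero_of_ne_zero (nonZeroDivisors.ne_zero hq)
  obtain ⟨M, hM, f, hf⟩ := hz.exists_sum_range
  have h1 : p ∈ integralOverIdeal (Ideal.span {q}) := by
    refine mem_integralOverIdeal_of_sum_range hM (a := fun i => f i * q ^ (M - i)) ?_ ?_
    · exact fun i _ => Ideal.mul_mem_left _ _ (Ideal.pow_mem_pow (Ideal.mem_span_singleton_self q) _)
    · apply IsFractionRing.injective R (FractionRing R)
      rw [map_zero, ← mul_zero (algebraMap R (FractionRing R) q ^ M), ← hf, mul_add, mul_sum]
      simp only [map_add, map_pow, map_sum, map_mul, div_pow]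
      congr 1
      · field_simp
      · refine Finset.sum_congr rfl fun i hi => ?_
        obtain ⟨j, rfl⟩ := Nat.exists_eq_add_of_lt (mem_range.1 hi)
        rw [show i + j + 1 - i = j + 1 by omega]
        field_simp
        ring
  have h2 := mem_of_integralOver_pow_length hy hym [q] (by simp) (z := p) (by
    simpa [Ideal.ofList] using h1)
  rw [Ideal.ofList_singleton, Ideal.mem_span_singleton'] at h2
  obtain ⟨a, rfl⟩ := h2
  exact ⟨a, by rw [map_mul]; field_simp⟩

end IntegralEquations

section OrderRing
variable {R : Type u} [CommRing R] [IsLocalRing R] {d : ℕ}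
variable [IsNoetherianRing R] [IsDomain R] {K : Type u} [Field K] [Algebra R K] [IsFractionRing R K]
variable {x : Fin d → R} (hx : IsParameters x) (hp : PowRegular x)

omit [IsNoetherianRing R] [IsDomain R] in
include hx hp in
lemma IsParameters.unitForm (i : Fin d) : UnitForm x 1 (x i) := by
  simpa using hx.unitForm_pow hp i 1

/-- A parameter as an element of the order ring. -/
def orderRingParam (K : Type u) [Field K] [Algebra R K] [IsFractionRing R K] (i : Fin d) :
    orderRing K hx hp :=
  ⟨algebraMap R K (x i), algebraMap_mem_orderRing hx hp (x i)⟩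

omit [IsDomain R] [IsNoetherianRing R] in
lemma not_isUnit_orderRingParam (i : Fin d) : ¬ IsUnit (orderRingParam hx hp K i) :=
  not_isUnit_orderRing hx hp (n := 0) (a := x i) (b := 1) (by simpa using hx.1 i)
    (unitForm_one x) (by simp [orderRingParam])

omit [IsNoetherianRing R] [IsDomain R] in
lemma exists_pow_mem_span_orderRingParam (i : Fin d) {z : orderRing K hx hp} (hz : ¬ IsUnit z) :
    ∃ N, z ^ N ∈ Ideal.span {orderRingParam hx hp K i} := by
  obtain ⟨N, hN⟩ := hx.2
  obtain ⟨n, a, b, ha, hb, h⟩ := (isUnit_orderRing_or hx hp z).resolve_left hz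
  have hbN : ∀ N, UnitForm x (n * N) (b ^ N) := by
    intro N
    induction N with
    | zero => simpa using unitForm_one x
    | succ N ih => rw [mul_add, mul_one, pow_succ]; exact ih.mul hx hp hb
  have haN : a ^ N ∈ genIdeal x ^ (1 + n * N) := by
    have := Ideal.pow_mem_pow ha N
    rw [mul_pow, ← pow_mul] at this
    rw [pow_add, pow_one]
    exact Ideal.mul_mono_left hN this
  have hmul := (hx.unitForm hp i).mul hx hp (hbN N)
  refine ⟨N, Ideal.mem_span_singleton'.2 ⟨⟨_, div_mem_orderRing hx hp haN hmul⟩, Subtype.ext ?_⟩⟩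
  have hb0 := algebraMap_ne_zero_of_ne_zero (K := K) hb.ne_zero
  have hi0 := algebraMap_ne_zero_of_ne_zero (K := K) (hx.unitForm hp i).ne_zero
  change algebraMap R K (a ^ N) / algebraMap R K (x i * b ^ N) * algebraMap R K (x i) = (z : K) ^ N
  rw [map_pow, map_mul, map_pow, ← h, mul_pow]
  field_simp

omit [IsDomain R] in
include hx hp in
lemma dimensionLEOne_orderRing (i : Fin d) : Ring.DimensionLEOne (orderRing K hx hp) := by
  have hN := isNoetherianRing_orderRing (K := K) hx hp i
  have hmin : maximalIdeal (orderRing K hx hp) ∈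
      (Ideal.span {orderRingParam hx hp K i}).minimalPrimes := by
    refine ⟨⟨inferInstance, ?_⟩, fun q hq _ z hz => ?_⟩
    · rw [Ideal.span_singleton_le_iff_mem]
      exact not_isUnit_orderRingParam hx hp i
    · obtain ⟨N, hN⟩ := exists_pow_mem_span_orderRingParam hx hp i hz
      exact hq.1.mem_of_pow_mem N (hq.2 hN)
  have hht := Ideal.height_le_one_of_isPrincipal_of_mem_minimalPrimes _ _ hmin
  refine ⟨fun {p} hp0 hpp => ?_⟩
  have hpm : p ≤ maximalIdeal _ := le_maximalIdeal hpp.ne_top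
  rcases hpm.eq_or_lt with h | h
  · rw [h]; infer_instance
  · exfalso
    have h1 : p.height < (1 : ℕ) := Ideal.height_le_iff.1 (by exact_mod_cast hht) p hpp h
    have h2 : p.height = 0 := by
      rw [Nat.cast_one] at h1
      exact Order.lt_one_iff.1 h1
    exact hp0 (by simpa using h2)

end OrderRing

section OrderRing
variable {R : Type u} [CommRing R] [IsLocalRing R] {d : ℕ}
variable [IsNoetherianRing R] [IsDomain R] {K : Type u} [Field K] [Algebra R K] [IsFractionRing R K]
variable {x : Fin d → R} (hx : IsParameters x) (hp : PowRegular x)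

omit [IsDomain R] [IsFractionRing R K] [IsNoetherianRing R] in
lemma exists_common_denominator (f : ℕ → orderRing K hx hp) (M : ℕ) :
    ∃ n b, UnitForm x n b ∧ ∀ j < M, ∃ a ∈ genIdeal x ^ n,
      (f j : K) * algebraMap R K b = algebraMap R K a := by
  induction M with
  | zero => exact ⟨0, 1, unitForm_one x, by simp⟩
  | succ M ih =>
    obtain ⟨n, b, hb, h⟩ := ih
    obtain ⟨n', a', b', ha', hb', h'⟩ := (f M).2
    refine ⟨n + n', b * b', hb.mul hx hp hb', fun j hj => ?_⟩
    rcases Nat.lt_succ_iff_lt_or_eq.1 hj with hj | rfl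
    · obtain ⟨a, ha, h1⟩ := h j hj
      refine ⟨a * b', by rw [pow_add]; exact Ideal.mul_mem_mul ha hb'.1, ?_⟩
      rw [map_mul, map_mul, ← h1, mul_assoc]
    · refine ⟨b * a', by rw [pow_add]; exact Ideal.mul_mem_mul hb.1 ha', ?_⟩
      rw [map_mul, map_mul, ← h']
      ring

variable (h : IsRegularLocalOfDim R d)
include h

lemma mul_mem_orderRing_of_isIntegral (i : Fin d) {z : K}
    (hz : IsIntegral (orderRing K hx hp) z) :
    algebraMap R K (x i) ^ (d - 1) * z ∈ orderRing K hx hp := by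
  have := h.isIntegrallyClosed
  obtain ⟨M, hM, f, hf⟩ := hz.exists_sum_range
  obtain ⟨n, b, hb, hfb⟩ := exists_common_denominator hx hp f M
  have hb0 := algebraMap_ne_zero_of_ne_zero (K := K) hb.ne_zero
  choose! a ha hfa using hfb
  have key : (z * algebraMap R K b) ^ M + ∑ i ∈ range M,
      algebraMap R K (a i * b ^ (M - i - 1)) * (z * algebraMap R K b) ^ i = 0 := by
    rw [← mul_zero (algebraMap R K b ^ M), ← hf, mul_add, mul_sum]
    congr 1
    · ring
    · refine Finset.sum_congr rfl fun j hj => ?_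
      rw [map_mul, ← hfa j (mem_range.1 hj)]
      obtain ⟨l, rfl⟩ := Nat.exists_eq_add_of_lt (mem_range.1 hj)
      rw [show j + l + 1 - j - 1 = l by omega, map_pow]
      change _ = _ * ((f j : K) * _)
      ring
  have hzint : IsIntegral R (z * algebraMap R K b) := by
    refine ⟨Polynomial.X ^ M + ∑ i ∈ range M, Polynomial.C (a i * b ^ (M - i - 1)) *
      Polynomial.X ^ i, ?_, ?_⟩
    · refine Polynomial.monic_X_pow_add ?_
      refine lt_of_le_of_lt (Polynomial.degree_sum_le _ _) ?_
      refine (Finset.sup_lt_iff (WithBot.bot_lt_coe M)).2 fun j hj => ?_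
      exact (Polynomial.degree_C_mul_X_pow_le _ _).trans_lt
        (WithBot.coe_lt_coe.2 (mem_range.1 hj))
    · simpa [Polynomial.eval₂_finsetSum] using key
  obtain ⟨w, hw⟩ := (isIntegrallyClosed_iff K).1 this hzint
  have hw1 : w ∈ integralOverIdeal (genIdeal x ^ n) := by
    refine mem_integralOverIdeal_of_sum_range hM (a := fun i => a i * b ^ (M - i - 1)) ?_ ?_
    · intro j hj
      obtain ⟨l, rfl⟩ := Nat.exists_eq_add_of_lt hj
      rw [show j + l + 1 - j - 1 = l by omega, show j + l + 1 - j = l + 1 by omega, pow_succ']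
      exact Ideal.mul_mem_mul (ha j hj) (Ideal.pow_mem_pow hb.1 l)
    · apply IsFractionRing.injective R K
      rw [map_zero, ← key, ← hw]
      simp
  have hJ : genIdeal x ≠ ⊥ := fun h0 =>
    (hx.unitForm hp i).ne_zero (by simpa [h0] using mem_genIdeal x i)
  have hw2 : w ∈ genIdeal x ^ (n - (d - 1)) :=
    almostClosure_pow_le h i.pos hJ hp n (integralOverIdeal.almostIntegralOver (pow_ne_zero n hJ) hw1)
  have hw3 : x i ^ (d - 1) * w ∈ genIdeal x ^ n := by
    have := Ideal.mul_mem_mul (Ideal.pow_mem_pow (mem_genIdeal x i) (d - 1)) hw2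
    rw [← pow_add] at this
    exact Ideal.pow_le_pow_right (by omega) this
  have := div_mem_orderRing (K := K) hx hp hw3 hb
  rwa [map_mul, hw, map_pow, ← mul_assoc, mul_div_cancel_right₀ _ hb0] at this

lemma mem_almostClosure_of_isIntegral_div (i : Fin d) {p : ℕ} {z : R}
    (hz : IsIntegral (orderRing K hx hp) (algebraMap R K z / algebraMap R K (x i) ^ p)) :
    z ∈ almostClosure (genIdeal x ^ p) := by
  refine ⟨x i ^ (d - 1), pow_ne_zero _ (hx.unitForm hp i).ne_zero, fun n => ?_⟩
  rw [← pow_mul]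
  refine mem_pow_of_div_mem_orderRing hx hp (K := K) (hx.unitForm_pow hp i (p * n)) ?_
  have := mul_mem_orderRing_of_isIntegral hx hp h i (hz.pow n)
  rwa [div_pow, ← pow_mul, ← mul_div_assoc, ← map_pow, ← map_pow, ← map_pow, ← map_mul] at this

omit [IsNoetherianRing R] h [IsDomain R] in
lemma isFractionRing_integralClosure_orderRing [IsNoetherianRing R] :
    IsFractionRing (integralClosure (orderRing K hx hp) K) K := by
  refine IsFractionRing.of_field _ _ fun z => ?_
  obtain ⟨a, b, _, rfl⟩ := IsFractionRing.div_surjective (A := R) z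
  exact ⟨algebraMap (orderRing K hx hp) _ ⟨_, algebraMap_mem_orderRing hx hp a⟩,
    algebraMap (orderRing K hx hp) _ ⟨_, algebraMap_mem_orderRing hx hp b⟩, rfl⟩

lemma isDedekindDomain_integralClosure_orderRing (i : Fin d) :
    IsDedekindDomain (integralClosure (orderRing K hx hp) K) := by
  have h1 := isNoetherianRing_orderRing (K := K) hx hp i
  have h2 := dimensionLEOne_orderRing (K := K) hx hp i
  have h3 := isFractionRing_integralClosure_orderRing (K := K) hx hp
  have hi0 := algebraMap_ne_zero_of_ne_zero (K := K) (hx.unitForm hp i).ne_zero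
  have h4 : IsNoetherian (orderRing K hx hp) (integralClosure (orderRing K hx hp) K) := by
    let φ : integralClosure (orderRing K hx hp) K →ₗ[orderRing K hx hp] orderRing K hx hp :=
      { toFun := fun s => ⟨_, mul_mem_orderRing_of_isIntegral hx hp h i s.2⟩
        map_add' := fun s t => Subtype.ext (mul_add _ _ _)
        map_smul' := fun r s => Subtype.ext (by
          change _ * ((r : K) * (s : K)) = (r : K) * _
          ring) }
    refine isNoetherian_of_injective φ fun s t hst => Subtype.ext ?_
    exact mul_left_cancel₀ (pow_ne_zero (d - 1) hi0) (congrArg Subtype.val hst)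
  have h5 : IsNoetherianRing (integralClosure (orderRing K hx hp) K) :=
    isNoetherian_of_tower (orderRing K hx hp) h4
  have h6 := (isDedekindRing_iff (integralClosure (orderRing K hx hp) K) K).2
    ⟨h5, inferInstance, fun {z} hz => ?_⟩
  · exact { toIsDomain := inferInstance, toIsDedekindRing := h6 }
  have := (integralClosure_idem (R := orderRing K hx hp) (A := K)).le hz
  exact Algebra.mem_bot.1 this

end OrderRing

section ReesValuations
open scoped WithZero
variable {R : Type u} [CommRing R] [IsLocalRing R] {d : ℕ}
variable [IsNoetherianRing R] [IsDomain R] {K : Type u} [Field K] [Algebra R K] [IsFractionRing R K]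
variable {x : Fin d → R} (hx : IsParameters x) (hp : PowRegular x) (h : IsRegularLocalOfDim R d)
include h

open IsDedekindDomain in
/-- The integral closures of powers of a parameter ideal are detected by finitely many discrete
valuations. -/
lemma exists_finset_valuation (i : Fin d) : ∃ W : Finset (Valuation K ℤᵐ⁰),
    (∀ w ∈ W, (∀ z ∈ orderRing K hx hp, w z ≤ 1) ∧ w (algebraMap R K (x i)) < 1) ∧
    ∀ (p : ℕ) (z : R), (∀ w ∈ W, w (algebraMap R K z) ≤ w (algebraMap R K (x i)) ^ p) →
      z ∈ almostClosure (genIdeal x ^ p) := by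
  classical
  have h1 := isDedekindDomain_integralClosure_orderRing (K := K) hx hp h i
  have h2 := isFractionRing_integralClosure_orderRing (K := K) hx hp
  have hi0 := algebraMap_ne_zero_of_ne_zero (K := K) (hx.unitForm hp i).ne_zero
  let C := integralClosure (orderRing K hx hp) K
  let y : C := algebraMap (orderRing K hx hp) C (orderRingParam hx hp K i)
  have hy : algebraMap C K y = algebraMap R K (x i) := rfl
  have hy0 : Ideal.span {y} ≠ 0 := by
    rw [Ideal.zero_eq_bot, Ne, Ideal.span_singleton_eq_bot]
    intro h0
    rw [h0, map_zero] at hy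
    exact hi0 hy.symm
  let W := (Ideal.finite_factors hy0).toFinset
  have hle : ∀ (v : HeightOneSpectrum C), ∀ z ∈ orderRing K hx hp, v.valuation K z ≤ 1 :=
    fun v z hz => v.valuation_le_one (K := K) (algebraMap (orderRing K hx hp) C ⟨z, hz⟩)
  refine ⟨W.image fun v => v.valuation K, ?_, fun p z hz => ?_⟩
  · intro w hw
    obtain ⟨v, hv, rfl⟩ := mem_image.1 hw
    refine ⟨hle v, ?_⟩
    rw [← hy]
    have hv' : v.asIdeal ∣ Ideal.span {y} := by simpa [W] using hv
    exact (v.valuation_lt_one_iff_dvd y).2 hv'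
  · refine mem_almostClosure_of_isIntegral_div hx hp (K := K) h i ?_
    have hv1 : ∀ v : HeightOneSpectrum C,
        v.valuation K (algebraMap R K z / algebraMap R K (x i) ^ p) ≤ 1 := by
      intro v
      have hv0 : v.valuation K (algebraMap R K (x i)) ≠ 0 := (Valuation.ne_zero_iff _).2 hi0
      rw [map_div₀, map_pow]
      refine div_le_one_of_le₀ ?_ zero_le
      by_cases hv : v ∈ W
      · exact hz _ (mem_image_of_mem _ hv)
      · have h3 : ¬ v.valuation K (algebraMap C K y) < 1 := fun h4 =>
          hv ((Set.Finite.mem_toFinset _).2 (show v.asIdeal ∣ Ideal.span {y} from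
            (v.valuation_lt_one_iff_dvd y).1 h4))
        rw [hy, not_lt] at h3
        exact (hle v _ (algebraMap_mem_orderRing hx hp z)).trans (one_le_pow_of_one_le' h3 p)
    obtain ⟨s, hs⟩ := HeightOneSpectrum.mem_integers_of_valuation_le_one (R := C) K _ hv1
    rw [← hs]
    exact s.2

lemma exists_extremal_valuation (i : Fin d) {ι : Type*} (T : Finset ι) (c : ι → R) {α : ι}
    (hα : α ∈ T) (hc : c α ∉ almostClosure (genIdeal x)) :
    ∃ w : Valuation K ℤᵐ⁰, (∀ z ∈ orderRing K hx hp, w z ≤ 1) ∧ w (algebraMap R K (x i)) < 1 ∧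
      ∃ β ∈ T, c β ≠ 0 ∧ (∀ γ ∈ T, w (algebraMap R K (c γ)) ≤ w (algebraMap R K (c β))) ∧
      ∃ p e : ℕ, p < e ∧ w (algebraMap R K (c β)) ^ e = w (algebraMap R K (x i)) ^ p ∧
      ∀ γ ∈ T, c γ ^ e ∈ almostClosure (genIdeal x ^ p) := by
  classical
  obtain ⟨W, hW, hWJ⟩ := exists_finset_valuation (K := K) hx hp h i
  have hi0 := algebraMap_ne_zero_of_ne_zero (K := K) (hx.unitForm hp i).ne_zero
  have hwi : ∀ w : Valuation K ℤᵐ⁰, w (algebraMap R K (x i)) ≠ 0 := fun w =>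
    (Valuation.ne_zero_iff _).2 hi0
  have hwc : ∀ (w : Valuation K ℤᵐ⁰) γ, c γ ≠ 0 → w (algebraMap R K (c γ)) ≠ 0 := fun w γ h =>
    (Valuation.ne_zero_iff _).2 (algebraMap_ne_zero_of_ne_zero h)
  let P : Valuation K ℤᵐ⁰ → ι → ℤ := fun w γ => - WithZero.log (w (algebraMap R K (c γ)))
  let E : Valuation K ℤᵐ⁰ → ℤ := fun w => - WithZero.log (w (algebraMap R K (x i)))
  have hE : ∀ w ∈ W, 0 < E w := by
    intro w hw
    have := (WithZero.log_lt_log (hwi w) one_ne_zero).2 (hW w hw).2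
    rw [WithZero.log_one] at this
    simp only [E]
    omega
  have hP : ∀ w ∈ W, ∀ γ, c γ ≠ 0 → 0 ≤ P w γ := by
    intro w hw γ hγ
    have := (WithZero.log_le_log (hwc w γ hγ) one_ne_zero).2
      ((hW w hw).1 _ (algebraMap_mem_orderRing hx hp _))
    rw [WithZero.log_one] at this
    simp only [P]
    omega
  have hcmp : ∀ (w : Valuation K ℤᵐ⁰) γ, c γ ≠ 0 → ∀ e p : ℕ,
      w (algebraMap R K (c γ)) ^ e ≤ w (algebraMap R K (x i)) ^ p ↔ p * E w ≤ e * P w γ := by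
    intro w γ hγ e p
    rw [← WithZero.log_le_log (pow_ne_zero _ (hwc w γ hγ)) (pow_ne_zero _ (hwi w)),
      WithZero.log_pow, WithZero.log_pow, nsmul_eq_mul, nsmul_eq_mul]
    simp only [P, E]
    constructor <;> intro h <;> linarith
  have hcα : c α ≠ 0 := fun h0 => hc (h0 ▸ Ideal.zero_mem _)
  obtain ⟨w₁, hw₁, hlt₁⟩ : ∃ w ∈ W, P w α < E w := by
    by_contra! hcon
    refine hc ?_
    have := hWJ 1 (c α) fun w hw => ?_
    · rwa [pow_one] at this
    · have := (hcmp w α hcα 1 1).2 (by simpa using hcon w hw)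
      rwa [pow_one] at this
  obtain ⟨⟨w, β⟩, hwβ, hmin⟩ := Finset.exists_min_image (W ×ˢ T.filter fun γ => c γ ≠ 0)
    (fun a => (P a.1 a.2 : ℚ) / E a.1) ⟨(w₁, α), by simp [hw₁, hα, hcα]⟩
  simp only [mem_product, mem_filter] at hwβ
  obtain ⟨hw, hβT, hβ⟩ := hwβ
  have hmin' : ∀ w' ∈ W, ∀ γ ∈ T, c γ ≠ 0 → P w β * E w' ≤ P w' γ * E w := by
    intro w' hw' γ hγ hcγ
    have := hmin (w', γ) (by simp [hw', hγ, hcγ])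
    rw [div_le_div_iff₀ (by exact_mod_cast hE w hw) (by exact_mod_cast hE w' hw')] at this
    exact_mod_cast this
  obtain ⟨e, he⟩ := Int.eq_ofNat_of_zero_le (hE w hw).le
  obtain ⟨p, hpe⟩ := Int.eq_ofNat_of_zero_le (hP w hw β hβ)
  have hcl : ∀ γ ∈ T, c γ ≠ 0 → ∀ w' ∈ W,
      w' (algebraMap R K (c γ)) ^ e ≤ w' (algebraMap R K (x i)) ^ p := by
    intro γ hγ hcγ w' hw'
    rw [hcmp w' γ hcγ, ← hpe, ← he, mul_comm (E w)]
    exact hmin' w' hw' γ hγ hcγ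
  have he0 : e ≠ 0 := by
    have := hE w hw
    omega
  refine ⟨w, (hW w hw).1, (hW w hw).2, β, hβT, hβ, ?_, p, e, ?_, ?_, ?_⟩
  · intro γ hγ
    by_cases hcγ : c γ = 0
    · rw [hcγ, map_zero, map_zero]; exact zero_le
    · have h1 := hmin' w hw γ hγ hcγ
      have h2 := le_of_mul_le_mul_right h1 (hE w hw)
      refine (WithZero.log_le_log (hwc w γ hcγ) (hwc w β hβ)).1 ?_
      simp only [P] at h2
      omega
  · have h1 := hmin' w₁ hw₁ α hα hcα
    have h2 : P w β * E w₁ < E w * E w₁ := by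
      refine h1.trans_lt ?_
      rw [mul_comm (E w)]
      exact mul_lt_mul_of_pos_right hlt₁ (hE w hw)
    have h3 := lt_of_mul_lt_mul_right h2 (hE w₁ hw₁).le
    omega
  · refine le_antisymm (hcl β hβT hβ w hw) ?_
    rw [← WithZero.log_le_log (pow_ne_zero _ (hwi w)) (pow_ne_zero _ (hwc w β hβ)),
      WithZero.log_pow, WithZero.log_pow, nsmul_eq_mul, nsmul_eq_mul]
    have h1 : WithZero.log (w (algebraMap R K (x i))) = -e := by simp only [E] at he; omega
    have h2 : WithZero.log (w (algebraMap R K (c β))) = -p := by simp only [P] at hpe; omega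
    rw [h1, h2]
    exact le_of_eq (by ring)
  · intro γ hγ
    by_cases hcγ : c γ = 0
    · rw [hcγ, zero_pow he0]; exact Ideal.zero_mem _
    · refine hWJ p _ fun w' hw' => ?_
      rw [map_pow, map_pow]
      exact hcl γ hγ hcγ w' hw'

end ReesValuations

section Places
open scoped WithZero
variable {K L : Type*} [Field K] [Field L]

/-- The residue map of a valuation into a field, extended arbitrarily outside of the valuation
ring. -/
structure IsPlace (w : Valuation K ℤᵐ⁰) (θ : K → L) : Prop where
  map_one : θ 1 = 1
  map_add : ∀ a b, w a ≤ 1 → w b ≤ 1 → θ (a + b) = θ a + θ b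
  map_mul : ∀ a b, w a ≤ 1 → w b ≤ 1 → θ (a * b) = θ a * θ b
  eq_zero_iff : ∀ a, w a ≤ 1 → (θ a = 0 ↔ w a < 1)

lemma exists_isPlace {K : Type u} [Field K] (w : Valuation K ℤᵐ⁰) :
    ∃ (L : Type u) (_ : Field L) (_ : IsAlgClosed L) (θ : K → L), IsPlace w θ := by
  classical
  let O := w.valuationSubring
  let ψ : O →+* AlgebraicClosure (ResidueField O) := (algebraMap _ _).comp (residue O)
  have hinj : ∀ z, algebraMap (ResidueField O) (AlgebraicClosure (ResidueField O)) z = 0 ↔ z = 0 :=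
    fun z => map_eq_zero_iff _ (RingHom.injective _)
  have hψ : ∀ z : O, ψ z = 0 ↔ w z < 1 := by
    intro z
    rw [RingHom.comp_apply, hinj, residue_eq_zero_iff, ValuationSubring.valuation_lt_one_iff]
    exact (w.isEquiv_valuation_valuationSubring.lt_one_iff_lt_one).symm
  refine ⟨AlgebraicClosure (ResidueField O), inferInstance, inferInstance,
    fun z => if hz : w z ≤ 1 then ψ ⟨z, hz⟩ else 0, ?_, ?_, ?_, ?_⟩
  · rw [dif_pos (by simp)]
    exact ψ.map_one
  · intro a b ha hb
    rw [dif_pos (w.map_add_le ha hb), dif_pos ha, dif_pos hb, ← ψ.map_add]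
    rfl
  · intro a b ha hb
    rw [dif_pos (by rw [map_mul]; exact mul_le_one' ha hb), dif_pos ha, dif_pos hb, ← ψ.map_mul]
    rfl
  · intro a ha
    rw [dif_pos ha]
    exact hψ _

variable {w : Valuation K ℤᵐ⁰} {θ : K → L} (hθ : IsPlace w θ)
include hθ

lemma IsPlace.map_zero : θ 0 = 0 := (hθ.eq_zero_iff 0 (by simp)).2 (by simp)

lemma IsPlace.map_pow {a : K} (ha : w a ≤ 1) (n : ℕ) : θ (a ^ n) = θ a ^ n := by
  induction n with
  | zero => simp [hθ.map_one]
  | succ n ih =>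
    rw [pow_succ, pow_succ, hθ.map_mul _ _ (by rw [_root_.map_pow]; exact pow_le_one' ha n) ha, ih]

lemma IsPlace.map_sum {ι : Type*} (s : Finset ι) (f : ι → K) (hf : ∀ i ∈ s, w (f i) ≤ 1) :
    θ (∑ i ∈ s, f i) = ∑ i ∈ s, θ (f i) := by
  classical
  induction s using Finset.induction_on with
  | empty => simp [hθ.map_zero]
  | insert i s hi ih =>
    rw [sum_insert hi, sum_insert hi, hθ.map_add _ _ (hf i (mem_insert_self i s))
      (Valuation.map_sum_le _ fun j hj => hf j (mem_insert_of_mem hj)),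
      ih fun j hj => hf j (mem_insert_of_mem hj)]

lemma IsPlace.map_monom {d : ℕ} {v : Fin d → K} (hv : ∀ i, w (v i) ≤ 1) (α : Fin d →₀ ℕ) :
    θ (monom v α) = monom (fun i => θ (v i)) α := by
  classical
  have h : ∀ s : Finset (Fin d), θ (∏ i ∈ s, v i ^ α i) = ∏ i ∈ s, θ (v i) ^ α i := by
    intro s
    induction s using Finset.induction_on with
    | empty => simp [hθ.map_one]
    | insert i s hi ih =>
      rw [prod_insert hi, prod_insert hi, hθ.map_mul, ih, hθ.map_pow (hv i)]
      · rw [_root_.map_pow]; exact pow_le_one' (hv i) _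
      · rw [map_prod]
        refine prod_le_one' fun j _ => ?_
        rw [_root_.map_pow]; exact pow_le_one' (hv j) _
  exact h univ

end Places

section PlaceOverOrderRing
open scoped WithZero
variable {R : Type u} [CommRing R] [IsLocalRing R] {c : ℕ}
variable [IsNoetherianRing R] [IsDomain R] {K : Type u} [Field K] [Algebra R K] [IsFractionRing R K]
variable {x : Fin (c + 1) → R} (hx : IsParameters x) (hp : PowRegular x)
variable {w : Valuation K ℤᵐ⁰} (hO : ∀ z ∈ orderRing K hx hp, w z ≤ 1)
include hO

omit [IsNoetherianRing R] [IsDomain R] in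
lemma valuation_le_pow_of_mem {n : ℕ} {a : R} (ha : a ∈ genIdeal x ^ n) :
    w (algebraMap R K a) ≤ w (algebraMap R K (x 0)) ^ n := by
  have h0 := algebraMap_ne_zero_of_ne_zero (K := K) (hx.unitForm hp 0).ne_zero
  have h := hO _ (div_mem_orderRing hx hp ha (hx.unitForm_pow hp 0 n))
  rw [map_div₀, map_pow, map_pow] at h
  rwa [div_le_one₀ (pow_pos ((Valuation.pos_iff _).2 h0) n)] at h

omit [IsNoetherianRing R] [IsDomain R] in
lemma UnitForm.valuation_eq {n : ℕ} {b : R} (hb : UnitForm x n b) :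
    w (algebraMap R K b) = w (algebraMap R K (x 0)) ^ n := by
  refine le_antisymm (valuation_le_pow_of_mem hx hp hO hb.1) ?_
  have h0 := algebraMap_ne_zero_of_ne_zero (K := K) hb.ne_zero
  have h := hO _ (div_mem_orderRing hx hp (hx.unitForm_pow hp 0 n).1 hb)
  rw [map_div₀, map_pow, map_pow] at h
  rwa [div_le_one₀ ((Valuation.pos_iff _).2 h0)] at h

omit [IsNoetherianRing R] [IsDomain R] in
lemma valuation_lt_one_of_mem_maximalIdeal (h0 : w (algebraMap R K (x 0)) < 1) {r : R}
    (hr : r ∈ maximalIdeal R) : w (algebraMap R K r) < 1 := by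
  obtain ⟨N, hN⟩ := hx.2
  have h := valuation_le_pow_of_mem hx hp hO (n := 1) (a := r ^ N)
    (by rw [pow_one]; exact hN (Ideal.pow_mem_pow hr N))
  rw [pow_one, map_pow, map_pow] at h
  by_contra hlt
  exact absurd (h.trans_lt h0) (not_lt.2 (one_le_pow_of_one_le' (not_lt.1 hlt) N))

lemma valuation_le_pow_of_mem_almostClosure {n : ℕ} {z : R}
    (hz : z ∈ almostClosure (genIdeal x ^ n)) :
    w (algebraMap R K z) ≤ w (algebraMap R K (x 0)) ^ n := by
  obtain ⟨M, hM, a, ha, h⟩ := AlmostIntegralOver.mem_integralOverIdeal hz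
  by_contra hlt
  rw [not_le] at hlt
  have hz0 : 0 < w (algebraMap R K z) := lt_of_le_of_lt zero_le hlt
  have h1 : w (algebraMap R K (∑ j ∈ Icc 1 M, a j * z ^ (M - j))) < w (algebraMap R K z) ^ M := by
    rw [map_sum]
    refine Valuation.map_sum_lt _ (pow_pos hz0 M).ne' fun j hj => ?_
    rw [mem_Icc] at hj
    have h2 := valuation_le_pow_of_mem hx hp hO (n := n * j) (by rw [pow_mul]; exact ha j hj.1 hj.2)
    rw [map_mul, map_mul, map_pow, map_pow]
    calc _ < w (algebraMap R K z) ^ j * w (algebraMap R K z) ^ (M - j) := by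
          refine mul_lt_mul_of_pos_right (h2.trans_lt ?_) (pow_pos hz0 _)
          rw [pow_mul]
          exact pow_lt_pow_left₀ hlt zero_le (by omega)
      _ = _ := by rw [← pow_add]; congr 1; omega
  rw [← map_pow, ← map_pow, ← Valuation.map_neg, ← map_neg] at h1
  rw [eq_neg_of_add_eq_zero_left h] at h1
  exact lt_irrefl _ h1

omit [IsNoetherianRing R] [IsDomain R] in
lemma valuation_div_le_one (i : Fin (c + 1)) :
    w (algebraMap R K (x i) / algebraMap R K (x 0)) ≤ 1 :=
  hO _ (div_mem_orderRing hx hp (hx.unitForm hp i).1 (hx.unitForm hp 0))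

omit [IsLocalRing R] [IsNoetherianRing R] [IsDomain R] [IsFractionRing R K] in
omit hO in
lemma monom_div (x : Fin (c + 1) → R) (α : Fin (c + 1) →₀ ℕ) :
    monom (fun i => algebraMap R K (x i) / algebraMap R K (x 0)) α =
      algebraMap R K (monom x α) / algebraMap R K (x 0) ^ α.degree := by
  simp only [monom, div_pow, prod_div_distrib, map_prod, map_pow, Finsupp.degree_eq_sum,
    prod_pow_eq_pow_sum]

variable {L : Type*} [Field L] {θ : K → L} (hθ : IsPlace w θ)
include hθ

omit [IsNoetherianRing R] [IsDomain R] in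
/-- The residue of a form of degree `n` divided by the `n`-th power of `x 0`. -/
lemma IsPlace.map_sum_monom_div (n : ℕ) (a : (Fin (c + 1) →₀ ℕ) → R) :
    θ (algebraMap R K (∑ α ∈ degFinset (c + 1) n, a α * monom x α) / algebraMap R K (x 0) ^ n) =
      ∑ α ∈ degFinset (c + 1) n, θ (algebraMap R K (a α)) *
        monom (fun i => θ (algebraMap R K (x i) / algebraMap R K (x 0))) α := by
  have h1 : ∀ r, w (algebraMap R K r) ≤ 1 := fun r => hO _ (algebraMap_mem_orderRing hx hp r)
  have h2 : ∀ α, w (monom (fun i => algebraMap R K (x i) / algebraMap R K (x 0)) α) ≤ 1 := by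
    intro α
    rw [monom, map_prod]
    refine prod_le_one' fun i _ => ?_
    rw [_root_.map_pow]
    exact pow_le_one' (valuation_div_le_one hx hp hO i) _
  have h3 : algebraMap R K (∑ α ∈ degFinset (c + 1) n, a α * monom x α) / algebraMap R K (x 0) ^ n
      = ∑ α ∈ degFinset (c + 1) n, algebraMap R K (a α) *
        monom (fun i => algebraMap R K (x i) / algebraMap R K (x 0)) α := by
    rw [_root_.map_sum, sum_div]
    refine sum_congr rfl fun α hα => ?_
    rw [monom_div, mem_degFinset.1 hα, _root_.map_mul, mul_div_assoc]
  rw [h3, hθ.map_sum _ _ fun α _ => by rw [_root_.map_mul]; exact mul_le_one' (h1 _) (h2 _)]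
  refine sum_congr rfl fun α _ => ?_
  rw [hθ.map_mul _ _ (h1 _) (h2 _), hθ.map_monom (valuation_div_le_one hx hp hO)]

omit [IsNoetherianRing R] [IsDomain R] in
/-- The map induced on the residue field by a place centered at the maximal ideal. -/
lemma IsPlace.exists_residueField_hom (h0 : w (algebraMap R K (x 0)) < 1) :
    ∃ f : ResidueField R →+* L, ∀ r, f (residue R r) = θ (algebraMap R K r) := by
  have h1 : ∀ r, w (algebraMap R K r) ≤ 1 := fun r => hO _ (algebraMap_mem_orderRing hx hp r)
  let g : R →+* L :=
    { toFun := fun r => θ (algebraMap R K r)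
      map_one' := by rw [_root_.map_one, hθ.map_one]
      map_zero' := by rw [_root_.map_zero, hθ.map_zero]
      map_add' := fun r s => by rw [_root_.map_add, hθ.map_add _ _ (h1 _) (h1 _)]
      map_mul' := fun r s => by rw [_root_.map_mul, hθ.map_mul _ _ (h1 _) (h1 _)] }
  exact ⟨Ideal.Quotient.lift (maximalIdeal R) g fun r hr => (hθ.eq_zero_iff _ (h1 r)).2
    (valuation_lt_one_of_mem_maximalIdeal hx hp hO h0 hr), fun r => rfl⟩

omit [IsNoetherianRing R] [IsDomain R] in
lemma IsPlace.mem_maximalIdeal_of_sum_eq_zero (n : ℕ) (a : (Fin (c + 1) →₀ ℕ) → R)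
    (h : ∑ α ∈ degFinset (c + 1) n, θ (algebraMap R K (a α)) *
        monom (fun i => θ (algebraMap R K (x i) / algebraMap R K (x 0))) α = 0) :
    ∀ α ∈ degFinset (c + 1) n, a α ∈ maximalIdeal R := by
  rw [← hθ.map_sum_monom_div hx hp hO n a] at h
  refine hp.mem_of_sum_mem hx.genIdeal_le ?_
  by_contra hcon
  have hu : UnitForm x n (∑ α ∈ degFinset (c + 1) n, a α * monom x α) :=
    ⟨mem_pow_genIdeal_iff.2 ⟨a, rfl⟩, hcon⟩
  have h0 := algebraMap_ne_zero_of_ne_zero (K := K) (hx.unitForm hp 0).ne_zero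
  have h1 : w (algebraMap R K (∑ α ∈ degFinset (c + 1) n, a α * monom x α) /
      algebraMap R K (x 0) ^ n) = 1 := by
    rw [map_div₀, hu.valuation_eq hx hp hO, _root_.map_pow]
    exact div_self (pow_ne_zero _ ((Valuation.ne_zero_iff _).2 h0))
  exact absurd ((hθ.eq_zero_iff _ h1.le).1 h) h1.not_lt

omit [IsNoetherianRing R] [IsDomain R] in
lemma IsPlace.algebraicIndependent [Algebra (ResidueField R) L]
    (hk : ∀ r, algebraMap (ResidueField R) L (residue R r) = θ (algebraMap R K r)) :
    AlgebraicIndependent (ResidueField R)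
      (fun j : Fin c => θ (algebraMap R K (x j.succ) / algebraMap R K (x 0))) := by
  classical
  rw [algebraicIndependent_iff]
  intro P hP
  have h0 := algebraMap_ne_zero_of_ne_zero (K := K) (hx.unitForm hp 0).ne_zero
  choose l hl using residue_surjective (R := R)
  set u : Fin (c + 1) → L := fun i => θ (algebraMap R K (x i) / algebraMap R K (x 0)) with hu
  have hu0 : u 0 = 1 := by rw [hu]; simp only [div_self h0, hθ.map_one]
  set N := P.totalDegree with hN
  let a : (Fin (c + 1) →₀ ℕ) → R := fun α => l (P.coeff α.tail)
  have hcons : ∀ (m : ℕ) (β : Fin c →₀ ℕ), (β.cons m).degree = m + β.degree := by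
    intro m β
    simp [Finsupp.degree_eq_sum, Fin.sum_univ_succ]
  have hdeg : ∀ β : Fin c →₀ ℕ, β.degree ≤ N → (β.cons (N - β.degree)).degree = N := by
    intro β hβ
    rw [hcons]
    omega
  have h1 : ∑ α ∈ degFinset (c + 1) N, θ (algebraMap R K (a α)) * monom u α = 0 := by
    rw [← hP, MvPolynomial.aeval_def, MvPolynomial.eval₂_eq']
    refine (sum_of_injOn (fun β => β.cons (N - β.degree)) ?_ ?_ ?_ ?_).symm
    · intro β _ γ _ h
      have := congrArg Finsupp.tail h
      simpa using this
    · intro β hβ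
      exact mem_degFinset.2 (hdeg β (MvPolynomial.le_totalDegree hβ))
    · intro α hα hα'
      have h2 : P.coeff α.tail = 0 := by
        by_contra hne
        refine hα' ⟨α.tail, MvPolynomial.mem_support_iff.2 hne, ?_⟩
        have h3 := mem_degFinset.1 hα
        rw [← Finsupp.cons_tail α, hcons] at h3
        conv_rhs => rw [← Finsupp.cons_tail α]
        simp only
        congr 1
        omega
      rw [← hk, hl, h2, _root_.map_zero, zero_mul]
    · intro β _
      simp only [a, ← hk, hl, Finsupp.tail_cons, monom, Fin.prod_univ_succ, hu0, one_pow, one_mul,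
        Finsupp.cons_succ]
      rfl
  ext β
  rw [MvPolynomial.coeff_zero]
  by_cases hβ : β ∈ P.support
  · have h2 : β.degree ≤ N := MvPolynomial.le_totalDegree hβ
    have h3 := hθ.mem_maximalIdeal_of_sum_eq_zero hx hp hO N a h1 (β.cons (N - β.degree))
      (mem_degFinset.2 (hdeg β h2))
    rw [← residue_eq_zero_iff] at h3
    simpa [a, hl] using h3
  · exact MvPolynomial.notMem_support_iff.1 hβ

end PlaceOverOrderRing

section Itoh
open scoped WithZero
variable {R : Type u} [CommRing R] [IsLocalRing R] {c : ℕ}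
variable [IsNoetherianRing R] [IsDomain R] {x : Fin (c + 1) → R}

lemma IsPlace.degreeBounded {K : Type u} [Field K] [Algebra R K] [IsFractionRing R K]
    (hx : IsParameters x) (hp : PowRegular x) {w : Valuation K ℤᵐ⁰}
    (hO : ∀ z ∈ orderRing K hx hp, w z ≤ 1) {L : Type*} [Field L] {θ : K → L} (hθ : IsPlace w θ)
    [Algebra (ResidueField R) L]
    (hk : ∀ r, algebraMap (ResidueField R) L (residue R r) = θ (algebraMap R K r)) {p e : ℕ}
    {r : R} (hr : r ∈ almostClosure (genIdeal x ^ p)) {s : L}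
    (hs : s ^ e = θ (algebraMap R K r / algebraMap R K (x 0) ^ p)) :
    DegreeBounded (ResidueField R) (fun i => θ (algebraMap R K (x i) / algebraMap R K (x 0)))
      e p s := by
  have h0 := algebraMap_ne_zero_of_ne_zero (K := K) (hx.unitForm hp 0).ne_zero
  have hw0 : 0 < w (algebraMap R K (x 0)) := (Valuation.pos_iff _).2 h0
  have hdiv : ∀ {n : ℕ} {z : R}, w (algebraMap R K z) ≤ w (algebraMap R K (x 0)) ^ n →
      w (algebraMap R K z / algebraMap R K (x 0) ^ n) ≤ 1 := by
    intro n z hz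
    rw [map_div₀, _root_.map_pow]
    exact (div_le_one₀ (pow_pos hw0 n)).2 hz
  have hy := hdiv (valuation_le_pow_of_mem_almostClosure hx hp hO hr)
  obtain ⟨M, -, b, hb, h⟩ := AlmostIntegralOver.mem_integralOverIdeal hr
  have hb' : ∀ j, 1 ≤ j → j ≤ M → b j ∈ genIdeal x ^ (p * j) := fun j h1 h2 => by
    rw [pow_mul]; exact hb j h1 h2
  refine degreeBounded_of_integral_equation (M := M)
    (a := fun j => θ (algebraMap R K (b j) / algebraMap R K (x 0) ^ (p * j))) ?_ ?_
  · intro j h1 h2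
    obtain ⟨g, hg⟩ := mem_pow_genIdeal_iff.1 (hb' j h1 h2)
    rw [hg, hθ.map_sum_monom_div hx hp hO]
    refine Submodule.sum_mem _ fun α hα => ?_
    rw [← hk, ← Algebra.smul_def]
    exact Submodule.smul_mem _ _ (Submodule.subset_span ⟨α, hα, rfl⟩)
  · rw [hs, ← hθ.map_pow hy]
    have hpow : ∀ n, w ((algebraMap R K r / algebraMap R K (x 0) ^ p) ^ n) ≤ 1 := fun n => by
      rw [_root_.map_pow]; exact pow_le_one' hy n
    have hbj : ∀ j ∈ Icc 1 M, w (algebraMap R K (b j) / algebraMap R K (x 0) ^ (p * j)) ≤ 1 := by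
      intro j hj
      rw [mem_Icc] at hj
      exact hdiv (valuation_le_pow_of_mem hx hp hO (hb' j hj.1 hj.2))
    have hterm : ∀ j ∈ Icc 1 M, w (algebraMap R K (b j) / algebraMap R K (x 0) ^ (p * j) *
        (algebraMap R K r / algebraMap R K (x 0) ^ p) ^ (M - j)) ≤ 1 := fun j hj => by
      rw [_root_.map_mul]; exact mul_le_one' (hbj j hj) (hpow _)
    have hsum : ∑ j ∈ Icc 1 M, θ (algebraMap R K (b j) / algebraMap R K (x 0) ^ (p * j)) *
        θ (algebraMap R K r / algebraMap R K (x 0) ^ p) ^ (M - j) =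
        θ (∑ j ∈ Icc 1 M, algebraMap R K (b j) / algebraMap R K (x 0) ^ (p * j) *
        (algebraMap R K r / algebraMap R K (x 0) ^ p) ^ (M - j)) := by
      rw [hθ.map_sum _ _ hterm]
      refine sum_congr rfl fun j hj => ?_
      rw [hθ.map_mul _ _ (hbj j hj) (hpow _), hθ.map_pow hy]
    rw [hsum, ← hθ.map_add _ _ (hpow M) (Valuation.map_sum_le _ hterm)]
    have hzero : (algebraMap R K r / algebraMap R K (x 0) ^ p) ^ M +
        ∑ j ∈ Icc 1 M, algebraMap R K (b j) / algebraMap R K (x 0) ^ (p * j) *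
        (algebraMap R K r / algebraMap R K (x 0) ^ p) ^ (M - j) = 0 := by
      have h2 : ∀ j ∈ Icc 1 M, algebraMap R K (b j) / algebraMap R K (x 0) ^ (p * j) *
          (algebraMap R K r / algebraMap R K (x 0) ^ p) ^ (M - j) =
          algebraMap R K (b j * r ^ (M - j)) / algebraMap R K (x 0) ^ (p * M) := by
        intro j hj
        rw [mem_Icc] at hj
        rw [div_pow, div_mul_div_comm, ← pow_mul, ← pow_add, _root_.map_mul, _root_.map_pow,
          ← mul_add]
        congr 3
        omega
      rw [sum_congr rfl h2, ← sum_div, div_pow, ← pow_mul, ← add_div, ← _root_.map_pow,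
        ← _root_.map_sum, ← _root_.map_add, h, _root_.map_zero, zero_div]
    rw [hzero, hθ.map_zero]

/-- The associated graded ring of the filtration of integral closures of powers of a parameter
ideal `J` contains the polynomial ring over `R` modulo the integral closure of `J`. -/
theorem IsRegularLocalOfDim.mem_almostClosure_of_sum_mem (h : IsRegularLocalOfDim R (c + 1))
    (hx : IsParameters x) {n : ℕ} {a : (Fin (c + 1) →₀ ℕ) → R}
    (hs : ∑ α ∈ degFinset (c + 1) n, a α * monom x α ∈ almostClosure (genIdeal x ^ (n + 1))) :
    ∀ α ∈ degFinset (c + 1) n, a α ∈ almostClosure (genIdeal x) := by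
  have hp := hx.powRegular h
  intro α hα
  by_contra hc
  obtain ⟨w, hO, hw0, β, hβ, haβ, hmax, p, e, hpe, hwβ, hcl⟩ :=
    exists_extremal_valuation (K := FractionRing R) hx hp h 0 (degFinset (c + 1) n) a hα hc
  obtain ⟨L, _, _, θ, hθ⟩ := exists_isPlace w
  obtain ⟨f, hf⟩ := hθ.exists_residueField_hom hx hp hO hw0
  let _ : Algebra (ResidueField R) L := f.toAlgebra
  have hk : ∀ r, algebraMap (ResidueField R) L (residue R r) = θ (algebraMap R _ r) := hf
  set v := algebraMap R (FractionRing R) with hv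
  set u : Fin (c + 1) → L := fun i => θ (v (x i) / v (x 0)) with hu
  have h0 : v (x 0) ≠ 0 := algebraMap_ne_zero_of_ne_zero (hx.unitForm hp 0).ne_zero
  have hwx : 0 < w (v (x 0)) := (Valuation.pos_iff _).2 h0
  have hβ0 : v (a β) ≠ 0 := algebraMap_ne_zero_of_ne_zero haβ
  have hwb : 0 < w (v (a β)) := (Valuation.pos_iff _).2 hβ0
  have hlt : w (v (x 0)) < w (v (a β)) := by
    refine lt_of_pow_lt_pow_left₀ e zero_le ?_
    rw [hwβ]
    exact pow_lt_pow_right_of_lt_one₀ hwx hw0 hpe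
  have hρ : ∀ γ ∈ degFinset (c + 1) n, w (v (a γ) / v (a β)) ≤ 1 := by
    intro γ hγ
    rw [map_div₀]
    exact (div_le_one₀ hwb).2 (hmax γ hγ)
  have hmon : ∀ γ, w (monom (fun i => v (x i) / v (x 0)) γ) ≤ 1 := by
    intro γ
    rw [monom, map_prod]
    refine prod_le_one' fun i _ => ?_
    rw [_root_.map_pow]
    exact pow_le_one' (valuation_div_le_one hx hp hO i) _
  have hsum : ∑ γ ∈ degFinset (c + 1) n, θ (v (a γ) / v (a β)) * monom u γ = 0 := by
    have h1 : ∀ γ ∈ degFinset (c + 1) n, θ (v (a γ) / v (a β)) * monom u γ =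
        θ (v (a γ) / v (a β) * monom (fun i => v (x i) / v (x 0)) γ) := fun γ hγ => by
      rw [hθ.map_mul _ _ (hρ γ hγ) (hmon γ), hθ.map_monom (valuation_div_le_one hx hp hO)]
    have h2 : ∀ γ ∈ degFinset (c + 1) n,
        w (v (a γ) / v (a β) * monom (fun i => v (x i) / v (x 0)) γ) ≤ 1 := fun γ hγ => by
      rw [_root_.map_mul]; exact mul_le_one' (hρ γ hγ) (hmon γ)
    rw [sum_congr rfl h1, ← hθ.map_sum _ _ h2, hθ.eq_zero_iff _ (Valuation.map_sum_le _ h2)]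
    have h3 : ∑ γ ∈ degFinset (c + 1) n,
        v (a γ) / v (a β) * monom (fun i => v (x i) / v (x 0)) γ =
        v (∑ γ ∈ degFinset (c + 1) n, a γ * monom x γ) / (v (a β) * v (x 0) ^ n) := by
      rw [_root_.map_sum, sum_div]
      refine sum_congr rfl fun γ hγ => ?_
      rw [monom_div, mem_degFinset.1 hγ, div_mul_div_comm, ← _root_.map_mul]
    rw [h3, map_div₀, _root_.map_mul, _root_.map_pow, div_lt_one₀ (mul_pos hwb (pow_pos hwx n))]
    refine (valuation_le_pow_of_mem_almostClosure hx hp hO hs).trans_lt ?_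
    rw [pow_succ, mul_comm]
    exact mul_lt_mul_of_pos_right hlt (pow_pos hwx n)
  have hone : w (v (a β) ^ e / v (x 0) ^ p) = 1 := by
    rw [map_div₀, _root_.map_pow, _root_.map_pow, hwβ, div_self (pow_pos hwx p).ne']
  obtain ⟨σ, hσ⟩ := IsAlgClosed.exists_pow_nat_eq (θ (v (a β) ^ e / v (x 0) ^ p))
    (show 0 < e by omega)
  have hσ0 : σ ≠ 0 := by
    rintro rfl
    rw [zero_pow (by omega)] at hσ
    exact absurd ((hθ.eq_zero_iff _ hone.le).1 hσ.symm) hone.not_lt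
  have hu0 : u 0 = 1 := by rw [hu]; simp only [div_self h0, hθ.map_one]
  have hind := hθ.algebraicIndependent hx hp hO hk
  have htr : ∀ i ≠ 0, Transcendental (Algebra.adjoin (ResidueField R) (u '' {i}ᶜ)) (u i) := by
    intro i hi
    obtain ⟨j, rfl⟩ := Fin.exists_succ_eq.2 hi
    have h1 := hind.transcendental_adjoin (s := {j}ᶜ) (i := j) (by simp)
    have h2 : Algebra.adjoin (ResidueField R) (u '' {j.succ}ᶜ) = Algebra.adjoin (ResidueField R)
        ((fun j : Fin c => θ (v (x j.succ) / v (x 0))) '' {j}ᶜ) := by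
      refine le_antisymm (Algebra.adjoin_le ?_) (Algebra.adjoin_mono ?_)
      · rintro _ ⟨l, hl, rfl⟩
        rcases Fin.eq_zero_or_eq_succ l with rfl | ⟨l, rfl⟩
        · rw [hu0]; exact one_mem _
        · exact Algebra.subset_adjoin ⟨l, fun hh => hl (by rw [Set.mem_singleton_iff.1 hh]; rfl), rfl⟩
      · rintro _ ⟨l, hl, rfl⟩
        exact ⟨l.succ, fun hh => hl (Fin.succ_injective _ hh), rfl⟩
    rw [h2]
    exact h1
  have key := DegreeBounded.eq_zero_of_sum (k := ResidueField R) hu0 htr hpe (univ.erase 0)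
    (by simp) (degFinset (c + 1) n) ?_ (s := fun γ => θ (v (a γ) / v (a β)) * σ) ?_ ?_ β hβ
  · simp only [div_self hβ0, hθ.map_one, one_mul] at key
    exact hσ0 key
  · intro γ hγ δ hδ hγδ
    have h1 : ∀ j : Fin c, γ j.succ = δ j.succ := fun j => hγδ _ (by simp)
    have h2 := (mem_degFinset.1 hγ).trans (mem_degFinset.1 hδ).symm
    simp only [Finsupp.degree_eq_sum, Fin.sum_univ_succ, h1] at h2
    ext l
    rcases Fin.eq_zero_or_eq_succ l with rfl | ⟨l, rfl⟩
    · omega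
    · exact h1 l
  · intro γ hγ
    refine hθ.degreeBounded hx hp hO hk (hcl γ hγ) ?_
    rw [mul_pow, hσ, ← hθ.map_pow (hρ γ hγ), ← hθ.map_mul _ _ ?_ hone.le]
    · congr 1
      rw [_root_.map_pow, div_pow, div_mul_div_cancel₀ (pow_ne_zero e hβ0)]
    · rw [_root_.map_pow]; exact pow_le_one' (hρ γ hγ) e
  · calc _ = (∑ γ ∈ degFinset (c + 1) n, θ (v (a γ) / v (a β)) * monom u γ) * σ := by
          rw [sum_mul]
          exact sum_congr rfl fun γ _ => by ring
      _ = 0 := by rw [hsum, zero_mul]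

end Itoh

section SecondBound
variable {R : Type u} [CommRing R] [IsLocalRing R] {c : ℕ}
variable [IsNoetherianRing R] [IsDomain R] {x : Fin (c + 1) → R}

omit [IsLocalRing R] [IsNoetherianRing R] in
lemma almostClosure_mono {I I' : Ideal R} (h : I ≤ I') : almostClosure I ≤ almostClosure I' :=
  fun _ hz => mem_almostClosure.2 ((mem_almostClosure.1 hz).mono h)

lemma IsRegularLocalOfDim.leadIdeal_almostClosure_le (h : IsRegularLocalOfDim R (c + 1))
    (hx : IsParameters x) {N : ℕ} {α : Fin (c + 1) →₀ ℕ} (hα : α.degree < N) :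
    leadIdeal x (almostClosure (genIdeal x ^ N)) α ≤ almostClosure (genIdeal x) := by
  classical
  intro a ha
  obtain ⟨g, hg, k, hk, hgk⟩ := Submodule.mem_sup.1 (mem_colonBy.1 ha)
  set S := (degFinset (c + 1) α.degree).erase α with hS
  have h1 : higherIdeal x α ≤ Ideal.span (monom x '' S) ⊔ genIdeal x ^ (α.degree + 1) := by
    refine Ideal.span_le.2 ?_
    rintro _ ⟨β, hβ, rfl⟩
    have hβ' : toDegLex α < toDegLex β := hβ
    have hdeg : α.degree ≤ β.degree := Finsupp.DegLex.monotone_degree hβ'.le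
    rcases hdeg.eq_or_lt with heq | hlt
    · refine Ideal.mem_sup_left (Ideal.subset_span ⟨β, ?_, rfl⟩)
      rw [mem_coe, hS, mem_erase, mem_degFinset]
      exact ⟨by rintro rfl; exact lt_irrefl _ hβ', heq.symm⟩
    · exact Ideal.mem_sup_right (Ideal.pow_le_pow_right hlt (monom_mem_pow x β))
  obtain ⟨s, hs, j, hj, rfl⟩ := Submodule.mem_sup.1 (h1 hk)
  obtain ⟨b, rfl⟩ := (Submodule.mem_span_image_finset_iff_exists_fun' R).1 hs
  have h2 : ∑ β ∈ degFinset (c + 1) α.degree, (if β = α then a else - b β) * monom x β ∈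
      almostClosure (genIdeal x ^ (α.degree + 1)) := by
    rw [← add_sum_erase _ _ (mem_degFinset.2 rfl), if_pos rfl, ← hS]
    have h3 : a * monom x α + ∑ β ∈ S, (if β = α then a else - b β) * monom x β = g + j := by
      have h4 : ∑ β ∈ S, (if β = α then a else - b β) * monom x β = - ∑ β ∈ S, b β • monom x β := by
        rw [← sum_neg_distrib]
        refine sum_congr rfl fun β hβ => ?_
        rw [if_neg (ne_of_mem_erase hβ), smul_eq_mul, neg_mul]
      rw [h4, ← hgk]
      ring
    rw [h3]
    exact Ideal.add_mem _ (almostClosure_mono (Ideal.pow_le_pow_right hα) hg)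
      (pow_le_almostClosure _ hj)
  have := h.mem_almostClosure_of_sum_mem hx h2 α (mem_degFinset.2 rfl)
  rwa [if_pos rfl] at this

lemma le_colength_almostClosure {p : ℕ} (h : IsRegularLocalOfDim R (c + 1)) (hx : IsParameters x)
    (hx0 : genIdeal x ≠ ⊥) :
    colength (genIdeal x) * ((p + c).choose (c + 1) : ℕ) +
      ((p + c).choose c : ℕ) * (c * colength (almostClosure (genIdeal x))) ≤
      colength (almostClosure (genIdeal x ^ (p + c))) := by
  have hp := hx.powRegular h
  have hB : almostClosure (genIdeal x ^ (p + c)) ≤ genIdeal x ^ p := by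
    simpa using almostClosure_pow_le h (Nat.succ_pos c) hx0 hp (p + c)
  have h1 := le_colength_of_le hp (pow_le_almostClosure _) hB
    (fun _ => colength (almostClosure (genIdeal x))) fun i hi α hα => colength_anti
      (h.leadIdeal_almostClosure_le hx (by rw [mem_degFinset.1 hα]; omega))
  rwa [sum_const, card_range, nsmul_eq_mul] at h1

end SecondBound

section Asymptotics
open Filter Topology

lemma tendsto_choose_div_pow (a k : ℕ) :
    Tendsto (fun n : ℕ => ((n + a).choose k : ℝ) / (n : ℝ) ^ k) atTop (𝓝 (1 / k.factorial)) := by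
  have h1 : Tendsto (fun n : ℕ => (n.choose k : ℝ) / (n : ℝ) ^ k) atTop (𝓝 (1 / k.factorial)) := by
    have h := (isEquivalent_choose k).div (Asymptotics.IsEquivalent.refl
      (u := fun n : ℕ => (n : ℝ) ^ k) (l := atTop))
    refine h.symm.tendsto_nhds (Tendsto.congr' ?_ tendsto_const_nhds)
    filter_upwards [eventually_gt_atTop 0] with n hn
    have : (n : ℝ) ^ k ≠ 0 := pow_ne_zero _ (by exact_mod_cast hn.ne')
    simp only [Pi.div_apply]
    field_simp
  have h2 : Tendsto (fun n : ℕ => ((n + a : ℕ) : ℝ) / (n : ℝ)) atTop (𝓝 1) := by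
    have h3 := (tendsto_const_div_atTop_nhds_zero_nat (a : ℝ)).const_add 1
    rw [add_zero] at h3
    refine h3.congr' ?_
    filter_upwards [eventually_gt_atTop 0] with n hn
    have : (n : ℝ) ≠ 0 := by exact_mod_cast hn.ne'
    push_cast
    field_simp
  have h4 := (h1.comp (tendsto_add_atTop_nat a)).mul (h2.pow k)
  rw [one_pow, mul_one] at h4
  refine h4.congr' ?_
  filter_upwards [eventually_gt_atTop 0] with n hn
  have : (n : ℝ) ≠ 0 := by exact_mod_cast hn.ne'
  have h5 : ((n + a : ℕ) : ℝ) ≠ 0 := by exact_mod_cast (by omega : n + a ≠ 0)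
  simp only [Function.comp_apply]
  rw [div_pow]
  field_simp

lemma tendsto_sum_choose_div_pow (m : ℕ) (b : ℕ → ℝ) :
    Tendsto (fun n : ℕ => (∑ i ∈ range (m + 1), b i * ((n + m - i).choose (m - i) : ℝ)) /
      (n : ℝ) ^ m) atTop (𝓝 (b 0 / m.factorial)) := by
  have h1 : ∀ i ∈ range (m + 1), Tendsto (fun n : ℕ =>
      b i * ((n + m - i).choose (m - i) : ℝ) / (n : ℝ) ^ m) atTop
      (𝓝 (if i = 0 then b 0 / m.factorial else 0)) := by
    intro i hi
    rw [mem_range] at hi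
    obtain ⟨k, rfl⟩ : ∃ k, m = k + i := ⟨m - i, by omega⟩
    have h2 := ((tendsto_choose_div_pow k k).const_mul (b i)).mul
      (tendsto_inv_atTop_nhds_zero_nat (𝕜 := ℝ) |>.pow i)
    have h3 : b i * (1 / k.factorial) * (0 : ℝ) ^ i =
        if i = 0 then b 0 / (k + i).factorial else 0 := by
      split_ifs with h0
      · subst h0; simp; ring
      · rw [zero_pow h0, mul_zero]
    rw [h3] at h2
    refine h2.congr' ?_
    filter_upwards [eventually_gt_atTop 0] with n hn
    have : (n : ℝ) ≠ 0 := by exact_mod_cast hn.ne'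
    rw [show n + (k + i) - i = n + k by omega, show k + i - i = k by omega, inv_pow, pow_add]
    field_simp
  have h2 := tendsto_finsetSum _ h1
  simp only [← sum_div] at h2
  simpa using h2

variable {c : ℕ}

lemma sum_choose_eq_of_coeff_zero_eq {e e' : ℕ → ℤ} (h : e 0 = e' 0) (n : ℕ) :
    ∑ i ∈ range (c + 1 + 1), (-1 : ℤ) ^ i * e i * ((n + (c + 1) - i).choose (c + 1 - i) : ℤ) -
      ∑ i ∈ range (c + 1 + 1), (-1 : ℤ) ^ i * e' i * ((n + (c + 1) - i).choose (c + 1 - i) : ℤ) =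
    ∑ i ∈ range (c + 1), (-1) ^ i * (e' (i + 1) - e (i + 1)) * ((n + c - i).choose (c - i) : ℤ) := by
  rw [← sum_sub_distrib, sum_range_succ', h, sub_self, add_zero]
  refine sum_congr rfl fun i _ => ?_
  rw [show n + (c + 1) - (i + 1) = n + c - i by omega, show c + 1 - (i + 1) = c - i by omega]
  ring

lemma coeff_zero_le {e : ℕ → ℤ} {a q m : ℕ}
    (h : ∀ᶠ n : ℕ in atTop, ((q * (n + a).choose m : ℕ) : ℤ) ≤
      ∑ i ∈ range (m + 1), (-1 : ℤ) ^ i * e i * ((n + m - i).choose (m - i) : ℤ)) :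
    (q : ℤ) ≤ e 0 := by
  have h1 := (tendsto_choose_div_pow a m).const_mul (q : ℝ)
  have h2 := tendsto_sum_choose_div_pow m fun i => (((-1 : ℤ) ^ i * e i : ℤ) : ℝ)
  have h3 := le_of_tendsto_of_tendsto h1 h2 ?_
  · have : (0 : ℝ) < m.factorial := by exact_mod_cast m.factorial_pos
    rw [mul_one_div, div_le_div_iff_of_pos_right this] at h3
    simp only [pow_zero, one_mul] at h3
    exact_mod_cast h3
  · filter_upwards [h] with n hn
    rw [← mul_div_assoc]
    refine div_le_div_of_nonneg_right ?_ (by positivity)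
    exact_mod_cast hn

lemma le_coeff_zero {e : ℕ → ℤ} {a q m : ℕ}
    (h : ∀ᶠ n : ℕ in atTop, ∑ i ∈ range (m + 1), (-1 : ℤ) ^ i * e i *
      ((n + m - i).choose (m - i) : ℤ) ≤ ((q * (n + a).choose m : ℕ) : ℤ)) :
    e 0 ≤ (q : ℤ) := by
  have h1 := (tendsto_choose_div_pow a m).const_mul (q : ℝ)
  have h2 := tendsto_sum_choose_div_pow m fun i => (((-1 : ℤ) ^ i * e i : ℤ) : ℝ)
  have h3 := le_of_tendsto_of_tendsto h2 h1 ?_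
  · have : (0 : ℝ) < m.factorial := by exact_mod_cast m.factorial_pos
    rw [mul_one_div, div_le_div_iff_of_pos_right this] at h3
    simp only [pow_zero, one_mul] at h3
    exact_mod_cast h3
  · filter_upwards [h] with n hn
    rw [← mul_div_assoc]
    refine div_le_div_of_nonneg_right ?_ (by positivity)
    exact_mod_cast hn

lemma coeff_one_le {e e' : ℕ → ℤ} (h0 : e 0 = e' 0)
    (h : ∀ᶠ n : ℕ in atTop,
      ∑ i ∈ range (c + 1 + 1), (-1 : ℤ) ^ i * e' i * ((n + (c + 1) - i).choose (c + 1 - i) : ℤ) ≤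
      ∑ i ∈ range (c + 1 + 1), (-1 : ℤ) ^ i * e i * ((n + (c + 1) - i).choose (c + 1 - i) : ℤ)) :
    e 1 ≤ e' 1 := by
  have h1 := coeff_zero_le (q := 0) (a := 0) (m := c) (e := fun i => e' (i + 1) - e (i + 1)) ?_
  · simpa using h1
  · filter_upwards [h] with n hn
    rw [← sum_choose_eq_of_coeff_zero_eq h0]
    simpa using hn

lemma choose_add_sum_choose (n c k : ℕ) :
    (n + 1).choose (c + 1) + ∑ j ∈ range k, (n + 1 + j).choose c = (n + k + 1).choose (c + 1) := by
  induction k with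
  | zero => simp
  | succ k ih =>
    rw [sum_range_succ, ← add_assoc, ih, show n + (k + 1) + 1 = (n + k + 1) + 1 by omega,
      Nat.choose_succ_succ' (n + k + 1) c, show n + 1 + k = n + k + 1 by omega]
    omega

lemma coeff_one_add_le {e : ℕ → ℤ} {q s B : ℕ} (h0 : e 0 = q)
    (h : ∀ᶠ n : ℕ in atTop, ((s * (q * (n + 1).choose (c + 1)) + B * (n + 1).choose c : ℕ) : ℤ) ≤
      s * ∑ i ∈ range (c + 1 + 1), (-1 : ℤ) ^ i * e i *
        ((n + (c + 1) - i).choose (c + 1 - i) : ℤ)) :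
    s * e 1 + B ≤ s * (c * q) := by
  have hB := (tendsto_choose_div_pow 1 c).const_mul (B : ℝ)
  have hS := (tendsto_finsetSum (range c) fun j _ => tendsto_choose_div_pow (1 + j) c).const_mul
    ((s : ℝ) * q)
  have hE := (tendsto_sum_choose_div_pow c fun i =>
    (((-1 : ℤ) ^ i * (0 - e (i + 1)) : ℤ) : ℝ)).const_mul (s : ℝ)
  have h3 := le_of_tendsto_of_tendsto (hB.sub hS) hE ?_
  · have hc : (0 : ℝ) < c.factorial := by exact_mod_cast c.factorial_pos
    simp only [sum_const, card_range, nsmul_eq_mul, ← mul_div_assoc, mul_one, ← sub_div] at h3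
    rw [div_le_div_iff_of_pos_right hc] at h3
    have h4 : (s * e 1 + B : ℝ) ≤ s * (c * q) := by
      simp at h3
      linarith
    exact_mod_cast h4
  · filter_upwards [h] with n hn
    rw [← sum_div, ← mul_div_assoc, ← mul_div_assoc, ← mul_div_assoc, ← sub_div]
    refine div_le_div_of_nonneg_right ?_ (by positivity)
    have h5 := sum_choose_eq_of_coeff_zero_eq (c := c) (e := e)
      (e' := fun i => if i = 0 then (q : ℤ) else 0) (by simpa using h0) n
    have h6 : ∑ i ∈ range (c + 1 + 1), (-1 : ℤ) ^ i * (if i = 0 then (q : ℤ) else 0) *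
        ((n + (c + 1) - i).choose (c + 1 - i) : ℤ) = q * (n + c + 1).choose (c + 1) := by
      rw [sum_range_succ']
      simp [add_assoc]
    rw [h6, ← choose_add_sum_choose n c c] at h5
    simp only [Nat.add_eq_zero_iff, one_ne_zero, and_false, if_false] at h5
    have h7 : (B * (n + 1).choose c : ℤ) - s * q * ∑ j ∈ range c, ((n + (1 + j)).choose c : ℤ) ≤
        s * ∑ i ∈ range (c + 1), (-1) ^ i * (0 - e (i + 1)) * ((n + c - i).choose (c - i) : ℤ) := by
      rw [← h5]
      push_cast at hn ⊢
      simp only [add_assoc] at hn ⊢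
      linarith
    exact_mod_cast h7

end Asymptotics

/-- **Polini–Ulrich–Vasconcelos (2005), Corollary 3.4**.  Let `(R,m)` be a regular
Noetherian local ring of dimension `d > 0` with infinite residue field and `I` an
`m`-primary ideal.  Then `e₁(I) ≤ ē₁(I) ≤ (d-1)·min{e₀(I)/2, e₀(I) - λ(R/Ī)}`. -/
theorem normal_chern_bound_of_regular
    {R : Type*} [CommRing R] [IsNoetherianRing R] [IsLocalRing R]
    (d : ℕ) (hd : 0 < d) (hdim : ringKrullDim R = d)
    (hreg : ∃ s : Finset R, Ideal.span (s : Set R) = maximalIdeal R ∧ s.card = d)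
    (hres : Infinite (IsLocalRing.ResidueField R))
    (I : Ideal R) (hI : I.radical = maximalIdeal R)
    (e : ℕ → ℤ) (he : HasHilbertCoeffs I d e)
    (ebar : ℕ → ℤ) (hebar : HasNormalHilbertCoeffs I d ebar)
    (lbar : ℕ)
    (hlbar : moduleLength R (R ⧸ idealIntegralClosure I) = (lbar : WithBot ℕ∞)) :
    e 1 ≤ ebar 1 ∧
      (ebar 1 : ℚ) ≤ ((d : ℚ) - 1) * min ((e 0 : ℚ) / 2) ((e 0 : ℚ) - (lbar : ℚ)) := by
  obtain ⟨hdom, h⟩ := isRegularLocalOfDim_of_span hdim hreg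
  obtain ⟨c, rfl⟩ : ∃ c, d = c + 1 := ⟨d - 1, by omega⟩
  obtain ⟨x, hx, hJI, t, ht⟩ := exists_isParameters hI he.polyBounded
  have hx0 := hx.genIdeal_ne_bot hd hdim
  have hp := hx.powRegular h
  have hI0 : I ≠ ⊥ := fun h0 => hx0 (le_bot_iff.1 (h0 ▸ hJI))
  have hcl : ∀ p, idealIntegralClosure (I ^ p) = almostClosure (genIdeal x ^ p) := fun p => by
    rw [idealIntegralClosure_eq_almostClosure (pow_ne_zero p hI0), almostClosure_congr hx0 hJI ht p]
  obtain ⟨N, hN⟩ := he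
  obtain ⟨N', hN'⟩ := hebar
  obtain ⟨q, hq⟩ : ∃ q : ℕ, colength (genIdeal x) = q := by
    obtain ⟨l, hl, -⟩ := hN (N + t) (by omega)
    have h1 : colength (genIdeal x) ≤ l := by
      rw [← colength_eq_of_moduleLength hl]
      refine colength_anti ((Ideal.pow_le_pow_right (by omega)).trans
        (by simpa using ht 1 : I ^ (1 + t) ≤ genIdeal x))
    exact ⟨_, (ENat.natCast_toNat (ne_top_of_le_ne_top (ENat.natCast_ne_top l) h1)).symm⟩
  have hlb : colength (almostClosure (genIdeal x)) = lbar := by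
    have h1 := hcl 1
    rw [pow_one, pow_one] at h1
    rw [← h1]
    exact colength_eq_of_moduleLength hlbar
  have hupper : ∀ᶠ n : ℕ in Filter.atTop, ∑ i ∈ range (c + 1 + 1), (-1 : ℤ) ^ i * e i *
      ((n + (c + 1) - i).choose (c + 1 - i) : ℤ) ≤
      ((q * (n + (c + 1)).choose (c + 1) : ℕ) : ℤ) := by
    filter_upwards [Filter.eventually_ge_atTop N] with n hn
    obtain ⟨l, hl, hsum⟩ := hN n hn
    rw [← hsum]
    have h1 := colength_anti (Ideal.pow_right_mono hJI (n + 1))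
    rw [colength_eq_of_moduleLength hl, colength_pow_genIdeal hp, hq] at h1
    rw [show n + (c + 1) = n + 1 + c by omega]
    exact_mod_cast h1
  have hmid : ∀ᶠ n : ℕ in Filter.atTop, ∑ i ∈ range (c + 1 + 1), (-1 : ℤ) ^ i * ebar i *
      ((n + (c + 1) - i).choose (c + 1 - i) : ℤ) ≤
      ∑ i ∈ range (c + 1 + 1), (-1 : ℤ) ^ i * e i *
      ((n + (c + 1) - i).choose (c + 1 - i) : ℤ) := by
    filter_upwards [Filter.eventually_ge_atTop N, Filter.eventually_ge_atTop N'] with n hn hn'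
    obtain ⟨l, hl, hsum⟩ := hN n hn
    obtain ⟨l', hl', hsum'⟩ := hN' n hn'
    rw [← hsum, ← hsum']
    have h1 := colength_anti (pow_le_almostClosure (I ^ (n + 1)))
    rw [← idealIntegralClosure_eq_almostClosure (pow_ne_zero _ hI0),
      colength_eq_of_moduleLength hl, colength_eq_of_moduleLength hl'] at h1
    exact_mod_cast h1
  have hlow1 : ∀ᶠ n : ℕ in Filter.atTop,
      ((2 * (q * (n + 1).choose (c + 1)) + c * q * (n + 1).choose c : ℕ) : ℤ) ≤
      (2 : ℕ) * ∑ i ∈ range (c + 1 + 1), (-1 : ℤ) ^ i * ebar i *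
        ((n + (c + 1) - i).choose (c + 1 - i) : ℤ) := by
    filter_upwards [Filter.eventually_ge_atTop N', Filter.eventually_ge_atTop c] with n hn hnc
    obtain ⟨l, hl, hsum⟩ := hN' n hn
    have h1 := two_mul_le_colength_almostClosure (p := n + 1 - c) h hx hx0
    rw [show n + 1 - c + c = n + 1 by omega, ← hcl, colength_eq_of_moduleLength hl, hq] at h1
    rw [← hsum, mul_comm (c * q)]
    exact_mod_cast h1
  have hlow2 : ∀ᶠ n : ℕ in Filter.atTop,
      ((1 * (q * (n + 1).choose (c + 1)) + c * lbar * (n + 1).choose c : ℕ) : ℤ) ≤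
      (1 : ℕ) * ∑ i ∈ range (c + 1 + 1), (-1 : ℤ) ^ i * ebar i *
        ((n + (c + 1) - i).choose (c + 1 - i) : ℤ) := by
    filter_upwards [Filter.eventually_ge_atTop N', Filter.eventually_ge_atTop c] with n hn hnc
    obtain ⟨l, hl, hsum⟩ := hN' n hn
    have h1 := le_colength_almostClosure (p := n + 1 - c) h hx hx0
    rw [show n + 1 - c + c = n + 1 by omega, ← hcl, colength_eq_of_moduleLength hl, hq, hlb] at h1
    rw [← hsum, mul_comm (c * lbar), one_mul, Nat.cast_one, one_mul]
    exact_mod_cast h1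
  have he0 : e 0 ≤ q := le_coeff_zero hupper
  have hebar0 : ebar 0 ≤ q := le_coeff_zero ((hmid.and hupper).mono fun n hn => hn.1.trans hn.2)
  have hebar0' : (q : ℤ) ≤ ebar 0 := by
    refine coeff_zero_le (a := 1) (m := c + 1) (hlow2.mono fun n hn => ?_)
    push_cast at hn ⊢
    rw [one_mul, one_mul] at hn
    exact le_trans (le_add_of_nonneg_right (by positivity)) hn
  have he0' : (q : ℤ) ≤ e 0 := by
    refine coeff_zero_le (a := 1) (m := c + 1) ((hlow2.and hmid).mono fun n hn => ?_)
    refine le_trans ?_ hn.2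
    have hn := hn.1
    push_cast at hn ⊢
    rw [one_mul, one_mul] at hn
    exact le_trans (le_add_of_nonneg_right (by positivity)) hn
  have heq : e 0 = q := le_antisymm he0 he0'
  have heqbar : ebar 0 = q := le_antisymm hebar0 hebar0'
  refine ⟨coeff_one_le (heq.trans heqbar.symm) hmid, ?_⟩
  have h1 := coeff_one_add_le heqbar hlow1
  have h2 := coeff_one_add_le heqbar hlow2
  have h1' : (2 * ebar 1 + c * q : ℚ) ≤ 2 * (c * q) := by exact_mod_cast h1
  have h2' : (1 * ebar 1 + c * lbar : ℚ) ≤ 1 * (c * q) := by exact_mod_cast h2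
  rw [heq, mul_min_of_nonneg _ _ (by simp)]
  refine le_min ?_ ?_
  · push_cast
    linarith
  · push_cast
    linarith
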